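/- Let N ≥ 1, 1 < p < 2, 0 < γ < p, λ₊, λ₋ > 0, δ₀ > 0, M > 0 and d > 0 be given. Then there exist α ∈ (0,1) and C₁ > 0, depending only on N, p, γ, λ₊, λ₋, δ₀, M and d, such that: for every open bounded Ω ⊆ ℝ^N, every δ ∈ [0, δ₀], every local minimizer u of J_δ on Ω with sup_Ω |u| ≤ M, and every set Ω' ⊆ Ω with dist(Ω', ∂Ω) ≥ d, one has sup_{x ∈ Ω'} ‖∇u(x)‖ ≤ C₁ and ‖∇u(x) − ∇u(y)‖ ≤ C₁ ‖x − y‖^α for all x, y ∈ Ω'. -/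

import Mathlib

open MeasureTheory Metric Set
open scoped InnerProductSpace

/-- The Alt–Phillips potential `F_γ(t) = λ₊ (t₊)^γ + λ₋ (t₋)^γ`. -/
noncomputable def Fgam (γ lp lm : ℝ) (t : ℝ) : ℝ :=
  lp * (max t 0) ^ γ + lm * (max (-t) 0) ^ γ

/-- `u` is a `C¹(Ω)` function with `∫_Ω ‖∇u‖^p < ∞` which is a local minimizer of the
functional with density `‖∇v‖^p/p + F(v)`, with respect to Lipschitz competitors on
balls compactly contained in `Ω` agreeing with `u` on the boundary sphere. -/
def APLocMin (N : ℕ) (p : ℝ) (F : ℝ → ℝ) (Ω : Set (EuclideanSpace ℝ (Fin N)))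
    (u : EuclideanSpace ℝ (Fin N) → ℝ) : Prop :=
  (∀ x ∈ Ω, DifferentiableAt ℝ u x) ∧
  ContinuousOn (fun x => gradient u x) Ω ∧
  IntegrableOn (fun x => ‖gradient u x‖ ^ p) Ω volume ∧
  ∀ (z : EuclideanSpace ℝ (Fin N)) (r : ℝ), 0 < r → closure (Metric.ball z r) ⊆ Ω →
    ∀ (v : EuclideanSpace ℝ (Fin N) → ℝ) (K : NNReal),
      LipschitzOnWith K v (closure (Metric.ball z r)) →
      Set.EqOn v u (Metric.sphere z r) →
      (∫ x in Metric.ball z r, (‖gradient u x‖ ^ p / p + F (u x))) ≤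
        ∫ x in Metric.ball z r, (‖gradient v x‖ ^ p / p + F (v x))

set_option linter.all false

namespace AP

section vec
variable {V : Type*} [NormedAddCommGroup V] [InnerProductSpace ℝ V]

noncomputable def aw (p ε s : ℝ) : ℝ := (ε ^ 2 + s ^ 2) ^ ((p - 2) / 2)
noncomputable def Av (p ε : ℝ) (ξ : V) : V := aw p ε ‖ξ‖ • ξ
noncomputable def ph (p ε : ℝ) (ξ : V) : ℝ := (ε ^ 2 + ‖ξ‖ ^ 2) ^ (p / 2) / p

variable {p ε : ℝ}

lemma bpos (hε : 0 < ε) (s : ℝ) : 0 < ε ^ 2 + s ^ 2 := by positivity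

lemma aw_pos (hε : 0 < ε) (s : ℝ) : 0 < aw p ε s := Real.rpow_pos_of_pos (bpos hε s) _

lemma aw_anti (hp2 : p < 2) (hε : 0 < ε) {s t : ℝ} (hs : 0 ≤ s) (hst : s ≤ t) :
    aw p ε t ≤ aw p ε s := by
  apply Real.rpow_le_rpow_of_nonpos (bpos hε s)
  · gcongr
  · linarith

lemma aw_key (hp1 : 1 < p) (hp2 : p < 2) (hε : 0 < ε) {s t : ℝ} (hs : 0 ≤ s) (hst : s ≤ t) :
    (aw p ε s - aw p ε t) * s ≤ (2 - p) * aw p ε t * (t - s) := by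
  have hat := aw_pos (p := p) hε t
  rcases hs.eq_or_lt with rfl | hs'
  · have : 0 ≤ (2 - p) * aw p ε t * (t - 0) := by
      apply mul_nonneg (mul_nonneg (by linarith) hat.le); linarith
    simpa using this
  have ht : 0 < t := hs'.trans_le hst
  have h1 : aw p ε s ≤ aw p ε t * (t / s) ^ (2 - p) := by
    have e1 : aw p ε s = aw p ε t * ((ε ^ 2 + t ^ 2) / (ε ^ 2 + s ^ 2)) ^ ((2 - p) / 2) := by
      unfold aw
      rw [Real.div_rpow (bpos hε t).le (bpos hε s).le, div_eq_mul_inv (_ ^ _) (_ ^ _),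
        ← Real.rpow_neg (bpos hε s).le, ← mul_assoc, ← Real.rpow_add (bpos hε t)]
      rw [show (p - 2) / 2 + (2 - p) / 2 = 0 by ring, Real.rpow_zero, one_mul]
      congr 1; ring
    rw [e1]
    gcongr
    have e2 : (t / s) ^ (2 - p) = ((t / s) ^ 2) ^ ((2 - p) / 2) := by
      rw [← Real.rpow_natCast, ← Real.rpow_mul (by positivity)]
      congr 1; push_cast; ring
    rw [e2]
    apply Real.rpow_le_rpow (by positivity) _ (by linarith)
    rw [div_pow, div_le_div_iff₀ (bpos hε s) (by positivity)]
    nlinarith [mul_nonneg (sq_nonneg ε) (sub_nonneg.2 (pow_le_pow_left₀ hs hst 2))]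
  have h2 : (t / s) ^ (2 - p) ≤ 1 + (2 - p) * (t / s - 1) := by
    have := rpow_one_add_le_one_add_mul_self (s := t / s - 1) (p := 2 - p)
      (by have : 0 < t / s := by positivity
          linarith) (by linarith) (by linarith)
    simpa using this
  have h3 : aw p ε s * s ≤ aw p ε t * (1 + (2 - p) * (t / s - 1)) * s := by
    gcongr; exact h1.trans (by gcongr)
  have h4 : aw p ε t * (1 + (2 - p) * (t / s - 1)) * s
      = aw p ε t * s + (2 - p) * aw p ε t * (t - s) := by
    field_simp
  linarith

lemma Av_sub (ξ ζ : V) : Av p ε ξ - Av p ε ζ =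
    aw p ε ‖ξ‖ • (ξ - ζ) - (aw p ε ‖ζ‖ - aw p ε ‖ξ‖) • ζ := by
  unfold Av; rw [smul_sub, sub_smul]; abel

lemma Av_mono (hp1 : 1 < p) (hp2 : p < 2) (hε : 0 < ε) (ξ ζ : V) :
    (p - 1) * aw p ε (max ‖ξ‖ ‖ζ‖) * ‖ξ - ζ‖ ^ 2 ≤ ⟪Av p ε ξ - Av p ε ζ, ξ - ζ⟫_ℝ := by
  wlog h : ‖ζ‖ ≤ ‖ξ‖ generalizing ξ ζ
  · have := this ζ ξ (le_of_not_ge h)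
    rw [max_comm, norm_sub_rev, ← neg_sub (Av p ε ζ), ← neg_sub ζ ξ, inner_neg_neg]; exact this
  rw [max_eq_left h, Av_sub, inner_sub_left, real_inner_smul_left, real_inner_smul_left,
    real_inner_self_eq_norm_sq]
  have k := aw_key hp1 hp2 hε (norm_nonneg ζ) h
  have hd : 0 ≤ aw p ε ‖ζ‖ - aw p ε ‖ξ‖ := sub_nonneg.2 (aw_anti hp2 hε (norm_nonneg _) h)
  have c := real_inner_le_norm ζ (ξ - ζ)
  have t := norm_sub_norm_le ξ ζ
  have hat := aw_pos (p := p) hε ‖ξ‖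
  have a1 : (aw p ε ‖ζ‖ - aw p ε ‖ξ‖) * ⟪ζ, ξ - ζ⟫_ℝ
      ≤ (aw p ε ‖ζ‖ - aw p ε ‖ξ‖) * ‖ζ‖ * ‖ξ - ζ‖ := by
    rw [mul_assoc]; gcongr
  have a2 : (aw p ε ‖ζ‖ - aw p ε ‖ξ‖) * ‖ζ‖ * ‖ξ - ζ‖
      ≤ (2 - p) * aw p ε ‖ξ‖ * ‖ξ - ζ‖ * ‖ξ - ζ‖ := by
    have : 0 ≤ (2 - p) * aw p ε ‖ξ‖ := mul_nonneg (by linarith) hat.le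
    exact mul_le_mul_of_nonneg_right (k.trans (by gcongr)) (norm_nonneg _)
  nlinarith

lemma Av_lip (hp1 : 1 < p) (hp2 : p < 2) (hε : 0 < ε) (ξ ζ : V) :
    ‖Av p ε ξ - Av p ε ζ‖ ≤ 2 * aw p ε (max ‖ξ‖ ‖ζ‖) * ‖ξ - ζ‖ := by
  wlog h : ‖ζ‖ ≤ ‖ξ‖ generalizing ξ ζ
  · have := this ζ ξ (le_of_not_ge h)
    rw [max_comm, norm_sub_rev, norm_sub_rev ξ]; exact this
  rw [max_eq_left h, Av_sub]
  have k := aw_key hp1 hp2 hε (norm_nonneg ζ) h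
  have hd : 0 ≤ aw p ε ‖ζ‖ - aw p ε ‖ξ‖ := sub_nonneg.2 (aw_anti hp2 hε (norm_nonneg _) h)
  have t := norm_sub_norm_le ξ ζ
  have hat := aw_pos (p := p) hε ‖ξ‖
  refine (norm_sub_le _ _).trans ?_
  rw [norm_smul, norm_smul, Real.norm_of_nonneg hat.le, Real.norm_of_nonneg hd]
  have : (2 - p) * aw p ε ‖ξ‖ * (‖ξ‖ - ‖ζ‖) ≤ 1 * aw p ε ‖ξ‖ * ‖ξ - ζ‖ := by
    gcongr
    linarith
  linarith

lemma aw_zero_le (hp2 : p < 2) (hε : 0 < ε) {s : ℝ} (hs : 0 ≤ s) : aw p ε s ≤ aw p ε 0 :=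
  aw_anti hp2 hε le_rfl hs

lemma Av_lip0 (hp1 : 1 < p) (hp2 : p < 2) (hε : 0 < ε) (ξ ζ : V) :
    ‖Av p ε ξ - Av p ε ζ‖ ≤ 2 * aw p ε 0 * ‖ξ - ζ‖ := by
  refine (Av_lip hp1 hp2 hε ξ ζ).trans ?_
  gcongr
  exact aw_zero_le hp2 hε (le_max_of_le_left (norm_nonneg _))

lemma Av_cont (hε : 0 < ε) : Continuous (Av p ε : V → V) := by
  unfold Av aw
  refine Continuous.smul (Continuous.rpow_const (by fun_prop) fun x => Or.inl (bpos hε _).ne') continuous_id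

lemma Av_norm_le (hp1 : 1 < p) (hε : 0 < ε) (ξ : V) :
    ‖Av p ε ξ‖ ≤ (ε ^ 2 + ‖ξ‖ ^ 2) ^ ((p - 1) / 2) := by
  have hb := bpos hε ‖ξ‖
  unfold Av; rw [norm_smul, Real.norm_of_nonneg (aw_pos hε _).le]
  have : ‖ξ‖ ≤ (ε ^ 2 + ‖ξ‖ ^ 2) ^ ((1:ℝ) / 2) := by
    rw [← Real.sqrt_eq_rpow]; apply Real.le_sqrt_of_sq_le; nlinarith [sq_nonneg ε]
  calc _ ≤ aw p ε ‖ξ‖ * (ε ^ 2 + ‖ξ‖ ^ 2) ^ ((1:ℝ) / 2) := by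
        gcongr; exact (aw_pos hε _).le
    _ = _ := by unfold aw; rw [← Real.rpow_add hb]; congr 1; ring

lemma ph_cont (hε : 0 < ε) : Continuous (ph p ε : V → ℝ) := by
  unfold ph
  exact (Continuous.rpow_const (by fun_prop) fun x => Or.inl (bpos hε _).ne').div_const _

lemma ph_line (hp1 : 1 < p) (hε : 0 < ε) (ζ D : V) (τ : ℝ) :
    HasDerivAt (fun τ : ℝ => ph p ε (ζ + τ • D)) (⟪Av p ε (ζ + τ • D), D⟫_ℝ) τ := by
  have h1 : HasDerivAt (fun τ : ℝ => ζ + τ • D) D τ := by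
    simpa using ((hasDerivAt_id τ).smul_const D).const_add ζ
  have h2 := h1.norm_sq
  have h3 := (((h2.const_add (ε ^ 2)).rpow_const (p := p / 2) (Or.inl (bpos hε _).ne')).div_const p)
  refine h3.congr_deriv ?_
  unfold Av aw
  rw [real_inner_smul_left, show p / 2 - 1 = (p - 2) / 2 by ring]
  field_simp

lemma ph_conv (hp1 : 1 < p) (hp2 : p < 2) (hε : 0 < ε) {R : ℝ} {ξ ζ : V}
    (hξ : ‖ξ‖ ≤ R) (hζ : ‖ζ‖ ≤ R) :
    ph p ε ζ + ⟪Av p ε ζ, ξ - ζ⟫_ℝ + (p - 1) / 2 * aw p ε R * ‖ξ - ζ‖ ^ 2 ≤ ph p ε ξ := by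
  set D := ξ - ζ
  let h : ℝ → ℝ := fun τ => ph p ε (ζ + τ • D) - τ * ⟪Av p ε ζ, D⟫_ℝ
    - (p - 1) / 2 * aw p ε R * ‖D‖ ^ 2 * τ ^ 2
  have hd : ∀ τ, HasDerivAt h (⟪Av p ε (ζ + τ • D), D⟫_ℝ - 1 * ⟪Av p ε ζ, D⟫_ℝ
    - (p - 1) / 2 * aw p ε R * ‖D‖ ^ 2 * (((2:ℕ):ℝ) * τ ^ (2-1))) τ := fun τ =>
    ((ph_line hp1 hε ζ D τ).sub ((hasDerivAt_id τ).mul_const _)).sub ((hasDerivAt_pow 2 τ).const_mul _)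
  have hm : MonotoneOn h (Icc 0 1) := by
    apply monotoneOn_of_deriv_nonneg (convex_Icc 0 1)
    · exact fun x _ => (hd x).continuousAt.continuousWithinAt
    · exact fun x _ => (hd x).differentiableAt.differentiableWithinAt
    · intro τ hτ
      rw [interior_Icc] at hτ
      rw [(hd τ).deriv]
      have m := Av_mono hp1 hp2 hε (ζ + τ • D) ζ
      have hn : ‖ζ + τ • D‖ ≤ R := by
        have : ζ + τ • D = (1 - τ) • ζ + τ • ξ := by simp only [D]; module
        rw [this]
        refine (norm_add_le _ _).trans ?_
        rw [norm_smul, norm_smul, Real.norm_of_nonneg hτ.1.le, Real.norm_of_nonneg (by linarith [hτ.2])]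
        nlinarith [hτ.1, hτ.2]
      have hR := aw_anti (p := p) hp2 hε (le_max_of_le_left (norm_nonneg (ζ + τ • D))) (max_le hn hζ)
      rw [add_sub_cancel_left, real_inner_smul_right, norm_smul, inner_sub_left,
        Real.norm_of_nonneg hτ.1.le] at m
      have m2 : (p - 1) * aw p ε R * (τ * ‖D‖) ^ 2 ≤ (p - 1) * aw p ε (max ‖ζ + τ • D‖ ‖ζ‖) * (τ * ‖D‖) ^ 2 := by
        gcongr
      have m3 : τ * ((p - 1) * aw p ε R * τ * ‖D‖ ^ 2) ≤ τ * (⟪Av p ε (ζ + τ • D), D⟫_ℝ - ⟪Av p ε ζ, D⟫_ℝ) := by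
        nlinarith
      have m4 := le_of_mul_le_mul_left m3 hτ.1
      norm_num
      nlinarith
  have := hm (left_mem_Icc.2 zero_le_one) (right_mem_Icc.2 zero_le_one) zero_le_one
  simp only [h, D] at this
  simp at this
  simp only [D]
  linarith

lemma ph_le (hp1 : 1 < p) (hp2 : p < 2) (hε : 0 < ε) (ξ ζ : V) :
    ph p ε ξ - ph p ε ζ ≤ ⟪Av p ε ξ, ξ - ζ⟫_ℝ := by
  have h := ph_conv hp1 hp2 hε (le_max_right ‖ξ‖ ‖ζ‖) (le_max_left ‖ξ‖ ‖ζ‖)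
  have : 0 ≤ (p - 1) / 2 * aw p ε (max ‖ξ‖ ‖ζ‖) * ‖ζ - ξ‖ ^ 2 :=
    mul_nonneg (mul_nonneg (by linarith) (aw_pos hε _).le) (by positivity)
  have e : ⟪Av p ε ξ, ζ - ξ⟫_ℝ = - ⟪Av p ε ξ, ξ - ζ⟫_ℝ := by rw [← inner_neg_right, neg_sub]
  linarith

lemma ph_ge_norm (hp1 : 1 < p) (hε : 0 < ε) (ξ : V) : ‖ξ‖ ^ p / p ≤ ph p ε ξ := by
  unfold ph
  gcongr
  calc ‖ξ‖ ^ p = (‖ξ‖ ^ 2) ^ (p / 2) := by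
        rw [← Real.rpow_natCast, ← Real.rpow_mul (by positivity)]; congr 1; push_cast; ring
    _ ≤ _ := Real.rpow_le_rpow (by positivity) (by nlinarith [sq_nonneg ε]) (by linarith)

lemma ph_le_norm (hp1 : 1 < p) (hp2 : p < 2) (hε : 0 < ε) (ξ : V) :
    ph p ε ξ ≤ ‖ξ‖ ^ p / p + ε ^ p / p := by
  unfold ph
  rw [← add_div]
  gcongr
  have e : ∀ x : ℝ, 0 ≤ x → x ^ p = (x ^ 2) ^ (p / 2) := fun x hx => by
    rw [← Real.rpow_natCast, ← Real.rpow_mul hx]; congr 1; push_cast; ring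
  rw [e _ (norm_nonneg ξ), e _ hε.le, add_comm]
  exact Real.rpow_add_le_add_rpow (by positivity) (by positivity) (by linarith) (by linarith)

end vec
end AP

namespace AP
open Filter Topology

abbrev EE (N : ℕ) := EuclideanSpace ℝ (Fin N)

section FD
variable {N : ℕ} {G : Type*} [NormedAddCommGroup G] [NormedSpace ℝ G]

/-- overlap set -/
def ov (B : Set (EE N)) (y : EE N) : Set (EE N) := {x | x ∈ B ∧ x + y ∈ B}

lemma ov_meas {B : Set (EE N)} (hB : MeasurableSet B) (y : EE N) : MeasurableSet (ov B y) :=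
  hB.inter ((measurable_add_const y) hB)

lemma fd_double {B : Set (EE N)} (hBc : Convex ℝ B) (hB : MeasurableSet B) {F : EE N → G}
    (hF : Continuous F) (q : ℕ) (y : EE N) :
    ∫⁻ x in ov B ((2:ℝ) • y), ENNReal.ofReal (‖F (x + (2:ℝ) • y) - F x‖ ^ q) ≤
      2 ^ q * ∫⁻ x in ov B y, ENNReal.ofReal (‖F (x + y) - F x‖ ^ q) := by
  rw [← lintegral_indicator (ov_meas hB _), ← lintegral_indicator (ov_meas hB _)]
  set I : EE N → ENNReal := (ov B y).indicator fun x => ENNReal.ofReal (‖F (x + y) - F x‖ ^ q)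
  have hI : Measurable I := by
    apply Measurable.indicator _ (ov_meas hB _)
    have : Continuous fun x => ‖F (x + y) - F x‖ ^ q := by fun_prop
    exact this.measurable.ennreal_ofReal
  rcases Nat.eq_zero_or_pos q with rfl | hq
  · simp only [pow_zero, one_mul]
    apply lintegral_mono
    intro x
    by_cases hx : x ∈ ov B ((2:ℝ) • y)
    · have : x ∈ ov B y := by
        refine ⟨hx.1, ?_⟩
        have := hBc hx.1 hx.2 (by norm_num : (0:ℝ) ≤ 1/2) (by norm_num : (0:ℝ) ≤ 1/2) (by norm_num)
        convert this using 1; module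
      simp [I, hx, this]
    · simp [hx]
  have key : ∀ x, (ov B ((2:ℝ) • y)).indicator
      (fun x => ENNReal.ofReal (‖F (x + (2:ℝ) • y) - F x‖ ^ q)) x ≤ 2 ^ (q - 1) * (I x + I (x + y)) := by
    intro x
    by_cases hx : x ∈ ov B ((2:ℝ) • y)
    · have hm : x + y ∈ B := by
        have := hBc hx.1 hx.2 (by norm_num : (0:ℝ) ≤ 1/2) (by norm_num : (0:ℝ) ≤ 1/2) (by norm_num)
        convert this using 1; module
      have e2 : x + (2:ℝ) • y = x + y + y := by module
      have h1 : x ∈ ov B y := ⟨hx.1, hm⟩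
      have h2 : x + y ∈ ov B y := ⟨hm, by rw [← e2]; exact hx.2⟩
      simp only [I, indicator_of_mem hx, indicator_of_mem h1, indicator_of_mem h2]
      rw [e2, ← ENNReal.ofReal_add (by positivity) (by positivity),
        show (2:ENNReal) ^ (q - 1) = ENNReal.ofReal (2 ^ (q - 1)) by
          rw [ENNReal.ofReal_pow (by norm_num)]; norm_num,
        ← ENNReal.ofReal_mul (by positivity)]
      apply ENNReal.ofReal_le_ofReal
      refine le_trans ?_ (add_pow_le (norm_nonneg _) (norm_nonneg _) q)
      gcongr
      calc ‖F (x + y + y) - F x‖ = ‖(F (x + y) - F x) + (F (x + y + y) - F (x + y))‖ := by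
            congr 1; abel
        _ ≤ _ := norm_add_le _ _
    · simp [hx]
  refine (lintegral_mono key).trans ?_
  rw [lintegral_const_mul _ (by fun_prop), lintegral_add_left hI,
    lintegral_add_right_eq_self I y]
  have : (2:ENNReal) ^ q = 2 ^ (q - 1) * 2 := by rw [← pow_succ]; congr 1; omega
  rw [this, mul_assoc, two_mul]

variable [FiniteDimensional ℝ G]

lemma fd_lint {B : Set (EE N)} (hBc : Convex ℝ B) (hB : MeasurableSet B) (hv : volume B ≠ ⊤)
    {F : EE N → G} {K : NNReal} (hF : LipschitzWith K F) (q : ℕ) (y : EE N) :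
    ∫⁻ x in ov B y, ENNReal.ofReal (‖F (x + y) - F x‖ ^ q) ≤
      ∫⁻ x in B, ENNReal.ofReal (‖fderiv ℝ F x y‖ ^ q) := by
  have hFc := hF.continuous
  have h1 : ∀ k : ℕ, ∫⁻ x in ov B y, ENNReal.ofReal (‖F (x + y) - F x‖ ^ q) ≤
      2 ^ (q * k) * ∫⁻ x in ov B (((2:ℝ)⁻¹ ^ k) • y),
        ENNReal.ofReal (‖F (x + ((2:ℝ)⁻¹ ^ k) • y) - F x‖ ^ q) := by
    intro k
    induction k with
    | zero => simp
    | succ k ih =>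
      refine ih.trans ?_
      have := fd_double hBc hB hFc q (((2:ℝ)⁻¹ ^ (k+1)) • y)
      rw [smul_smul, show (2:ℝ) * 2⁻¹ ^ (k+1) = 2⁻¹ ^ k by rw [pow_succ]; ring] at this
      rw [show q * (k+1) = q * k + q by ring, pow_add, mul_assoc]
      gcongr
  let g : ℕ → EE N → ENNReal := fun k x =>
    ENNReal.ofReal (‖((2:ℝ)⁻¹ ^ k)⁻¹ • (F (x + ((2:ℝ)⁻¹ ^ k) • y) - F x)‖ ^ q)
  have h2 : ∀ k : ℕ, ∫⁻ x in ov B y, ENNReal.ofReal (‖F (x + y) - F x‖ ^ q) ≤ ∫⁻ x in B, g k x := by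
    intro k
    refine (h1 k).trans ?_
    rw [← lintegral_const_mul' _ _ (by simp)]
    refine (lintegral_mono_set (fun x hx => hx.1)).trans (le_of_eq ?_)
    congr 1; ext x
    simp only [g]
    rw [norm_smul, mul_pow, ENNReal.ofReal_mul (by positivity)]
    congr 1
    rw [Real.norm_of_nonneg (by positivity), ← inv_pow, inv_inv, ← pow_mul, mul_comm q k,
      ENNReal.ofReal_pow (by norm_num)]; norm_num
  have h3 : Tendsto (fun k => ∫⁻ x in B, g k x) atTop
      (𝓝 (∫⁻ x in B, ENNReal.ofReal (‖fderiv ℝ F x y‖ ^ q))) := by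
    apply tendsto_lintegral_of_dominated_convergence (fun _ => ENNReal.ofReal ((K * ‖y‖) ^ q))
    · intro k
      have : Continuous fun x => ‖((2:ℝ)⁻¹ ^ k)⁻¹ • (F (x + ((2:ℝ)⁻¹ ^ k) • y) - F x)‖ ^ q := by fun_prop
      exact this.measurable.ennreal_ofReal
    · intro k
      refine Eventually.of_forall fun x => ENNReal.ofReal_le_ofReal ?_
      gcongr
      rw [norm_smul, Real.norm_of_nonneg (by positivity)]
      have := hF.norm_sub_le (x + ((2:ℝ)⁻¹ ^ k) • y) x
      rw [add_sub_cancel_left, norm_smul, Real.norm_of_nonneg (by positivity)] at this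
      rw [inv_mul_le_iff₀ (by positivity)]
      linarith
    · rw [lintegral_const]; simp [ENNReal.mul_eq_top, hv]
    · apply ae_restrict_of_ae
      filter_upwards [hF.ae_differentiableAt] with x hx
      apply ENNReal.tendsto_ofReal
      apply Tendsto.pow
      apply Tendsto.norm
      have this : HasDerivAt (fun t : ℝ => F (x + t • y)) (fderiv ℝ F x y) 0 :=
        hx.hasFDerivAt.hasLineDerivAt y
      have h0 := this.tendsto_slope_zero
      simp only [zero_add, zero_smul, add_zero] at h0
      apply h0.comp
      rw [tendsto_nhdsWithin_iff]
      exact ⟨tendsto_pow_atTop_nhds_zero_of_lt_one (by norm_num) (by norm_num),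
        Eventually.of_forall fun k => by simp⟩
  exact ge_of_tendsto' h3 h2

/-- global version -/
lemma fd_glob {R : ℝ} {F : EE N → G} {K : NNReal} (hF : LipschitzWith K F)
    (hs : ∀ x, x ∉ closedBall (0 : EE N) R → F x = 0) (q : ℕ) (hq : q ≠ 0) (y : EE N) :
    ∫⁻ x, ENNReal.ofReal (‖F (x + y) - F x‖ ^ q) ≤
      ∫⁻ x, ENNReal.ofReal (‖fderiv ℝ F x y‖ ^ q) := by
  have h := fd_lint (convex_closedBall (0:EE N) (R + ‖y‖)) measurableSet_closedBall
    (measure_closedBall_lt_top.ne) hF q y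
  refine le_trans ?_ (h.trans (setLIntegral_le_lintegral _ _))
  rw [← lintegral_indicator (ov_meas measurableSet_closedBall _)]
  apply lintegral_mono
  intro x
  by_cases hx : x ∈ ov (closedBall (0:EE N) (R + ‖y‖)) y
  · simp [hx]
  · have : F (x + y) = 0 ∧ F x = 0 := by
      constructor
      · apply hs
        intro h1
        apply hx
        rw [mem_closedBall_zero_iff] at h1
        constructor
        · rw [mem_closedBall_zero_iff]
          calc ‖x‖ = ‖x + y - y‖ := by rw [add_sub_cancel_right]
            _ ≤ _ := (norm_sub_le _ _).trans (by linarith)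
        · rw [mem_closedBall_zero_iff]; linarith [norm_nonneg y]
      · apply hs
        intro h1
        apply hx
        rw [mem_closedBall_zero_iff] at h1
        constructor
        · rw [mem_closedBall_zero_iff]; linarith [norm_nonneg y]
        · rw [mem_closedBall_zero_iff]
          exact (norm_add_le _ _).trans (by linarith)
    simp [this, hq]

end FD

section FUB
variable {N : ℕ}

lemma fub {B Z : Set (EE N)} (hB : MeasurableSet B) (hZ : MeasurableSet Z) (hZB : Z ⊆ B)
    {F : EE N → ℝ} (hF : Measurable F) (hFZ : ∀ x ∈ Z, F x = 0) {K ρ : ℝ}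
    (h : ∀ y, ∫⁻ x in ov B y, ENNReal.ofReal ((F (x + y) - F x) ^ 2) ≤ ENNReal.ofReal (K * ‖y‖ ^ 2))
    (hK : 0 ≤ K) :
    ∫⁻ x in B, ENNReal.ofReal (F x ^ 2) * volume (Z ∩ ball x ρ) ≤
      volume (ball (0 : EE N) ρ) * ENNReal.ofReal (K * ρ ^ 2) := by
  have mF : Measurable fun q : EE N × EE N => ENNReal.ofReal ((F (q.1 + q.2) - F q.1) ^ 2) := by
    fun_prop
  have step1 : ∀ x, ENNReal.ofReal (F x ^ 2) * volume (Z ∩ ball x ρ) =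
      ∫⁻ y in ball (0 : EE N) ρ, Z.indicator (fun z => ENNReal.ofReal ((F z - F x) ^ 2)) (x + y) := by
    intro x
    rw [← setLIntegral_const, ← lintegral_indicator (hZ.inter measurableSet_ball),
      ← lintegral_indicator measurableSet_ball, ← lintegral_add_left_eq_self _ x]
    congr 1; ext y
    by_cases h1 : x + y ∈ Z <;> by_cases h2 : ‖y‖ < ρ <;>
      simp [indicator, h1, h2]
    rw [hFZ _ h1]; simp
  simp_rw [step1]
  rw [lintegral_lintegral_swap]
  · calc _ ≤ ∫⁻ y in ball (0 : EE N) ρ, ENNReal.ofReal (K * ρ ^ 2) := by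
          apply setLIntegral_mono measurable_const
          intro y hy
          rw [mem_ball_zero_iff] at hy
          refine le_trans ?_ ((h y).trans (ENNReal.ofReal_le_ofReal (by gcongr)))
          rw [← lintegral_indicator hB, ← lintegral_indicator (ov_meas hB y)]
          apply lintegral_mono
          intro x
          by_cases h1 : x ∈ B <;> by_cases h2 : x + y ∈ Z <;> simp [h1, h2]
          rw [indicator_of_mem (show x ∈ ov B y from ⟨h1, hZB h2⟩)]
      _ = _ := by rw [setLIntegral_const, mul_comm]
  · apply Measurable.aemeasurable
    have : (Function.uncurry fun x y => Z.indicator (fun z => ENNReal.ofReal ((F z - F x) ^ 2)) (x + y))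
      = ((fun q : EE N × EE N => q.1 + q.2) ⁻¹' Z).indicator
        (fun q : EE N × EE N => ENNReal.ofReal ((F (q.1 + q.2) - F q.1) ^ 2)) := by
      ext q; simp [Function.uncurry, indicator]; rfl
    rw [this]
    exact mF.indicator (measurable_add hZ)

/-- Poincare-type -/
lemma poinc {Z : Set (EE N)} (hZ : MeasurableSet Z) {r : ℝ} (hr : r ≤ 1/2) (hZB : Z ⊆ ball 0 r)
    {F : EE N → ℝ} (hF : Measurable F) (hFZ : ∀ x ∈ Z, F x = 0) {K : ℝ} (hK : 0 ≤ K)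
    (h : ∀ y, ∫⁻ x in ov (ball 0 r) y, ENNReal.ofReal ((F (x + y) - F x) ^ 2) ≤ ENNReal.ofReal (K * ‖y‖ ^ 2)) :
    (∫⁻ x in ball 0 r, ENNReal.ofReal (F x ^ 2)) * volume Z ≤
      volume (ball (0 : EE N) 1) * ENNReal.ofReal K := by
  have := fub (ρ := 1) measurableSet_ball hZ hZB hF hFZ h hK
  rw [one_pow, mul_one] at this
  refine le_trans ?_ this
  rw [← lintegral_mul_const _ (by fun_prop)]
  apply setLIntegral_mono' measurableSet_ball
  intro x hx
  gcongr
  intro z hz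
  refine ⟨hz, ?_⟩
  have h1 := hZB hz
  rw [mem_ball_zero_iff] at h1 hx
  rw [mem_ball, dist_eq_norm]
  exact (norm_sub_le _ _).trans_lt (by linarith)

/-- Faber-Krahn-type -/
lemma faber (hN : 1 ≤ N) : ∃ C : ℝ, 0 < C ∧ ∀ (F : EE N → ℝ) (K : ℝ), Measurable F → 0 ≤ K →
    (∀ y, ∫⁻ x, ENNReal.ofReal ((F (x + y) - F x) ^ 2) ≤ ENNReal.ofReal (K * ‖y‖ ^ 2)) →
    ∀ S : Set (EE N), MeasurableSet S → volume S ≠ ⊤ → (∀ x ∉ S, F x = 0) →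
    ∫⁻ x, ENNReal.ofReal (F x ^ 2) ≤ ENNReal.ofReal (C * K * (volume.real S) ^ (2 / (N:ℝ))) := by
  have : Nonempty (Fin N) := ⟨⟨0, hN⟩⟩
  have hN' : (0:ℝ) < N := by exact_mod_cast hN
  set ω := volume.real (ball (0:EE N) 1)
  have hω : 0 < ω := by
    apply ENNReal.toReal_pos (measure_ball_pos _ _ one_pos).ne' measure_ball_lt_top.ne
  refine ⟨2 * (2 / ω) ^ (2 / (N:ℝ)), by positivity, ?_⟩
  intro F K hF hK h S hS hSf hFS
  set s := volume.real S
  have hs0 : 0 ≤ s := measureReal_nonneg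
  rcases hs0.eq_or_lt with hs | hs
  · have : ∀ᵐ x, F x = 0 := by
      have h0 : volume S = 0 := by
        have := (ENNReal.toReal_eq_zero_iff _).1 hs.symm
        tauto
      filter_upwards [measure_eq_zero_iff_ae_notMem.1 h0] with x hx using hFS x hx
    have : ∫⁻ x, ENNReal.ofReal (F x ^ 2) = 0 := by
      rw [lintegral_eq_zero_iff' (by fun_prop)]
      filter_upwards [this] with x hx; simp [hx]
    rw [this]; positivity
  set ρ := (2 * s / ω) ^ (1 / (N:ℝ))
  have hρ : 0 < ρ := by positivity
  have hvol : ∀ x : EE N, volume (ball x ρ) = ENNReal.ofReal (2 * s) := by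
    intro x
    rw [Measure.addHaar_ball _ _ hρ.le, finrank_euclideanSpace_fin,
      ← ofReal_measureReal (measure_ball_lt_top.ne), ← ENNReal.ofReal_mul (by positivity)]
    congr 1
    have : ρ ^ N = 2 * s / ω := by
      rw [← Real.rpow_natCast, ← Real.rpow_mul (by positivity)]
      simp [hN'.ne']
    rw [this]; change 2 * s / ω * ω = _; field_simp
  have f := fub (ρ := ρ) MeasurableSet.univ hS.compl (subset_univ _) hF (fun x hx => hFS x hx) (K := K)
    (by intro y; simpa [ov] using h y) hK
  rw [hvol, Measure.restrict_univ] at f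
  have g : ENNReal.ofReal s * ∫⁻ x, ENNReal.ofReal (F x ^ 2) ≤
      ENNReal.ofReal s * ENNReal.ofReal (2 * (K * ρ ^ 2)) := by
    rw [← ENNReal.ofReal_mul hs0, show s * (2 * (K * ρ ^ 2)) = 2 * s * (K * ρ ^ 2) by ring,
      ENNReal.ofReal_mul (by positivity)]
    refine le_trans ?_ f
    rw [mul_comm, ← lintegral_mul_const _ (by fun_prop)]
    apply lintegral_mono
    intro x
    refine mul_le_mul_right ?_ _
    have h1 : volume (ball x ρ) ≤ volume (Sᶜ ∩ ball x ρ) + volume S := by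
      refine le_trans (measure_mono ?_) (measure_union_le _ _)
      intro z hz
      by_cases hzS : z ∈ S
      · exact Or.inr hzS
      · exact Or.inl ⟨hzS, hz⟩
    rw [hvol, ← ofReal_measureReal hSf, two_mul, ENNReal.ofReal_add hs0 hs0] at h1
    exact (ENNReal.add_le_add_iff_right ENNReal.ofReal_ne_top).1 h1
  have g2 := (ENNReal.mul_le_mul_iff_right (by simpa using hs) ENNReal.ofReal_ne_top).1 g
  refine g2.trans (ENNReal.ofReal_le_ofReal (le_of_eq ?_))
  have : ρ ^ 2 = (2 / ω) ^ (2 / (N:ℝ)) * s ^ (2 / (N:ℝ)) := by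
    rw [← Real.mul_rpow (by positivity) hs0, ← Real.rpow_natCast, ← Real.rpow_mul (by positivity)]
    congr 1
    · ring
    · push_cast; ring
  rw [this]; ring

end FUB
end AP

namespace AP
open Filter Topology

section grad
variable {N : ℕ} {f g : EE N → ℝ} {f' g' x : EE N}

lemma hg_mul (hf : HasGradientAt f f' x) (hg : HasGradientAt g g' x) :
    HasGradientAt (fun y => f y * g y) (f x • g' + g x • f') x := by
  rw [hasGradientAt_iff_hasFDerivAt] at *
  exact (hf.mul hg).congr_fderiv (by simp)

lemma hg_add (hf : HasGradientAt f f' x) (hg : HasGradientAt g g' x) :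
    HasGradientAt (fun y => f y + g y) (f' + g') x := by
  rw [hasGradientAt_iff_hasFDerivAt] at *
  exact (hf.add hg).congr_fderiv (by simp)

lemma hg_sub (hf : HasGradientAt f f' x) (hg : HasGradientAt g g' x) :
    HasGradientAt (fun y => f y - g y) (f' - g') x := by
  rw [hasGradientAt_iff_hasFDerivAt] at *
  exact (hf.sub hg).congr_fderiv (by simp)

lemma hg_cmul (c : ℝ) (hf : HasGradientAt f f' x) :
    HasGradientAt (fun y => c * f y) (c • f') x := by
  rw [hasGradientAt_iff_hasFDerivAt] at *
  simpa using hf.const_mul c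

lemma hg_comp {h : ℝ → ℝ} {h' : ℝ} (hh : HasDerivAt h h' (f x)) (hf : HasGradientAt f f' x) :
    HasGradientAt (fun y => h (f y)) (h' • f') x := by
  rw [hasGradientAt_iff_hasFDerivAt] at *
  exact (hh.comp_hasFDerivAt x hf).congr_fderiv (by simp)

lemma hg_affine (a : EE N) (ρ : ℝ) (hf : HasGradientAt f f' (a + ρ • x)) :
    HasGradientAt (fun y => f (a + ρ • y)) (ρ • f') x := by
  rw [hasGradientAt_iff_hasFDerivAt] at *
  have h1 : HasFDerivAt (fun y : EE N => a + ρ • y) (ρ • ContinuousLinearMap.id ℝ (EE N)) x :=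
    ((hasFDerivAt_id x).const_smul ρ).const_add a
  have := hf.comp x h1
  refine this.congr_fderiv ?_
  ext y; simp

lemma hg_shift (a : EE N) (hf : HasGradientAt f f' (x + a)) :
    HasGradientAt (fun y => f (y + a)) f' x := by
  have := hg_affine (x := x) a 1 (f := f) (f' := f') (by simpa [add_comm] using hf)
  simpa [add_comm] using this

lemma grad_meas (f : EE N → ℝ) : Measurable (gradient f) := by
  unfold gradient
  exact (LinearIsometryEquiv.continuous _).measurable.comp (measurable_fderiv ℝ f)

lemma norm_grad (f : EE N → ℝ) (x : EE N) : ‖gradient f x‖ = ‖fderiv ℝ f x‖ := by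
  unfold gradient; simp

lemma grad_le {K : NNReal} (hf : LipschitzWith K f) (x : EE N) : ‖gradient f x‖ ≤ K := by
  rw [norm_grad]; exact norm_fderiv_le_of_lipschitz ℝ hf

lemma grad_ae {K : NNReal} (hf : LipschitzWith K f) : ∀ᵐ x, HasGradientAt f (gradient f x) x := by
  filter_upwards [hf.ae_differentiableAt] with x hx using hx.hasGradientAt

lemma ae_shift {P : EE N → Prop} (h : ∀ᵐ x, P x) (a : EE N) : ∀ᵐ x, P (x + a) :=
  (measurePreserving_add_right volume a).quasiMeasurePreserving.ae h

lemma grad_zero_off {R : ℝ} (hs : ∀ x, x ∉ closedBall (0 : EE N) R → f x = 0)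
    (hx : x ∉ closedBall (0 : EE N) R) : gradient f x = 0 := by
  have : f =ᶠ[𝓝 x] fun _ => 0 := by
    filter_upwards [isClosed_closedBall.isOpen_compl.mem_nhds hx] with y hy using hs y hy
  rw [this.gradient_eq]; simp

end grad

section BLs
variable {N : ℕ} {G : Type*} [NormedAddCommGroup G] [NormedSpace ℝ G]

/-- bounded and Lipschitz -/
def BL (f : EE N → G) : Prop :=
  ∃ K C : ℝ, 0 ≤ K ∧ 0 ≤ C ∧ (∀ x y, ‖f x - f y‖ ≤ K * ‖x - y‖) ∧ ∀ x, ‖f x‖ ≤ C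

lemma BL.lip {f : EE N → G} (h : BL f) : ∃ K : NNReal, LipschitzWith K f := by
  obtain ⟨K, C, hK, hC, h1, h2⟩ := h
  refine ⟨⟨K, hK⟩, LipschitzWith.of_dist_le_mul fun x y => ?_⟩
  rw [dist_eq_norm, dist_eq_norm]; exact h1 x y

lemma BL.mk' {f : EE N → G} {K : NNReal} (h : LipschitzWith K f) {C : ℝ} (hC : ∀ x, ‖f x‖ ≤ C) : BL f :=
  ⟨K, C, K.2, (norm_nonneg _).trans (hC 0), fun x y => h.norm_sub_le x y, hC⟩

lemma BL.cont {f : EE N → G} (h : BL f) : Continuous f := h.lip.choose_spec.continuous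

lemma BL.smul {f : EE N → ℝ} {g : EE N → G} (hf : BL f) (hg : BL g) : BL fun x => f x • g x := by
  obtain ⟨K, C, hK, hC, h1, h2⟩ := hf
  obtain ⟨K', C', hK', hC', h1', h2'⟩ := hg
  refine ⟨C * K' + K * C', C * C', by positivity, by positivity, fun x y => ?_, fun x => ?_⟩
  · have : f x • g x - f y • g y = f x • (g x - g y) + (f x - f y) • g y := by module
    rw [this]
    refine (norm_add_le _ _).trans ?_
    rw [norm_smul, norm_smul]
    have a := mul_le_mul (h2 x) (h1' x y) (norm_nonneg _) hC
    have b := mul_le_mul (h1 x y) (h2' y) (norm_nonneg _) (by positivity)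
    linarith
  · rw [norm_smul]; exact mul_le_mul (h2 x) (h2' x) (norm_nonneg _) hC

lemma BL.mul {f g : EE N → ℝ} (hf : BL f) (hg : BL g) : BL fun x => f x * g x := hf.smul hg

lemma BL.add {f g : EE N → G} (hf : BL f) (hg : BL g) : BL fun x => f x + g x := by
  obtain ⟨K, C, hK, hC, h1, h2⟩ := hf
  obtain ⟨K', C', hK', hC', h1', h2'⟩ := hg
  refine ⟨K + K', C + C', by positivity, by positivity, fun x y => ?_, fun x => ?_⟩
  · rw [add_sub_add_comm, add_mul]
    exact (norm_add_le _ _).trans (add_le_add (h1 x y) (h1' x y))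
  · exact (norm_add_le _ _).trans (add_le_add (h2 x) (h2' x))

lemma BL.const (c : G) : BL fun _ : EE N => c :=
  ⟨0, ‖c‖, le_rfl, norm_nonneg _, fun x y => by simp, fun x => le_rfl⟩

lemma BL.sub {f g : EE N → ℝ} (hf : BL f) (hg : BL g) : BL fun x => f x - g x := by
  have := hf.add ((BL.const (-1:ℝ)).mul hg)
  simpa [sub_eq_add_neg] using this

lemma BL.comp {h h' : ℝ → ℝ} (hh : ∀ t, HasDerivAt h (h' t) t) (hc : Continuous h') {f : EE N → ℝ}
    (hf : BL f) : BL fun x => h (f x) := by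
  obtain ⟨K, C, hK, hC, h1, h2⟩ := hf
  have hcont : Continuous h := continuous_iff_continuousAt.2 fun t => (hh t).continuousAt
  obtain ⟨D, hD⟩ := (isCompact_Icc (a := -C) (b := C)).exists_bound_of_continuousOn hc.continuousOn
  obtain ⟨D', hD'⟩ := (isCompact_Icc (a := -C) (b := C)).exists_bound_of_continuousOn hcont.continuousOn
  have hm : ∀ x, f x ∈ Icc (-C) C := fun x => abs_le.1 (h2 x)
  have hD0 : 0 ≤ D := (norm_nonneg _).trans (hD _ (hm 0))
  refine ⟨D * K, D', by positivity, (norm_nonneg _).trans (hD' _ (hm 0)), fun x y => ?_, fun x => hD' _ (hm x)⟩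
  have := (convex_Icc (-C) C).norm_image_sub_le_of_norm_hasDerivWithin_le
    (fun t _ => (hh t).hasDerivWithinAt) (fun t ht => hD t ht) (hm y) (hm x)
  refine this.trans ?_
  rw [mul_assoc]
  exact mul_le_mul_of_nonneg_left (h1 x y) hD0

lemma BL.shift {f : EE N → G} (h : BL f) (a : EE N) : BL fun x => f (x + a) := by
  obtain ⟨K, C, hK, hC, h1, h2⟩ := h
  refine ⟨K, C, hK, hC, fun x y => ?_, fun x => h2 _⟩
  have := h1 (x + a) (y + a)
  rwa [add_sub_add_right_eq_sub] at this

end BLs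

section eta
variable {N : ℕ}

noncomputable def eta (R : ℝ) (x : EE N) : ℝ := R ^ 2 - (min ‖x‖ R) ^ 2

lemma eta_in {R : ℝ} {x : EE N} (hx : ‖x‖ ≤ R) : eta R x = R ^ 2 - ‖x‖ ^ 2 := by
  unfold eta; rw [min_eq_left hx]

lemma eta_out {R : ℝ} {x : EE N} (hx : R ≤ ‖x‖) : eta R x = 0 := by
  unfold eta; rw [min_eq_right hx]; ring

lemma eta_nonneg {R : ℝ} (hR : 0 ≤ R) (x : EE N) : 0 ≤ eta R x := by
  rcases le_total ‖x‖ R with h | h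
  · rw [eta_in h]; nlinarith [norm_nonneg x]
  · rw [eta_out h]

lemma eta_le {R : ℝ} (hR : 0 ≤ R) (hR1 : R ≤ 1) (x : EE N) : eta R x ≤ 1 := by
  unfold eta; nlinarith [sq_nonneg (min ‖x‖ R)]

lemma eta_BL {R : ℝ} (hR : 0 ≤ R) : BL (eta R : EE N → ℝ) := by
  have h : BL fun x : EE N => min ‖x‖ R := by
    apply BL.mk' (lipschitzWith_one_norm.min_const R) (C := R)
    intro x
    rw [Real.norm_of_nonneg (le_min (norm_nonneg _) hR)]; exact min_le_right _ _
  exact (BL.const (R ^ 2)).sub (by simpa [pow_two] using h.mul h)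

lemma etax_BL {R : ℝ} (hR : 0 ≤ R) : BL (fun x : EE N => eta R x • x) := by
  obtain ⟨K, C, hK, hC, h1, h2⟩ := eta_BL (N := N) hR
  refine ⟨K * R + C, C * R, by positivity, by positivity, ?_, fun x => ?_⟩
  · have key : ∀ x y : EE N, ‖x‖ ≤ ‖y‖ → ‖eta R x • x - eta R y • y‖ ≤ (K * R + C) * ‖x - y‖ := by
      intro x y hxy
      rcases le_total R ‖x‖ with h | h
      · rw [eta_out h, eta_out (h.trans hxy)]; simp; positivity
      · have : eta R x • x - eta R y • y = (eta R x - eta R y) • x + eta R y • (x - y) := by module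
        rw [this]
        refine (norm_add_le _ _).trans ?_
        rw [norm_smul, norm_smul]
        have a := mul_le_mul (h1 x y) h (norm_nonneg _) (by positivity)
        have b := mul_le_mul_of_nonneg_right (h2 y) (norm_nonneg (x - y))
        linarith
    intro x y
    rcases le_total ‖x‖ ‖y‖ with h | h
    · exact key x y h
    · rw [norm_sub_rev, norm_sub_rev x]; exact key y x h
  · beta_reduce
    rcases le_total R ‖x‖ with h | h
    · rw [eta_out h]; simp; positivity
    · rw [norm_smul]; exact mul_le_mul (h2 x) h (norm_nonneg _) hC

lemma eta_ge_mid {R r : ℝ} (hr : 0 ≤ r) (hrR : r ≤ R) {x : EE N} (hx : ‖x‖ < r) : R ^ 2 - r ^ 2 ≤ eta R x := by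
  rw [eta_in (hx.le.trans hrR)]; nlinarith [norm_nonneg x]

noncomputable def geta (R : ℝ) (x : EE N) : EE N := if ‖x‖ < R then (-2 : ℝ) • x else 0

lemma eta_grad (hN : 1 ≤ N) {R : ℝ} (hR : 0 < R) : ∀ᵐ x : EE N, HasGradientAt (eta R) (geta R x) x ∧
    ‖x‖ ≠ R := by
  have : Nonempty (Fin N) := ⟨⟨0, hN⟩⟩
  have h0 : ∀ᵐ x : EE N, x ∉ sphere (0:EE N) R :=
    measure_eq_zero_iff_ae_notMem.1 (Measure.addHaar_sphere _ _ _)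
  filter_upwards [h0] with x hx
  rw [mem_sphere_zero_iff_norm] at hx
  refine ⟨?_, hx⟩
  unfold geta
  rcases lt_or_gt_of_ne hx with h | h
  · rw [if_pos h]
    have e : eta R =ᶠ[𝓝 x] fun y => R ^ 2 - ‖y‖ ^ 2 := by
      filter_upwards [(isOpen_lt continuous_norm continuous_const).mem_nhds h] with y hy
      exact eta_in (le_of_lt hy)
    refine HasGradientAt.congr_of_eventuallyEq ?_ e
    rw [hasGradientAt_iff_hasFDerivAt]
    have := ((hasStrictFDerivAt_norm_sq x).hasFDerivAt).const_sub (R ^ 2)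
    refine this.congr_fderiv ?_
    ext y; simp
  · rw [if_neg (not_lt.2 h.le)]
    have e : eta R =ᶠ[𝓝 x] fun y => (0:ℝ) := by
      filter_upwards [(isOpen_lt continuous_const continuous_norm).mem_nhds h] with y hy
      exact eta_out (le_of_lt hy)
    exact HasGradientAt.congr_of_eventuallyEq (hasGradientAt_const _ _) e

lemma geta_le {R : ℝ} (hR : 0 ≤ R) (hR1 : R ≤ 1) (x : EE N) : ‖geta R x‖ ≤ 2 := by
  unfold geta
  split_ifs with h
  · rw [norm_smul]; norm_num; linarith
  · simp

end eta

section Sol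
variable {N : ℕ}

structure Sol (p ε : ℝ) (f : EE N → ℝ) (Λ : ℝ) (v : EE N → ℝ) : Prop where
  lip : ∃ K : NNReal, LipschitzWith K v
  grad1 : ∀ᵐ x, x ∈ ball (0 : EE N) 1 → ‖gradient v x‖ ≤ 1
  fcont : Continuous f
  flip : ∀ x ∈ ball (0 : EE N) 1, ∀ y ∈ ball (0 : EE N) 1, |f x - f y| ≤ Λ * ‖x - y‖
  el : ∀ (ψ : EE N → ℝ) (K : NNReal) (R : ℝ), LipschitzWith K ψ → R < 1 →
    (∀ x, x ∉ closedBall (0 : EE N) R → ψ x = 0) →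
    ∫ x, ⟪gradient ψ x, Av p ε (gradient v x)⟫_ℝ = ∫ x, f x * ψ x

lemma int_cpt {h : EE N → ℝ} (hm : Measurable h) {R C : ℝ} (hC : ∀ x, |h x| ≤ C)
    (hs : ∀ x, x ∉ closedBall (0 : EE N) R → h x = 0) : Integrable h := by
  rw [← integrableOn_iff_integrable_of_support_subset (s := closedBall (0:EE N) R)]
  · exact Measure.integrableOn_of_bounded (M := C) measure_closedBall_lt_top.ne
      hm.aestronglyMeasurable (Eventually.of_forall hC)
  · intro x hx
    by_contra h'
    exact hx (hs x h')

end Sol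
end AP

namespace AP
open Filter Topology

section BMs
variable {N : ℕ} {G : Type*} [NormedAddCommGroup G] [InnerProductSpace ℝ G] [MeasurableSpace G]
  [BorelSpace G] [SecondCountableTopology G]

/-- bounded and measurable -/
def BM (f : EE N → G) : Prop := Measurable f ∧ ∃ C : ℝ, ∀ x, ‖f x‖ ≤ C

lemma BM.inner {f g : EE N → G} (hf : BM f) (hg : BM g) : BM fun x => ⟪f x, g x⟫_ℝ := by
  obtain ⟨mf, C, hC⟩ := hf
  obtain ⟨mg, D, hD⟩ := hg
  refine ⟨mf.inner mg, C * D, fun x => (norm_inner_le_norm _ _).trans ?_⟩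
  exact mul_le_mul (hC x) (hD x) (norm_nonneg _) ((norm_nonneg _).trans (hC x))

lemma BM.smul {f : EE N → ℝ} {g : EE N → G} (hf : BM f) (hg : BM g) : BM fun x => f x • g x := by
  obtain ⟨mf, C, hC⟩ := hf
  obtain ⟨mg, D, hD⟩ := hg
  refine ⟨mf.smul mg, C * D, fun x => ?_⟩
  rw [norm_smul]
  exact mul_le_mul (hC x) (hD x) (norm_nonneg _) ((norm_nonneg _).trans (hC x))

lemma BM.mul {f g : EE N → ℝ} (hf : BM f) (hg : BM g) : BM fun x => f x * g x := hf.smul hg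

lemma BM.add {f g : EE N → G} (hf : BM f) (hg : BM g) : BM fun x => f x + g x := by
  obtain ⟨mf, C, hC⟩ := hf
  obtain ⟨mg, D, hD⟩ := hg
  exact ⟨mf.add mg, C + D, fun x => (norm_add_le _ _).trans (add_le_add (hC x) (hD x))⟩

lemma BM.sub {f g : EE N → G} (hf : BM f) (hg : BM g) : BM fun x => f x - g x := by
  obtain ⟨mf, C, hC⟩ := hf
  obtain ⟨mg, D, hD⟩ := hg
  exact ⟨mf.sub mg, C + D, fun x => (norm_sub_le _ _).trans (add_le_add (hC x) (hD x))⟩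

lemma BM.const (c : G) : BM fun _ : EE N => c := ⟨measurable_const, ‖c‖, fun _ => le_rfl⟩

lemma BM.norm {f : EE N → G} (hf : BM f) : BM fun x => ‖f x‖ :=
  ⟨hf.1.norm, hf.2.choose, fun x => by simpa using hf.2.choose_spec x⟩

lemma BM.shift {f : EE N → G} (hf : BM f) (a : EE N) : BM fun x => f (x + a) :=
  ⟨hf.1.comp (measurable_add_const a), hf.2.choose, fun x => hf.2.choose_spec _⟩

lemma BM.sq {f : EE N → ℝ} (hf : BM f) : BM fun x => f x ^ 2 := by
  simpa [pow_two] using hf.mul hf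

lemma BL.BM {f : EE N → G} (h : BL f) : BM f :=
  ⟨h.cont.measurable, by obtain ⟨K, C, _, _, _, h2⟩ := h; exact ⟨C, h2⟩⟩

lemma BM.comp {h : ℝ → ℝ} (hc : Continuous h) {f : EE N → ℝ} (hf : BM f) : BM fun x => h (f x) := by
  obtain ⟨mf, C, hC⟩ := hf
  obtain ⟨D, hD⟩ := (isCompact_Icc (a := -C) (b := C)).exists_bound_of_continuousOn hc.continuousOn
  exact ⟨hc.measurable.comp mf, D, fun x => hD _ (abs_le.1 (hC x))⟩

lemma BM.off {f : EE N → ℝ} (hf : BM f) {R : ℝ} (hs : ∀ x, x ∉ closedBall (0 : EE N) R → f x = 0) :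
    Integrable f := by
  obtain ⟨mf, C, hC⟩ := hf
  exact int_cpt mf hC hs

lemma BM.on {f : EE N → ℝ} (hf : BM f) {s : Set (EE N)} (hs : volume s ≠ ⊤) : IntegrableOn f s := by
  obtain ⟨mf, C, hC⟩ := hf
  exact Measure.integrableOn_of_bounded (M := C) hs mf.aestronglyMeasurable (Eventually.of_forall hC)

lemma BM.grad {v : EE N → ℝ} {K : NNReal} (hv : LipschitzWith K v) : BM (gradient v) :=
  ⟨grad_meas v, K, grad_le hv⟩

lemma BM.av {p ε : ℝ} (hp1 : 1 < p) (hp2 : p < 2) (hε : 0 < ε) {u : EE N → EE N} (hu : BM u) :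
    BM fun x => Av p ε (u x) := by
  obtain ⟨mf, C, hC⟩ := hu
  refine ⟨(Av_cont hε).measurable.comp mf, 2 * aw p ε 0 * C, fun x => ?_⟩
  have := Av_lip0 hp1 hp2 hε (u x) 0
  simp only [Av, smul_zero, sub_zero] at this
  refine this.trans ?_
  have := (aw_pos (p := p) hε 0).le
  gcongr; exact hC x

end BMs

section Cac
variable {N : ℕ} {p ε Λ : ℝ} {f v : EE N → ℝ} {e : EE N} {h R : ℝ}

noncomputable def dq (v : EE N → ℝ) (h : ℝ) (e x : EE N) : ℝ := h⁻¹ * (v (x + h • e) - v x)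
noncomputable def Yh (v : EE N → ℝ) (h : ℝ) (e x : EE N) : EE N :=
  h⁻¹ • (gradient v (x + h • e) - gradient v x)
noncomputable def Xh (p ε : ℝ) (v : EE N → ℝ) (h : ℝ) (e x : EE N) : EE N :=
  h⁻¹ • (Av p ε (gradient v (x + h • e)) - Av p ε (gradient v x))

lemma dq_le {K : NNReal} (hv : LipschitzWith K v) (he : ‖e‖ = 1) (hh : 0 < h) (x : EE N) :
    |dq v h e x| ≤ K := by
  unfold dq
  rw [abs_mul, abs_of_pos (inv_pos.2 hh), inv_mul_le_iff₀ hh]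
  have := hv.norm_sub_le (x + h • e) x
  rw [add_sub_cancel_left, norm_smul, he, Real.norm_of_nonneg hh.le] at this
  rw [← Real.norm_eq_abs]; linarith

lemma dq_BL {K : NNReal} (hv : LipschitzWith K v) (he : ‖e‖ = 1) (hh : 0 < h) : BL (dq v h e) := by
  refine ⟨h⁻¹ * (2 * K), K, by positivity, K.2, fun x y => ?_, fun x => dq_le hv he hh x⟩
  unfold dq
  rw [← mul_sub, norm_mul, Real.norm_of_nonneg (inv_pos.2 hh).le, mul_assoc]
  gcongr
  have h1 := hv.norm_sub_le (x + h • e) (y + h • e)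
  have h2 := hv.norm_sub_le x y
  rw [add_sub_add_right_eq_sub] at h1
  calc _ = ‖(v (x + h • e) - v (y + h • e)) - (v x - v y)‖ := by congr 1; ring
    _ ≤ _ := (norm_sub_le _ _).trans (by linarith)

lemma dq_grad {K : NNReal} (hv : LipschitzWith K v) :
    ∀ᵐ x, HasGradientAt (dq v h e) (Yh v h e x) x := by
  filter_upwards [grad_ae hv, ae_shift (grad_ae hv) (h • e)] with x h1 h2
  exact hg_cmul h⁻¹ (hg_sub (hg_shift _ h2) h1)

lemma Yh_BM {K : NNReal} (hv : LipschitzWith K v) : BM (Yh v h e) :=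
  (BM.const h⁻¹).smul (((BM.grad hv).shift _).sub (BM.grad hv))

lemma Xh_BM (hp1 : 1 < p) (hp2 : p < 2) (hε : 0 < ε) {K : NNReal} (hv : LipschitzWith K v) : BM (Xh p ε v h e) :=
  (BM.const h⁻¹).smul ((((BM.grad hv).av hp1 hp2 hε).shift _).sub ((BM.grad hv).av hp1 hp2 hε))

lemma mem_ball1 {x : EE N} (he : ‖e‖ = 1) (hh : 0 < h) (hRh : R + h < 1) (hx : ‖x‖ ≤ R) :
    x ∈ ball (0:EE N) 1 ∧ x + h • e ∈ ball (0:EE N) 1 := by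
  rw [mem_ball_zero_iff, mem_ball_zero_iff]
  refine ⟨by linarith, (norm_add_le _ _).trans_lt ?_⟩
  rw [norm_smul, he, Real.norm_of_nonneg hh.le]; linarith

lemma el_shift (hp1 : 1 < p) (hp2 : p < 2) (hε : 0 < ε) (S : Sol p ε f Λ v) (he : ‖e‖ = 1) (hh : 0 < h)
    (hRh : R + h < 1) {ψ : EE N → ℝ} (hψ : BL ψ) (hs : ∀ x, x ∉ closedBall (0 : EE N) R → ψ x = 0) :
    ∫ x, ⟪gradient ψ x, Xh p ε v h e x⟫_ℝ = ∫ x, h⁻¹ * (f (x + h • e) - f x) * ψ x := by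
  obtain ⟨Kv, hv⟩ := S.lip
  obtain ⟨K1, hK1⟩ := hψ.lip
  obtain ⟨K2, hK2⟩ := (hψ.shift (-(h • e))).lip
  have e1 := S.el ψ K1 R hK1 (by linarith) hs
  have e2 := S.el _ K2 (R + h) hK2 hRh (fun x hx => by
    apply hs; intro h1; apply hx
    rw [mem_closedBall_zero_iff] at *
    have : x = (x + -(h • e)) + h • e := by abel
    rw [this]
    refine (norm_add_le _ _).trans ?_
    rw [norm_smul, he, Real.norm_of_nonneg hh.le]; linarith)
  have gs : ∀ x, gradient (fun x => ψ (x + -(h • e))) x = gradient ψ (x + -(h • e)) := by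
    intro x; unfold gradient; rw [fderiv_comp_add_right]
  simp_rw [gs] at e2
  rw [← integral_add_right_eq_self _ (h • e)] at e2
  rw [← integral_add_right_eq_self (fun x => f x * ψ (x + -(h • e))) (h • e)] at e2
  simp only [add_neg_cancel_right] at e2
  have gz : ∀ x, x ∉ closedBall (0 : EE N) R → gradient ψ x = 0 := fun x hx => grad_zero_off hs hx
  have i1 : Integrable fun x => ⟪gradient ψ x, Av p ε (gradient v x)⟫_ℝ :=
    ((BM.grad hK1).inner ((BM.grad hv).av hp1 hp2 hε)).off (R := R) fun x hx => by rw [gz x hx]; simp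
  have i2 : Integrable fun x => ⟪gradient ψ x, Av p ε (gradient v (x + h • e))⟫_ℝ :=
    ((BM.grad hK1).inner (((BM.grad hv).av hp1 hp2 hε).shift _)).off (R := R)
      fun x hx => by rw [gz x hx]; simp
  have cs : HasCompactSupport ψ :=
    HasCompactSupport.of_support_subset_isCompact (isCompact_closedBall (0:EE N) R) fun x hx => by
      by_contra h'; exact hx (hs x h')
  have j1 : Integrable fun x => f x * ψ x :=
    (S.fcont.mul hψ.cont).integrable_of_hasCompactSupport cs.mul_left
  have j2 : Integrable fun x => f (x + h • e) * ψ x :=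
    ((S.fcont.comp (continuous_add_const _)).mul hψ.cont).integrable_of_hasCompactSupport cs.mul_left
  have l1 : ∀ x, ⟪gradient ψ x, Xh p ε v h e x⟫_ℝ = h⁻¹ * (⟪gradient ψ x, Av p ε (gradient v (x + h • e))⟫_ℝ
    - ⟪gradient ψ x, Av p ε (gradient v x)⟫_ℝ) := by
    intro x; unfold Xh; rw [real_inner_smul_right, inner_sub_right]
  have l2 : ∀ x, h⁻¹ * (f (x + h • e) - f x) * ψ x = h⁻¹ * (f (x + h • e) * ψ x - f x * ψ x) := by
    intro x; ring
  simp_rw [l1, l2]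
  rw [integral_const_mul, integral_const_mul, integral_sub i2 i1, integral_sub j2 j1, e1, e2]

/-- structural bounds at a good point -/
lemma XY_bds (hp1 : 1 < p) (hp2 : p < 2) (hε : 0 < ε) (hε1 : ε ≤ 1) (hh : 0 < h) {x : EE N}
    (h1 : ‖gradient v x‖ ≤ 1) (h2 : ‖gradient v (x + h • e)‖ ≤ 1) :
    ∃ a : ℝ, 1 / 2 ≤ a ∧ a ≤ aw p ε ‖gradient v x‖ ∧
      (p - 1) * a * ‖Yh v h e x‖ ^ 2 ≤ ⟪Xh p ε v h e x, Yh v h e x⟫_ℝ ∧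
      ‖Xh p ε v h e x‖ ≤ 2 * a * ‖Yh v h e x‖ := by
  set ξ := gradient v (x + h • e)
  set ζ := gradient v x
  refine ⟨aw p ε (max ‖ξ‖ ‖ζ‖), ?_, ?_, ?_, ?_⟩
  · have : aw p ε 1 ≤ aw p ε (max ‖ξ‖ ‖ζ‖) :=
      aw_anti hp2 hε (le_max_of_le_left (norm_nonneg _)) (max_le h2 h1)
    refine le_trans ?_ this
    unfold aw
    calc (1:ℝ) / 2 = 2 ^ (-1 : ℝ) := by rw [Real.rpow_neg_one]; norm_num
      _ ≤ 2 ^ ((p - 2) / 2) := Real.rpow_le_rpow_of_exponent_le (by norm_num) (by linarith)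
      _ ≤ _ := Real.rpow_le_rpow_of_nonpos (by positivity) (by nlinarith) (by linarith)
  · exact aw_anti hp2 hε (norm_nonneg _) (le_max_right _ _)
  · unfold Xh Yh
    rw [real_inner_smul_left, real_inner_smul_right, norm_smul, Real.norm_of_nonneg (inv_pos.2 hh).le]
    have := mul_le_mul_of_nonneg_left (Av_mono hp1 hp2 hε ξ ζ) (by positivity : 0 ≤ h⁻¹ * h⁻¹)
    simp only [ξ, ζ] at *
    nlinarith
  · unfold Xh Yh
    rw [norm_smul, norm_smul, Real.norm_of_nonneg (inv_pos.2 hh).le]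
    have := mul_le_mul_of_nonneg_left (Av_lip hp1 hp2 hε ξ ζ) (inv_pos.2 hh).le
    simp only [ξ, ζ] at *
    linarith

variable {φ g Q : ℝ → ℝ}

noncomputable def tst (v : EE N → ℝ) (h : ℝ) (e : EE N) (R : ℝ) (g : ℝ → ℝ) (x : EE N) : ℝ :=
  eta R x * eta R x * g (dq v h e x)

lemma tst_grad (hN : 1 ≤ N) (hR : 0 < R) {K : NNReal} (hv : LipschitzWith K v)
    (hg : ∀ t, HasDerivAt g (φ t ^ 2) t) :
    ∀ᵐ x, gradient (tst v h e R g) x = (eta R x ^ 2 * φ (dq v h e x) ^ 2) • Yh v h e x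
      + (g (dq v h e x) * (2 * eta R x)) • geta R x := by
  filter_upwards [eta_grad hN hR, dq_grad (h := h) (e := e) hv] with x h1 h2
  have h3 := hg_mul (hg_mul h1.1 h1.1) (hg_comp (hg (dq v h e x)) h2)
  change gradient (fun x => eta R x * eta R x * g (dq v h e x)) x = _
  rw [h3.gradient]
  module

lemma tst_BL (hR : 0 < R) {K : NNReal} (hv : LipschitzWith K v) (he : ‖e‖ = 1) (hh : 0 < h)
    (hφ : Continuous φ) (hg : ∀ t, HasDerivAt g (φ t ^ 2) t) : BL (tst v h e R g) :=
  ((eta_BL hR.le).mul (eta_BL hR.le)).mul ((dq_BL hv he hh).comp hg (hφ.pow 2))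

lemma tst_off {x : EE N} (hx : x ∉ closedBall (0:EE N) R) : tst v h e R g x = 0 := by
  rw [mem_closedBall_zero_iff, not_le] at hx
  unfold tst; rw [eta_out hx.le]; ring

lemma tst_rhs (S : Sol p ε f Λ v) (he : ‖e‖ = 1) (hh : 0 < h) (hR : 0 < R)
    (hRh : R + h < 1) (hφ : Continuous φ) (hg : ∀ t, HasDerivAt g (φ t ^ 2) t) (hg0 : ∀ t, 0 ≤ g t) :
    ∫ x, h⁻¹ * (f (x + h • e) - f x) * tst v h e R g x ≤ ∫ x in ball (0:EE N) R, Λ * g (dq v h e x) := by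
  obtain ⟨K, hv⟩ := S.lip
  have gc : Continuous g := continuous_iff_continuousAt.2 fun t => (hg t).continuousAt
  rw [← integral_indicator measurableSet_ball]
  have cs : HasCompactSupport (tst v h e R g) :=
    HasCompactSupport.of_support_subset_isCompact (isCompact_closedBall (0:EE N) R) fun x hx => by
      by_contra h'; exact hx (tst_off h')
  refine integral_mono ?_ ?_ ?_
  · apply Continuous.integrable_of_hasCompactSupport _ cs.mul_left
    have := (tst_BL hR hv he hh hφ hg).cont
    have := S.fcont
    fun_prop
  · rw [integrable_indicator_iff measurableSet_ball]
    exact ((BM.const Λ).mul ((dq_BL hv he hh).BM.comp gc)).on measure_ball_lt_top.ne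
  · intro x
    by_cases hx : x ∈ ball (0:EE N) R
    · simp only [indicator_of_mem hx]
      rw [mem_ball_zero_iff] at hx
      obtain ⟨b1, b2⟩ := mem_ball1 he hh hRh hx.le
      have := S.flip _ b2 _ b1
      rw [add_sub_cancel_left, norm_smul, he, Real.norm_of_nonneg hh.le, mul_one] at this
      have f1 : h⁻¹ * (f (x + h • e) - f x) ≤ Λ := by
        rw [inv_mul_le_iff₀ hh]; linarith [(abs_le.1 this).2]
      have hΛ : 0 ≤ Λ := by
        by_contra hn
        have := (abs_nonneg _).trans this
        nlinarith
      have n0 := eta_nonneg hR.le x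
      have n1 := eta_le hR.le (by linarith) x
      unfold tst
      have : 0 ≤ eta R x * eta R x * g (dq v h e x) := mul_nonneg (mul_nonneg n0 n0) (hg0 _)
      calc _ ≤ Λ * (eta R x * eta R x * g (dq v h e x)) := by gcongr
        _ ≤ Λ * (1 * 1 * g (dq v h e x)) := by gcongr; exact hg0 _
        _ = _ := by ring
    · simp only [indicator_of_notMem hx]
      rw [mem_ball_zero_iff, not_lt] at hx
      unfold tst; rw [eta_out hx]; simp

lemma en_BM (hR : 0 < R) {K : NNReal} (hv : LipschitzWith K v) (he : ‖e‖ = 1) (hh : 0 < h)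
    (hφ : Continuous φ) : BM fun x => eta R x ^ 2 * φ (dq v h e x) ^ 2 * ‖Yh v h e x‖ ^ 2 :=
  (((eta_BL hR.le).BM.sq).mul ((dq_BL hv he hh).BM.comp hφ).sq).mul (Yh_BM hv).norm.sq

lemma en_int (hR : 0 < R) {K : NNReal} (hv : LipschitzWith K v) (he : ‖e‖ = 1) (hh : 0 < h)
    (hφ : Continuous φ) : Integrable fun x => eta R x ^ 2 * φ (dq v h e x) ^ 2 * ‖Yh v h e x‖ ^ 2 :=
  (en_BM hR hv he hh hφ).off (R := R) fun x hx => by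
      rw [mem_closedBall_zero_iff, not_le] at hx
      rw [eta_out hx.le]; ring

lemma cacS (hN : 1 ≤ N) (hp1 : 1 < p) (hp2 : p < 2) (hε : 0 < ε) (hε1 : ε ≤ 1) (S : Sol p ε f Λ v)
    (he : ‖e‖ = 1) (hh : 0 < h) (hR : 0 < R) (hRh : R + h < 1) (hφ : Continuous φ) (hQ : Continuous Q)
    (hφ0 : ∀ t, 0 ≤ φ t)
    (hg : ∀ t, HasDerivAt g (φ t ^ 2) t) (hg0 : ∀ t, 0 ≤ g t) (hgQ : ∀ t, g t ≤ φ t * Q t) :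
    ∫ x, eta R x ^ 2 * φ (dq v h e x) ^ 2 * ‖Yh v h e x‖ ^ 2 ≤
      ∫ x in ball (0:EE N) R, (128 / (p - 1) ^ 2 * (aw p ε ‖gradient v x‖ * Q (dq v h e x) ^ 2)
        + 4 / (p - 1) * (Λ * g (dq v h e x))) := by
  obtain ⟨K, hv⟩ := S.lip
  have gc : Continuous g := continuous_iff_continuousAt.2 fun t => (hg t).continuousAt
  have tBL := tst_BL hR hv he hh hφ hg
  obtain ⟨Kt, hKt⟩ := tBL.lip
  have E := el_shift hp1 hp2 hε S he hh hRh tBL (fun x hx => tst_off hx)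
  have E2 := tst_rhs S he hh hR hRh hφ hg hg0
  rw [← E] at E2
  have awBM : BM fun x => aw p ε ‖gradient v x‖ := by
    refine ⟨?_, aw p ε 0, fun x => ?_⟩
    · unfold aw
      have := (grad_meas v).norm
      fun_prop
    · rw [Real.norm_of_nonneg (aw_pos hε _).le]; exact aw_zero_le hp2 hε (norm_nonneg _)
  have dBM := (dq_BL hv he hh).BM
  have i1 : IntegrableOn (fun x => aw p ε ‖gradient v x‖ * Q (dq v h e x) ^ 2) (ball (0:EE N) R) :=
    (awBM.mul (dBM.comp hQ).sq).on measure_ball_lt_top.ne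
  have i2 : IntegrableOn (fun x => Λ * g (dq v h e x)) (ball (0:EE N) R) :=
    ((BM.const Λ).mul (dBM.comp gc)).on measure_ball_lt_top.ne
  have i3 : Integrable fun x => ⟪gradient (tst v h e R g) x, Xh p ε v h e x⟫_ℝ :=
    ((BM.grad hKt).inner (Xh_BM hp1 hp2 hε hv)).off (R := R) fun x hx => by
      rw [grad_zero_off (fun x hx => tst_off hx) hx]; simp
  rw [integral_add (i1.const_mul _) (i2.const_mul _), integral_const_mul, integral_const_mul]
  have pw : (p - 1) / 4 * ∫ x, eta R x ^ 2 * φ (dq v h e x) ^ 2 * ‖Yh v h e x‖ ^ 2 ≤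
      ∫ x, (⟪gradient (tst v h e R g) x, Xh p ε v h e x⟫_ℝ + 32 / (p - 1) * (ball (0:EE N) R).indicator
        (fun x => aw p ε ‖gradient v x‖ * Q (dq v h e x) ^ 2) x) := by
    rw [← integral_const_mul]
    apply integral_mono_ae ((en_int hR hv he hh hφ).const_mul _)
      (i3.add ((integrable_indicator_iff measurableSet_ball).2 i1 |>.const_mul _))
    filter_upwards [tst_grad (h := h) (e := e) hN hR hv hg, S.grad1, ae_shift S.grad1 (h • e)]
      with x h1 h2 h3
    simp only [Pi.add_apply]
    rw [h1]
    by_cases hx : ‖x‖ < R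
    · have hx' : x ∈ ball (0:EE N) R := by rwa [mem_ball_zero_iff]
      obtain ⟨b1, b2⟩ := mem_ball1 he hh hRh hx.le
      obtain ⟨a, a1, a2, a3, a4⟩ := XY_bds hp1 hp2 hε hε1 hh (h2 b1) (h3 b2)
      rw [indicator_of_mem hx', inner_add_left, real_inner_smul_left, real_inner_smul_left,
        real_inner_comm]
      have n0 := eta_nonneg hR.le x
      have n1 := geta_le hR.le (by linarith : R ≤ 1) x
      have c1 : -(2 * (2 * a * ‖Yh v h e x‖)) ≤ ⟪geta R x, Xh p ε v h e x⟫_ℝ := by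
        have := abs_le.1 (abs_real_inner_le_norm (geta R x) (Xh p ε v h e x))
        have b := mul_le_mul n1 a4 (norm_nonneg _) (by norm_num)
        linarith [this.1]
      set w := dq v h e x
      set y := ‖Yh v h e x‖
      have hy : 0 ≤ y := norm_nonneg _
      have q0 : 0 ≤ φ w * Q w := (hg0 w).trans (hgQ w)
      have c2 : -(φ w * Q w * (2 * eta R x) * (2 * (2 * a * y))) ≤
          g w * (2 * eta R x) * ⟪geta R x, Xh p ε v h e x⟫_ℝ := by
        have d1 : g w * (2 * eta R x) * (-(2 * (2 * a * y))) ≤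
          g w * (2 * eta R x) * ⟪geta R x, Xh p ε v h e x⟫_ℝ :=
          mul_le_mul_of_nonneg_left c1 (mul_nonneg (hg0 _) (by positivity))
        have d2 : g w * ((2 * eta R x) * (2 * (2 * a * y))) ≤ φ w * Q w * ((2 * eta R x) * (2 * (2 * a * y))) :=
          mul_le_mul_of_nonneg_right (hgQ w) (by positivity)
        linarith
      have c3 := mul_le_mul_of_nonneg_left a3 (by positivity : 0 ≤ eta R x ^ 2 * φ w ^ 2)
      have c4 : a * Q w ^ 2 ≤ aw p ε ‖gradient v x‖ * Q w ^ 2 := by gcongr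
      have c5 : 32 / (p - 1) * (a * Q w ^ 2) ≤ 32 / (p - 1) * (aw p ε ‖gradient v x‖ * Q w ^ 2) := by
        have : 0 < p - 1 := by linarith
        gcongr
      have hp0 : 0 < p - 1 := by linarith
      have c6 : (p - 1) / 4 * (eta R x * φ w * y) ^ 2 ≤
          (p - 1) * a * (eta R x * φ w * y) ^ 2 - 8 * a * (eta R x * φ w * y) * Q w
          + 32 / (p - 1) * (a * Q w ^ 2) := by
        set t := eta R x * φ w * y
        have s1 : (p - 1) / 2 * a * t ^ 2 - 8 * a * t * Q w + 32 / (p - 1) * (a * Q w ^ 2)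
          = a / (2 * (p - 1)) * ((p - 1) * t - 8 * Q w) ^ 2 := by field_simp; ring
        have s2 : 0 ≤ a / (2 * (p - 1)) * ((p - 1) * t - 8 * Q w) ^ 2 := by positivity
        have s3 : (p - 1) / 4 * t ^ 2 ≤ (p - 1) / 2 * a * t ^ 2 := by
          have : (p - 1) / 4 ≤ (p - 1) / 2 * a := by nlinarith only [a1, hp0]
          gcongr
        linarith
      linear_combination c2 + c3 + c5 + c6
    · have hx' : x ∉ ball (0:EE N) R := by rwa [mem_ball_zero_iff]
      rw [indicator_of_notMem hx', eta_out (not_lt.1 hx)]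
      simp
  rw [integral_add i3 ((integrable_indicator_iff measurableSet_ball).2 i1 |>.const_mul _),
    integral_const_mul, integral_indicator measurableSet_ball] at pw
  have hp0 : 0 < p - 1 := by linarith
  have := mul_le_mul_of_nonneg_left (pw.trans (add_le_add_left E2 _)) (by positivity : 0 ≤ 4 / (p - 1))
  have e1 : 4 / (p - 1) * ((p - 1) / 4 * ∫ x, eta R x ^ 2 * φ (dq v h e x) ^ 2 * ‖Yh v h e x‖ ^ 2)
     = ∫ x, eta R x ^ 2 * φ (dq v h e x) ^ 2 * ‖Yh v h e x‖ ^ 2 := by field_simp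
  rw [e1] at this
  refine this.trans (le_of_eq ?_)
  field_simp; ring

end Cac
end AP

namespace AP
open Filter Topology

section CacT
variable {N : ℕ} {p ε Λ : ℝ} {f v : EE N → ℝ} {e : EE N} {h R : ℝ} {φ g Q : ℝ → ℝ}

lemma Av_le2 (hp1 : 1 < p) (hp2 : p < 2) (hε : 0 < ε) (hε1 : ε ≤ 1) {ξ : EE N} (h : ‖ξ‖ ≤ 1) :
    ‖Av p ε ξ‖ ≤ 2 := by
  refine (Av_norm_le hp1 hε ξ).trans ?_
  calc _ ≤ (2:ℝ) ^ ((p - 1) / 2) := by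
        apply Real.rpow_le_rpow (bpos hε _).le _ (by linarith)
        nlinarith [norm_nonneg ξ]
    _ ≤ (2:ℝ) ^ (1:ℝ) := Real.rpow_le_rpow_of_exponent_le (by norm_num) (by linarith)
    _ = 2 := Real.rpow_one _

lemma fd1_real {Z : EE N → EE N} (hZ : BL Z) (hs : ∀ x, x ∉ closedBall (0 : EE N) R → Z x = 0) (y : EE N) :
    ∫ x, ‖Z (x + y) - Z x‖ ≤ ∫ x, ‖fderiv ℝ Z x y‖ := by
  obtain ⟨K, hK⟩ := hZ.lip
  have h := fd_glob hK hs 1 one_ne_zero y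
  simp only [pow_one] at h
  have c := hZ.cont
  have m1 : AEStronglyMeasurable (fun x => ‖Z (x + y) - Z x‖) volume :=
    (by fun_prop : Continuous fun x => ‖Z (x + y) - Z x‖).aestronglyMeasurable
  rw [integral_eq_lintegral_of_nonneg_ae (Eventually.of_forall fun _ => norm_nonneg _) m1,
    integral_eq_lintegral_of_nonneg_ae (Eventually.of_forall fun _ => norm_nonneg _)
      (measurable_fderiv_apply_const ℝ Z y).norm.aestronglyMeasurable]
  apply ENNReal.toReal_mono _ h
  have : Integrable fun x => ‖fderiv ℝ Z x y‖ := by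
    apply int_cpt (R := R) (C := K * ‖y‖) (measurable_fderiv_apply_const ℝ Z y).norm
    · intro x
      rw [abs_norm]
      exact (ContinuousLinearMap.le_opNorm _ _).trans
        (mul_le_mul_of_nonneg_right (norm_fderiv_le_of_lipschitz ℝ hK) (norm_nonneg _))
    · intro x hx
      have : Z =ᶠ[𝓝 x] fun _ => 0 := by
        filter_upwards [isClosed_closedBall.isOpen_compl.mem_nhds hx] with y hy using hs y hy
      rw [this.fderiv_eq]; simp
  exact (hasFiniteIntegral_iff_ofReal (Eventually.of_forall fun _ => norm_nonneg _)).1 this.2 |>.ne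

lemma zx_bd (hp1 : 1 < p) (hp2 : p < 2) (hε : 0 < ε) (hε1 : ε ≤ 1) (S : Sol p ε f Λ v) (he : ‖e‖ = 1)
    (hh : 0 < h) (hRh : R + h < 1) {Z : EE N → EE N} (hZ : BL Z)
    (hs : ∀ x, x ∉ closedBall (0 : EE N) R → Z x = 0) :
    ∫ x, ⟪Z x, Xh p ε v h e x⟫_ℝ ≤ 2 * ∫ x, ‖fderiv ℝ Z x e‖ := by
  obtain ⟨K, hv⟩ := S.lip
  have aBM := (BM.grad hv).av hp1 hp2 hε
  have hs2 : ∀ x, x ∉ closedBall (0 : EE N) (R + h) → Z (x + -(h • e)) = 0 := fun x hx => by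
    apply hs; intro h1; apply hx
    rw [mem_closedBall_zero_iff] at *
    have : x = (x + -(h • e)) + h • e := by abel
    rw [this]
    refine (norm_add_le _ _).trans ?_
    rw [norm_smul, he, Real.norm_of_nonneg hh.le]; linarith
  have hs3 : ∀ x, x ∉ closedBall (0 : EE N) (R + h) → Z x = 0 := fun x hx => hs x fun h1 =>
    hx (closedBall_subset_closedBall (by linarith) h1)
  have i1 : Integrable fun x => ⟪Z x, Av p ε (gradient v x)⟫_ℝ :=
    (hZ.BM.inner aBM).off (R := R) fun x hx => by rw [hs x hx]; simp
  have i2 : Integrable fun x => ⟪Z x, Av p ε (gradient v (x + h • e))⟫_ℝ :=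
    (hZ.BM.inner (aBM.shift _)).off (R := R) fun x hx => by rw [hs x hx]; simp
  have i3 : Integrable fun x => ⟪Z (x + -(h • e)), Av p ε (gradient v x)⟫_ℝ :=
    ((hZ.shift _).BM.inner aBM).off (R := R + h) fun x hx => by rw [hs2 x hx]; simp
  have i4 : Integrable fun x => ‖Z (x + -(h • e)) - Z x‖ :=
    ((hZ.shift _).BM.sub hZ.BM).norm.off (R := R + h) fun x hx => by rw [hs2 x hx, hs3 x hx]; simp
  have l1 : ∀ x, ⟪Z x, Xh p ε v h e x⟫_ℝ = h⁻¹ * (⟪Z x, Av p ε (gradient v (x + h • e))⟫_ℝ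
    - ⟪Z x, Av p ε (gradient v x)⟫_ℝ) := by
    intro x; unfold Xh; rw [real_inner_smul_right, inner_sub_right]
  simp_rw [l1]
  rw [integral_const_mul, integral_sub i2 i1]
  have e2 : ∫ x, ⟪Z x, Av p ε (gradient v (x + h • e))⟫_ℝ = ∫ x, ⟪Z (x + -(h • e)), Av p ε (gradient v x)⟫_ℝ := by
    rw [← integral_add_right_eq_self (fun x => ⟪Z (x + -(h • e)), Av p ε (gradient v x)⟫_ℝ) (h • e)]
    simp only [add_neg_cancel_right]
  rw [e2, ← integral_sub i3 i1]
  have b1 : ∫ x, (⟪Z (x + -(h • e)), Av p ε (gradient v x)⟫_ℝ - ⟪Z x, Av p ε (gradient v x)⟫_ℝ) ≤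
      ∫ x, 2 * ‖Z (x + -(h • e)) - Z x‖ := by
    apply integral_mono_ae (i3.sub i1) (i4.const_mul 2)
    filter_upwards [S.grad1] with x hx
    simp only [Pi.sub_apply]
    rw [← inner_sub_left]
    by_cases hb : x ∈ closedBall (0:EE N) (R + h)
    · have : x ∈ ball (0:EE N) 1 := by
        rw [mem_closedBall_zero_iff] at hb; rw [mem_ball_zero_iff]; linarith
      refine (real_inner_le_norm _ _).trans ?_
      rw [mul_comm]
      gcongr
      exact Av_le2 hp1 hp2 hε hε1 (hx this)
    · rw [hs2 x hb, hs3 x hb]; simp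
  rw [integral_const_mul] at b1
  have b2 := fd1_real hZ hs (-(h • e))
  have b3 : ∀ x, ‖fderiv ℝ Z x (-(h • e))‖ = h * ‖fderiv ℝ Z x e‖ := by
    intro x; rw [map_neg, norm_neg, map_smul, norm_smul, Real.norm_of_nonneg hh.le]
  simp_rw [b3] at b2
  rw [integral_const_mul] at b2
  rw [inv_mul_le_iff₀ hh]
  linarith

lemma cacT (hN : 1 ≤ N) (hp1 : 1 < p) (hp2 : p < 2) (hε : 0 < ε) (hε1 : ε ≤ 1) (S : Sol p ε f Λ v)
    (he : ‖e‖ = 1) (hh : 0 < h) (hR : 0 < R) (hRh : R + h < 1) (hφ : Continuous φ)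
    (hg : ∀ t, HasDerivAt g (φ t ^ 2) t) (hg0 : ∀ t, 0 ≤ g t) :
    ∫ x, eta R x ^ 2 * φ (dq v h e x) ^ 2 * ‖Yh v h e x‖ ^ 2 ≤
      ∫ x in ball (0:EE N) R, (256 / (p - 1) ^ 2 * φ (dq v h e x) ^ 2
        + 4 / (p - 1) * (Λ + 24) * g (dq v h e x)) := by
  obtain ⟨K, hv⟩ := S.lip
  have gc : Continuous g := continuous_iff_continuousAt.2 fun t => (hg t).continuousAt
  have tBL := tst_BL hR hv he hh hφ hg
  obtain ⟨Kt, hKt⟩ := tBL.lip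
  have E := el_shift hp1 hp2 hε S he hh hRh tBL (fun x hx => tst_off hx)
  have E2 := tst_rhs S he hh hR hRh hφ hg hg0
  rw [← E] at E2
  have dBM := (dq_BL hv he hh).BM
  have hp0 : 0 < p - 1 := by linarith
  set Z : EE N → EE N := fun x => g (dq v h e x) • (eta R x • x) with hZdef
  have hZ : BL Z := ((dq_BL hv he hh).comp hg (hφ.pow 2)).smul (etax_BL hR.le)
  have hZs : ∀ x, x ∉ closedBall (0 : EE N) R → Z x = 0 := fun x hx => by
    rw [mem_closedBall_zero_iff, not_le] at hx
    simp [Z, eta_out hx.le]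
  have Ez := zx_bd hp1 hp2 hε hε1 S he hh hRh hZ hZs
  have i1 : IntegrableOn (fun x => φ (dq v h e x) ^ 2) (ball (0:EE N) R) :=
    (dBM.comp hφ).sq.on measure_ball_lt_top.ne
  have i2 : IntegrableOn (fun x => g (dq v h e x)) (ball (0:EE N) R) :=
    (dBM.comp gc).on measure_ball_lt_top.ne
  have i3 : Integrable fun x => ⟪gradient (tst v h e R g) x, Xh p ε v h e x⟫_ℝ :=
    ((BM.grad hKt).inner (Xh_BM hp1 hp2 hε hv)).off (R := R) fun x hx => by
      rw [grad_zero_off (fun x hx => tst_off hx) hx]; simp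
  have i4 : Integrable fun x => ⟪Z x, Xh p ε v h e x⟫_ℝ :=
    (hZ.BM.inner (Xh_BM hp1 hp2 hε hv)).off (R := R) fun x hx => by rw [hZs x hx]; simp
  have i5 := en_int hR hv he hh hφ
  have i6 : IntegrableOn (fun x => 24 * g (dq v h e x) + 64 / (p - 1) * φ (dq v h e x) ^ 2) (ball (0:EE N) R) :=
    (i2.const_mul _).add (i1.const_mul _)
  have i6' := (integrable_indicator_iff measurableSet_ball).2 i6
  have pw1 : (p - 1) / 2 * ∫ x, eta R x ^ 2 * φ (dq v h e x) ^ 2 * ‖Yh v h e x‖ ^ 2 ≤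
      ∫ x, (⟪gradient (tst v h e R g) x, Xh p ε v h e x⟫_ℝ + 4 * ⟪Z x, Xh p ε v h e x⟫_ℝ) := by
    rw [← integral_const_mul]
    apply integral_mono_ae (i5.const_mul _) (i3.add (i4.const_mul _))
    filter_upwards [tst_grad (h := h) (e := e) hN hR hv hg, S.grad1, ae_shift S.grad1 (h • e)]
      with x h1 h2 h3
    simp only [Pi.add_apply]
    rw [h1]
    by_cases hx : ‖x‖ < R
    · obtain ⟨b1, b2⟩ := mem_ball1 he hh hRh hx.le
      obtain ⟨a, a1, a2, a3, a4⟩ := XY_bds hp1 hp2 hε hε1 hh (h2 b1) (h3 b2)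
      simp only [Z, geta, if_pos hx]
      rw [inner_add_left, real_inner_smul_left, real_inner_smul_left, real_inner_smul_left,
        real_inner_smul_left, real_inner_smul_left, real_inner_comm]
      have c0 : (p - 1) / 2 * ‖Yh v h e x‖ ^ 2 ≤ ⟪Xh p ε v h e x, Yh v h e x⟫_ℝ := by
        refine le_trans ?_ a3
        gcongr; nlinarith only [a1, hp1]
      have c3 := mul_le_mul_of_nonneg_left c0 (by positivity : 0 ≤ eta R x ^ 2 * φ (dq v h e x) ^ 2)
      linear_combination c3
    · simp [Z, eta_out (not_lt.1 hx)]
  rw [integral_add i3 (i4.const_mul _), integral_const_mul] at pw1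
  have pw2 : 8 * ∫ x, ‖fderiv ℝ Z x e‖ ≤ ∫ x, ((p - 1) / 4 * (eta R x ^ 2 * φ (dq v h e x) ^ 2 * ‖Yh v h e x‖ ^ 2)
      + (ball (0:EE N) R).indicator
        (fun x => 24 * g (dq v h e x) + 64 / (p - 1) * φ (dq v h e x) ^ 2) x) := by
    rw [← integral_const_mul]
    apply integral_mono_of_nonneg (Eventually.of_forall fun x => by positivity)
      ((i5.const_mul _).add i6')
    filter_upwards [eta_grad hN hR, dq_grad (h := h) (e := e) hv] with x h1 h2
    simp only [Pi.add_apply]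
    have d1 : HasFDerivAt Z _ x :=
      ((hg_comp (hg (dq v h e x)) h2).hasFDerivAt).smul (h1.1.hasFDerivAt.smul (hasFDerivAt_id x))
    rw [d1.fderiv]
    by_cases hx : ‖x‖ < R
    · have hx' : x ∈ ball (0:EE N) R := by rwa [mem_ball_zero_iff]
      rw [indicator_of_mem hx']
      have n0 := eta_nonneg hR.le x
      have n1 := geta_le hR.le (by linarith : R ≤ 1) x
      have n2 := eta_le hR.le (by linarith : R ≤ 1) x
      have hx1 : ‖x‖ ≤ 1 := by linarith
      set w := dq v h e x
      set y := ‖Yh v h e x‖ with hy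
      have hg0w := hg0 w
      have t1 : ‖g w • (eta R x • e + ⟪geta R x, e⟫_ℝ • x)‖ ≤ 3 * g w := by
        rw [norm_smul, Real.norm_of_nonneg hg0w]
        have : ‖eta R x • e + ⟪geta R x, e⟫_ℝ • x‖ ≤ 3 := by
          refine (norm_add_le _ _).trans ?_
          rw [norm_smul, norm_smul, he, Real.norm_of_nonneg n0]
          have := (norm_inner_le_norm (𝕜 := ℝ) (geta R x) e)
          rw [he] at this
          nlinarith [norm_nonneg x, norm_nonneg ⟪geta R x, e⟫_ℝ]
        nlinarith only [this, hg0w]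
      have t2 : ‖(φ w ^ 2 * ⟪Yh v h e x, e⟫_ℝ) • (eta R x • x)‖ ≤ φ w ^ 2 * y * eta R x := by
        rw [norm_smul, norm_smul, norm_mul, Real.norm_of_nonneg n0, Real.norm_of_nonneg (sq_nonneg _)]
        have := (norm_inner_le_norm (𝕜 := ℝ) (Yh v h e x) e)
        rw [he, mul_one] at this
        calc _ ≤ (φ w ^ 2 * y) * (eta R x * 1) := by gcongr
          _ = _ := by ring
      have t3 : ‖g w • (eta R x • e + ⟪geta R x, e⟫_ℝ • x) + (φ w ^ 2 * ⟪Yh v h e x, e⟫_ℝ) • (eta R x • x)‖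
          ≤ 3 * g w + φ w ^ 2 * y * eta R x := (norm_add_le _ _).trans (add_le_add t1 t2)
      have t4 : 8 * (φ w ^ 2 * y * eta R x) ≤ (p - 1) / 4 * (eta R x ^ 2 * φ w ^ 2 * y ^ 2)
          + 64 / (p - 1) * φ w ^ 2 := by
        have s1 : (p - 1) / 4 * (eta R x ^ 2 * φ w ^ 2 * y ^ 2) + 64 / (p - 1) * φ w ^ 2
          - 8 * (φ w ^ 2 * y * eta R x) = φ w ^ 2 / (4 * (p - 1)) * ((p - 1) * (eta R x * y) - 16) ^ 2 := by
          field_simp; ring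
        have s2 : 0 ≤ φ w ^ 2 / (4 * (p - 1)) * ((p - 1) * (eta R x * y) - 16) ^ 2 := by positivity
        linarith
      have t5 : ‖((g w • (eta R x • ContinuousLinearMap.id ℝ (EE N) +
          ContinuousLinearMap.smulRight ((InnerProductSpace.toDual ℝ (EE N)) (geta R x)) (id x)) +
          ContinuousLinearMap.smulRight ((InnerProductSpace.toDual ℝ (EE N)) (φ w ^ 2 • Yh v h e x)) (eta R x • id x)) : EE N →L[ℝ] EE N) e‖
          = ‖g w • (eta R x • e + ⟪geta R x, e⟫_ℝ • x) + (φ w ^ 2 * ⟪Yh v h e x, e⟫_ℝ) • (eta R x • x)‖ := by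
        simp
      have t6 := t5.le.trans t3
      refine (mul_le_mul_of_nonneg_left t6 (by norm_num)).trans ?_
      linarith
    · have hx' : x ∉ ball (0:EE N) R := by rwa [mem_ball_zero_iff]
      rw [indicator_of_notMem hx']
      simp [eta_out (not_lt.1 hx), geta, hx]
  rw [integral_add (i5.const_mul _) i6', integral_const_mul, integral_indicator measurableSet_ball,
    integral_add (i2.const_mul _) (i1.const_mul _), integral_const_mul, integral_const_mul] at pw2
  rw [integral_const_mul] at E2
  rw [integral_add (i1.const_mul _) (i2.const_mul _), integral_const_mul, integral_const_mul]
  set I := ∫ x, eta R x ^ 2 * φ (dq v h e x) ^ 2 * ‖Yh v h e x‖ ^ 2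
  set I1 := ∫ x in ball (0:EE N) R, φ (dq v h e x) ^ 2
  set I2 := ∫ x in ball (0:EE N) R, g (dq v h e x)
  have fin : (p - 1) / 4 * I ≤ (Λ + 24) * I2 + 64 / (p - 1) * I1 := by linarith
  have := mul_le_mul_of_nonneg_left fin (by positivity : 0 ≤ 4 / (p - 1))
  have e1 : 4 / (p - 1) * ((p - 1) / 4 * I) = I := by field_simp
  rw [e1] at this
  refine this.trans (le_of_eq ?_)
  field_simp; ring

end CacT
end AP

namespace AP
open Filter Topology

section Lim
variable {N : ℕ} {p ε Λ : ℝ} {f v : EE N → ℝ} {e : EE N} {R : ℝ} {φ Φ Q1 Q2 : ℝ → ℝ}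

lemma fat {μ : Measure (EE N)} {F : ℕ → EE N → ℝ} {G : EE N → ℝ} (hm : ∀ n, Measurable (F n))
    (ht : ∀ᵐ x ∂μ, Tendsto (fun n => F n x) atTop (𝓝 (G x))) {c : ℕ → ℝ} {c0 : ℝ}
    (hc : Tendsto c atTop (𝓝 c0))
    (h : ∀ n, ∫⁻ x, ENNReal.ofReal (F n x ^ 2) ∂μ ≤ ENNReal.ofReal (c n)) :
    ∫⁻ x, ENNReal.ofReal (G x ^ 2) ∂μ ≤ ENNReal.ofReal c0 := by
  have e1 : ∫⁻ x, ENNReal.ofReal (G x ^ 2) ∂μ =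
      ∫⁻ x, liminf (fun n => ENNReal.ofReal (F n x ^ 2)) atTop ∂μ := by
    apply lintegral_congr_ae
    filter_upwards [ht] with x hx
    exact ((ENNReal.continuous_ofReal.tendsto _).comp (hx.pow 2)).liminf_eq.symm
  rw [e1]
  refine (lintegral_liminf_le fun n => ((hm n).pow_const 2).ennreal_ofReal).trans ?_
  rw [← ((ENNReal.continuous_ofReal.tendsto _).comp hc).liminf_eq]
  exact liminf_le_liminf (Eventually.of_forall h)

noncomputable def ww (v : EE N → ℝ) (e x : EE N) : ℝ := ⟪gradient v x, e⟫_ℝ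

lemma ww_meas : Measurable (ww v e) := (grad_meas v).inner measurable_const

lemma ww_BM {K : NNReal} (hv : LipschitzWith K v) : BM (ww v e) := (BM.grad hv).inner (BM.const e)

lemma dq_lim {K : NNReal} (hv : LipschitzWith K v) {h : ℕ → ℝ} (hh : ∀ n, 0 < h n)
    (h0 : Tendsto h atTop (𝓝 0)) : ∀ᵐ x, Tendsto (fun n => dq v (h n) e x) atTop (𝓝 (ww v e x)) := by
  filter_upwards [grad_ae hv] with x hx
  have h1 := (hx.hasFDerivAt.hasLineDerivAt e).tendsto_slope_zero
  have h2 : Tendsto h atTop (𝓝[≠] 0) :=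
    tendsto_nhdsWithin_iff.2 ⟨h0, Eventually.of_forall fun n => (hh n).ne'⟩
  have h3 := h1.comp h2
  simpa [dq, ww, Function.comp_def] using h3

lemma aw_BM (hp2 : p < 2) (hε : 0 < ε) : BM fun x => aw p ε ‖gradient v x‖ := by
  refine ⟨?_, aw p ε 0, fun x => ?_⟩
  · unfold aw
    have := grad_meas v
    fun_prop
  · rw [Real.norm_of_nonneg (aw_pos hε _).le]
    exact aw_zero_le hp2 hε (norm_nonneg _)

lemma rhs_lim (hp2 : p < 2) (hε : 0 < ε) (he : ‖e‖ = 1) {K : NNReal} (hv : LipschitzWith K v)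
    (h1 : Continuous Q1) (h2 : Continuous Q2) {h : ℕ → ℝ} (hh : ∀ n, 0 < h n)
    (h0 : Tendsto h atTop (𝓝 0)) :
    Tendsto (fun n => ∫ x in ball (0:EE N) R, (aw p ε ‖gradient v x‖ * Q1 (dq v (h n) e x) + Q2 (dq v (h n) e x)))
      atTop (𝓝 (∫ x in ball (0:EE N) R, (aw p ε ‖gradient v x‖ * Q1 (ww v e x) + Q2 (ww v e x)))) := by
  obtain ⟨C1, hC1⟩ := (isCompact_Icc (a := -(K:ℝ)) (b := K)).exists_bound_of_continuousOn h1.continuousOn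
  obtain ⟨C2, hC2⟩ := (isCompact_Icc (a := -(K:ℝ)) (b := K)).exists_bound_of_continuousOn h2.continuousOn
  have hfin : IsFiniteMeasure (volume.restrict (ball (0:EE N) R)) := isFiniteMeasure_restrict.2 measure_ball_lt_top.ne
  apply tendsto_integral_of_dominated_convergence (fun _ => aw p ε 0 * C1 + C2)
  · intro n
    have b := (dq_BL hv he (hh n)).BM
    exact (((aw_BM hp2 hε).mul (b.comp h1)).add (b.comp h2)).1.aestronglyMeasurable
  · exact integrable_const _
  · intro n
    refine Eventually.of_forall fun x => ?_
    have hd := abs_le.1 (dq_le hv he (hh n) x)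
    refine (norm_add_le _ _).trans (add_le_add ?_ (hC2 _ hd))
    rw [norm_mul, Real.norm_of_nonneg (aw_pos hε _).le]
    exact mul_le_mul (aw_zero_le hp2 hε (norm_nonneg _)) (hC1 _ hd) (norm_nonneg _) (aw_pos hε _).le
  · filter_upwards [ae_restrict_of_ae (dq_lim (e := e) hv hh h0)] with x hx
    exact (((h1.tendsto _).comp hx).const_mul _).add ((h2.tendsto _).comp hx)

lemma seq_h (hR1 : R < 1) : ∃ h : ℕ → ℝ, (∀ n, 0 < h n) ∧ (∀ n, R + h n < 1) ∧ Tendsto h atTop (𝓝 0) := by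
  refine ⟨fun n => (1 - R) * (1 / (n + 1 : ℝ)) / 2, fun n => ?_, fun n => ?_, ?_⟩
  · have : 0 < 1 - R := by linarith
    positivity
  · have h1 : (1:ℝ) / (n + 1) ≤ 1 := by
      rw [div_le_one (by positivity)]; linarith [(Nat.cast_nonneg n : (0:ℝ) ≤ n)]
    nlinarith
  · have := ((tendsto_one_div_add_atTop_nhds_zero_nat (𝕜 := ℝ)).const_mul (1 - R)).div_const 2
    simpa using this

/-- global finite-difference bound -/
lemma lim_glob (hN : 1 ≤ N) (hp2 : p < 2) (hε : 0 < ε) (he : ‖e‖ = 1) {K : NNReal} (hv : LipschitzWith K v)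
    (hR : 0 < R) (hR1 : R < 1) (hφ : Continuous φ) (hΦ : ∀ t, HasDerivAt Φ (φ t) t)
    (h1 : Continuous Q1) (h2 : Continuous Q2)
    (H : ∀ h, 0 < h → R + h < 1 → ∫ x, eta R x ^ 2 * φ (dq v h e x) ^ 2 * ‖Yh v h e x‖ ^ 2 ≤
      ∫ x in ball (0:EE N) R, (aw p ε ‖gradient v x‖ * Q1 (dq v h e x) + Q2 (dq v h e x))) (y : EE N) :
    ∫⁻ x, ENNReal.ofReal ((eta R (x + y) * Φ (ww v e (x + y)) - eta R x * Φ (ww v e x)) ^ 2) ≤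
      ENNReal.ofReal ((2 * ∫ x in ball (0:EE N) R, (aw p ε ‖gradient v x‖ * Q1 (ww v e x) +
        (Q2 (ww v e x) + 4 * Φ (ww v e x) ^ 2))) * ‖y‖ ^ 2) := by
  obtain ⟨h, hh, hRh, h0⟩ := seq_h hR1
  have Φc : Continuous Φ := continuous_iff_continuousAt.2 fun t => (hΦ t).continuousAt
  have bBL := fun n => (eta_BL hR.le).mul ((dq_BL (e := e) hv he (hh n)).comp hΦ hφ)
  have lim := ((rhs_lim (R := R) (Q2 := fun t => Q2 t + 4 * Φ t ^ 2) hp2 hε he hv h1 (by fun_prop) hh h0).const_mul 2).mul_const (‖y‖ ^ 2)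
  refine fat (F := fun n x => eta R (x + y) * Φ (dq v (h n) e (x + y)) - eta R x * Φ (dq v (h n) e x)) ?_ ?_ lim ?_
  · intro n
    exact (((bBL n).shift y).sub (bBL n)).cont.measurable
  · filter_upwards [dq_lim (e := e) hv hh h0, ae_shift (dq_lim (e := e) hv hh h0) y] with x a b
    exact (((Φc.tendsto _).comp b).const_mul _).sub (((Φc.tendsto _).comp a).const_mul _)
  · intro n
    obtain ⟨L, hL⟩ := (bBL n).lip
    have fd := fd_glob (R := R) hL (fun x hx => by
      rw [mem_closedBall_zero_iff, not_le] at hx; simp [eta_out hx.le]) 2 two_ne_zero y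
    simp only [Real.norm_eq_abs, sq_abs] at fd
    refine fd.trans ?_
    have dBM := (dq_BL (e := e) hv he (hh n)).BM
    have i5 := en_int (h := h n) hR hv he (hh n) hφ
    have j0 : BM fun x => aw p ε ‖gradient v x‖ * Q1 (dq v (h n) e x) + Q2 (dq v (h n) e x) :=
      ((aw_BM hp2 hε).mul (dBM.comp h1)).add (dBM.comp h2)
    have j1 : IntegrableOn (fun x => 8 * Φ (dq v (h n) e x) ^ 2) (ball (0:EE N) R) :=
      ((BM.const 8).mul (dBM.comp Φc).sq).on measure_ball_lt_top.ne
    have j1' := (integrable_indicator_iff measurableSet_ball).2 j1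
    set I := fun x => 2 * (eta R x ^ 2 * φ (dq v (h n) e x) ^ 2 * ‖Yh v (h n) e x‖ ^ 2) +
      (ball (0:EE N) R).indicator (fun x => 8 * Φ (dq v (h n) e x) ^ 2) x
    have hI : Integrable I := (i5.const_mul 2).add j1'
    have hI0 : ∀ x, 0 ≤ I x := fun x => add_nonneg (by positivity)
      (indicator_nonneg (fun _ _ => by positivity) _)
    have key : ∀ᵐ x, ENNReal.ofReal ((fderiv ℝ (fun x => eta R x * Φ (dq v (h n) e x)) x y) ^ 2) ≤
        ENNReal.ofReal (I x * ‖y‖ ^ 2) := by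
      filter_upwards [eta_grad hN hR, dq_grad (h := h n) (e := e) hv] with x a b
      apply ENNReal.ofReal_le_ofReal
      have d := (hg_mul a.1 (hg_comp (hΦ _) b)).hasFDerivAt
      rw [d.fderiv, InnerProductSpace.toDual_apply_apply]
      refine (sq_le_sq' (by linarith [neg_abs_le ⟪eta R x • φ (dq v (h n) e x) • Yh v (h n) e x + Φ (dq v (h n) e x) • geta R x, y⟫_ℝ, abs_real_inner_le_norm (eta R x • φ (dq v (h n) e x) • Yh v (h n) e x + Φ (dq v (h n) e x) • geta R x) y]) (real_inner_le_norm _ _)).trans ?_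
      rw [mul_pow]
      apply mul_le_mul_of_nonneg_right _ (by positivity)
      refine (pow_le_pow_left₀ (norm_nonneg _) (norm_add_le _ _) 2).trans ?_
      refine (add_sq_le).trans ?_
      rw [mul_add]
      refine add_le_add ?_ ?_
      · rw [norm_smul, norm_smul, mul_pow, mul_pow, Real.norm_eq_abs, Real.norm_eq_abs, sq_abs, sq_abs, mul_assoc]
      · by_cases hx : ‖x‖ < R
        · rw [indicator_of_mem (by rwa [mem_ball_zero_iff]), norm_smul, mul_pow, Real.norm_eq_abs, sq_abs]
          have := geta_le hR.le hR1.le x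
          have : ‖geta R x‖ ^ 2 ≤ 4 := by nlinarith [norm_nonneg (geta R x)]
          nlinarith [sq_nonneg (Φ (dq v (h n) e x))]
        · rw [indicator_of_notMem (by rwa [mem_ball_zero_iff])]
          simp [geta, hx]
    refine (lintegral_mono_ae key).trans ?_
    rw [← ofReal_integral_eq_lintegral_ofReal (hI.mul_const _) (Eventually.of_forall fun x => by have := hI0 x; positivity)]
    apply ENNReal.ofReal_le_ofReal
    rw [integral_mul_const]
    apply mul_le_mul_of_nonneg_right _ (by positivity)
    rw [integral_add (i5.const_mul 2) j1', integral_const_mul, integral_indicator measurableSet_ball]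
    have := H (h n) (hh n) (hRh n)
    have e3 : ∫ x in ball (0:EE N) R, (aw p ε ‖gradient v x‖ * Q1 (dq v (h n) e x) + (Q2 (dq v (h n) e x) + 4 * Φ (dq v (h n) e x) ^ 2))
      = (∫ x in ball (0:EE N) R, (aw p ε ‖gradient v x‖ * Q1 (dq v (h n) e x) + Q2 (dq v (h n) e x)))
        + ∫ x in ball (0:EE N) R, 4 * Φ (dq v (h n) e x) ^ 2 := by
      rw [← integral_add (j0.on measure_ball_lt_top.ne) (((BM.const 4).mul (dBM.comp Φc).sq).on measure_ball_lt_top.ne)]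
      congr 1; ext x; ring
    rw [e3]
    simp only [integral_const_mul]
    linarith

/-- local finite-difference bound -/
lemma lim_loc (hp2 : p < 2) (hε : 0 < ε) (he : ‖e‖ = 1) {K : NNReal} (hv : LipschitzWith K v)
    (hφ : Continuous φ) (hΦ : ∀ t, HasDerivAt Φ (φ t) t)
    (h1 : Continuous Q1) (h2 : Continuous Q2)
    (H : ∀ h, 0 < h → 3 / 4 + h < 1 → ∫ x, eta (3/4) x ^ 2 * φ (dq v h e x) ^ 2 * ‖Yh v h e x‖ ^ 2 ≤
      ∫ x in ball (0:EE N) (3/4), (aw p ε ‖gradient v x‖ * Q1 (dq v h e x) + Q2 (dq v h e x))) (y : EE N) :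
    ∫⁻ x in ov (ball 0 (1/2)) y, ENNReal.ofReal ((Φ (ww v e (x + y)) - Φ (ww v e x)) ^ 2) ≤
      ENNReal.ofReal ((16 * ∫ x in ball (0:EE N) (3/4), (aw p ε ‖gradient v x‖ * Q1 (ww v e x) +
        Q2 (ww v e x))) * ‖y‖ ^ 2) := by
  obtain ⟨h, hh, hRh, h0⟩ := seq_h (R := 3/4) (by norm_num)
  have Φc : Continuous Φ := continuous_iff_continuousAt.2 fun t => (hΦ t).continuousAt
  have bBL := fun n => (dq_BL (e := e) hv he (hh n)).comp hΦ hφ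
  have lim := ((rhs_lim (R := 3/4) hp2 hε he hv h1 h2 hh h0).const_mul 16).mul_const (‖y‖ ^ 2)
  refine fat (F := fun n x => Φ (dq v (h n) e (x + y)) - Φ (dq v (h n) e x)) ?_ ?_ lim ?_
  · intro n
    exact (((bBL n).shift y).sub (bBL n)).cont.measurable
  · apply ae_restrict_of_ae
    filter_upwards [dq_lim (e := e) hv hh h0, ae_shift (dq_lim (e := e) hv hh h0) y] with x a b
    exact ((Φc.tendsto _).comp b).sub ((Φc.tendsto _).comp a)
  · intro n
    obtain ⟨L, hL⟩ := (bBL n).lip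
    have fd := fd_lint (convex_ball (0:EE N) (1/2)) measurableSet_ball measure_ball_lt_top.ne hL 2 y
    simp only [Real.norm_eq_abs, sq_abs] at fd
    refine fd.trans ?_
    have i5 := en_int (h := h n) (R := 3/4) (by norm_num) hv he (hh n) hφ
    have key : ∀ᵐ x ∂(volume.restrict (ball (0:EE N) (1/2))),
        ENNReal.ofReal ((fderiv ℝ (fun x => Φ (dq v (h n) e x)) x y) ^ 2) ≤
        ENNReal.ofReal (16 * (eta (3/4) x ^ 2 * φ (dq v (h n) e x) ^ 2 * ‖Yh v (h n) e x‖ ^ 2) * ‖y‖ ^ 2) := by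
      filter_upwards [ae_restrict_of_ae (dq_grad (h := h n) (e := e) hv), ae_restrict_mem measurableSet_ball] with x b hx
      apply ENNReal.ofReal_le_ofReal
      have d := (hg_comp (hΦ _) b).hasFDerivAt
      rw [d.fderiv, InnerProductSpace.toDual_apply_apply, real_inner_smul_left, mul_pow]
      have e1 := eta_ge_mid (R := 3/4) (r := 1/2) (by norm_num) (by norm_num) (mem_ball_zero_iff.1 hx)
      have e2 : 1 ≤ 16 * eta (3/4) x ^ 2 := by norm_num at e1; nlinarith
      have e3 : ⟪Yh v (h n) e x, y⟫_ℝ ^ 2 ≤ ‖Yh v (h n) e x‖ ^ 2 * ‖y‖ ^ 2 := by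
        rw [← mul_pow, ← sq_abs]
        exact pow_le_pow_left₀ (abs_nonneg _) (abs_real_inner_le_norm _ _) 2
      calc _ ≤ φ (dq v (h n) e x) ^ 2 * (‖Yh v (h n) e x‖ ^ 2 * ‖y‖ ^ 2) := by gcongr
        _ ≤ (16 * eta (3/4) x ^ 2) * (φ (dq v (h n) e x) ^ 2 * (‖Yh v (h n) e x‖ ^ 2 * ‖y‖ ^ 2)) :=
          le_mul_of_one_le_left (by positivity) e2
        _ = _ := by ring
    refine (lintegral_mono_ae key).trans ((setLIntegral_le_lintegral _ _).trans ?_)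
    rw [← ofReal_integral_eq_lintegral_ofReal ((i5.const_mul _).mul_const _) (Eventually.of_forall fun x => by positivity)]
    apply ENNReal.ofReal_le_ofReal
    rw [integral_mul_const, integral_const_mul]
    have := H (h n) (hh n) (hRh n)
    gcongr

end Lim
end AP

namespace AP
open Filter Topology

lemma iter {A b s : ℝ} (hA : 0 < A) (hb : 1 < b) (hs : 0 < s) : ∃ ν : ℝ, 0 < ν ∧ ∀ Y : ℕ → ℝ,
    (∀ n, 0 ≤ Y n) → (∀ n, Y (n + 1) ≤ A * b ^ n * Y n ^ (1 + s)) → Y 0 ≤ ν →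
    Tendsto Y atTop (𝓝 0) := by
  have hb0 : 0 < b := by linarith
  set q := b ^ (-1 / s) with hq
  have q0 : 0 < q := Real.rpow_pos_of_pos hb0 _
  have q1 : q < 1 := Real.rpow_lt_one_of_one_lt_of_neg hb (div_neg_of_neg_of_pos (by norm_num) hs)
  have qs : q ^ s = b⁻¹ := by
    rw [hq, ← Real.rpow_mul hb0.le, div_mul_cancel₀ _ hs.ne', Real.rpow_neg_one]
  set ν := (q / A) ^ (1 / s)
  have ν0 : 0 < ν := by positivity
  have νs : ν ^ s = q / A := by
    rw [← Real.rpow_mul (by positivity), one_div_mul_cancel hs.ne', Real.rpow_one]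
  refine ⟨ν, ν0, fun Y h0 h1 h2 => ?_⟩
  have key : ∀ n, Y n ≤ ν * q ^ n := by
    intro n
    induction n with
    | zero => simpa using h2
    | succ n ih =>
      refine (h1 n).trans ?_
      have e1 : (ν * q ^ n) ^ (1 + s) = (ν * q ^ n) * ((q / A) * b⁻¹ ^ n) := by
        rw [Real.rpow_add (by positivity), Real.rpow_one, Real.mul_rpow ν0.le (by positivity), νs,
          ← Real.rpow_natCast, ← Real.rpow_mul q0.le, mul_comm (n:ℝ) s, Real.rpow_mul q0.le, qs, Real.rpow_natCast, Real.rpow_natCast]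
      calc _ ≤ A * b ^ n * (ν * q ^ n) ^ (1 + s) := by
            exact mul_le_mul_of_nonneg_left (Real.rpow_le_rpow (h0 n) ih (by linarith)) (by positivity)
        _ = ν * q ^ (n + 1) := by rw [e1, inv_pow, pow_succ]; field_simp
  refine squeeze_zero h0 key ?_
  simpa using (tendsto_pow_atTop_nhds_zero_of_lt_one q0.le q1).const_mul ν

lemma dg1 {N : ℕ} (hN : 1 ≤ N) {C0 : ℝ} (hC0 : 0 < C0) : ∃ ν : ℝ, 0 < ν ∧ ∀ z : EE N → ℝ, Measurable z →
    (∀ κ R : ℝ, 0 ≤ κ → κ < 1 → 1 / 4 < R → R ≤ 1 / 2 → ∀ y : EE N,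
      ∫⁻ x, ENNReal.ofReal ((eta R (x + y) * (max (z (x + y) - κ) 0) ^ 2 - eta R x * (max (z x - κ) 0) ^ 2) ^ 2)
      ≤ ENNReal.ofReal (C0 * volume.real {x | x ∈ ball (0:EE N) R ∧ κ < z x} * ‖y‖ ^ 2)) →
    volume.real {x | x ∈ ball (0:EE N) (1/2) ∧ 0 < z x} ≤ ν →
    volume {x | x ∈ ball (0:EE N) (1/4) ∧ 1 < z x} = 0 := by
  obtain ⟨Cf, hCf, fab⟩ := faber hN
  have hN' : (0:ℝ) < N := by exact_mod_cast hN
  obtain ⟨ν, hν, it⟩ := iter (A := 2 ^ 12 * (Cf * C0)) (b := 64) (s := 2 / (N:ℝ)) (by positivity) (by norm_num) (by positivity)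
  refine ⟨ν, hν, fun z hz H h0 => ?_⟩
  set κ : ℕ → ℝ := fun n => 1 - (1/2) ^ n
  set R : ℕ → ℝ := fun n => 1/4 + (1/2) ^ n / 4
  set S : ℕ → Set (EE N) := fun n => {x | x ∈ ball (0:EE N) (R n) ∧ κ n < z x}
  have hd : ∀ n, (0:ℝ) < (1/2) ^ n ∧ ((1/2:ℝ)) ^ n ≤ 1 := fun n => ⟨by positivity, pow_le_one₀ (by norm_num) (by norm_num)⟩
  have mS : ∀ n, MeasurableSet (S n) := fun n => measurableSet_ball.inter (measurableSet_lt measurable_const hz)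
  have fS : ∀ n, volume (S n) ≠ ⊤ := fun n => measure_ne_top_of_subset (fun x hx => hx.1) measure_ball_lt_top.ne
  have T := it (fun n => volume.real (S n)) (fun n => measureReal_nonneg) ?_ ?_
  · have h1 : ∀ n, volume.real {x | x ∈ ball (0:EE N) (1/4) ∧ 1 < z x} ≤ volume.real (S n) := by
      intro n
      apply measureReal_mono _ (fS n)
      rintro x ⟨a, b⟩
      obtain ⟨d1, d2⟩ := hd n
      exact ⟨ball_subset_ball (by simp only [R]; linarith) a, by simp only [κ]; linarith⟩
    have h2 := ge_of_tendsto' T h1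
    have h3 := measureReal_nonneg.antisymm' h2
    rwa [measureReal_eq_zero_iff (measure_ne_top_of_subset (fun x hx => hx.1) measure_ball_lt_top.ne)] at h3
  · intro n
    obtain ⟨d1, d2⟩ := hd n
    set d := ((1/2:ℝ)) ^ n
    have hs : ((1/2:ℝ)) ^ (n + 1) = d / 2 := by rw [pow_succ]; ring
    set F : EE N → ℝ := fun x => eta (R n) x * (max (z x - κ n) 0) ^ 2
    have ec := (eta_BL (N := N) (R := R n) (by simp only [R]; linarith)).cont.measurable
    have mF : Measurable F := by fun_prop
    have f1 := fab F (C0 * volume.real (S n)) mF (by positivity)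
      (H (κ n) (R n) (by simp only [κ]; linarith) (by simp only [κ]; linarith) (by simp only [R]; linarith) (by simp only [R]; linarith))
      (S n) (mS n) (fS n) (by
        intro x hx
        simp only [S, mem_setOf_eq, not_and_or, not_lt, mem_ball_zero_iff] at hx
        rcases hx with h | h
        · simp [F, eta_out h]
        · simp [F, max_eq_right (sub_nonpos.2 h)])
    have f2 : ENNReal.ofReal ((d ^ 3 / 64) ^ 2) * volume (S (n + 1)) ≤ ∫⁻ x, ENNReal.ofReal (F x ^ 2) := by
      rw [← setLIntegral_const]
      refine le_trans ?_ (setLIntegral_le_lintegral (S (n + 1)) _)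
      apply setLIntegral_mono' (mS _)
      rintro x ⟨a, b⟩
      apply ENNReal.ofReal_le_ofReal
      simp only [R, κ, hs] at a b
      have e1 := eta_ge_mid (R := R n) (r := 1/4 + d/2/4) (by linarith) (by simp only [R]; linarith) (mem_ball_zero_iff.1 a)
      have e2 : d / 16 ≤ eta (R n) x := by refine le_trans ?_ e1; simp only [R]; nlinarith
      have e3 : d / 2 ≤ max (z x - κ n) 0 := le_max_of_le_left (by simp only [κ]; linarith)
      have e4 : (d / 2) ^ 2 ≤ (max (z x - κ n) 0) ^ 2 := by gcongr
      have : d ^ 3 / 64 ≤ F x := by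
        calc d ^ 3 / 64 = (d / 16) * (d / 2) ^ 2 := by ring
          _ ≤ _ := by simp only [F]; gcongr; linarith
      gcongr
    have f3 := f2.trans f1
    rw [← ENNReal.ofReal_toReal (fS (n + 1)), ← ENNReal.ofReal_mul (by positivity),
      ENNReal.ofReal_le_ofReal_iff (by positivity)] at f3
    change (d ^ 3 / 64) ^ 2 * volume.real (S (n + 1)) ≤ _ at f3
    rw [← le_div_iff₀' (by positivity)] at f3
    refine f3.trans (le_of_eq ?_)
    have e6 : (64:ℝ) ^ n = (d ^ 6)⁻¹ := by
      simp only [d, ← pow_mul, one_div, inv_pow, inv_inv]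
      rw [mul_comm, pow_mul]; norm_num
    rcases (measureReal_nonneg : 0 ≤ volume.real (S n)).eq_or_lt with h | h
    · rw [← h, Real.zero_rpow (by positivity), Real.zero_rpow (by positivity)]; simp
    · rw [Real.rpow_add h, Real.rpow_one, e6]
      field_simp
      norm_num
  · refine le_trans (le_of_eq ?_) h0
    simp only [S, R, κ]; norm_num

end AP

namespace AP
open Filter Topology

lemma mx_pow (n : ℕ) (t : ℝ) : HasDerivAt (fun t : ℝ => (max t 0) ^ (n + 2)) ((n + 2) * (max t 0) ^ (n + 1)) t := by
  rcases lt_trichotomy t 0 with h | h | h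
  · rw [max_eq_right h.le, zero_pow (by omega), mul_zero]
    apply (hasDerivAt_const t (0:ℝ)).congr_of_eventuallyEq
    filter_upwards [Iio_mem_nhds h] with s hs
    rw [max_eq_right (le_of_lt hs), zero_pow (by omega)]
  · subst h
    rw [← hasDerivWithinAt_univ, ← Iic_union_Ici (a := (0:ℝ))]
    have h2 : HasDerivAt (fun s : ℝ => s ^ (n + 2)) ((n + 2) * (max (0:ℝ) 0) ^ (n + 1)) 0 := by
      simpa using hasDerivAt_pow (n + 2) (0:ℝ)
    apply HasDerivWithinAt.union
    · simp only [max_self, ne_eq, Nat.add_eq_zero_iff, one_ne_zero, and_false, not_false_eq_true, zero_pow, mul_zero]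
      exact (hasDerivWithinAt_const _ _ (0:ℝ)).congr (fun s hs => by rw [max_eq_right hs, zero_pow (by omega)]) (by simp)
    · exact h2.hasDerivWithinAt.congr (fun s hs => by rw [max_eq_left hs]) (by simp)
  · rw [max_eq_left h.le]
    have h2 := hasDerivAt_pow (n + 2) t
    simp only [Nat.cast_add, Nat.cast_ofNat] at h2
    apply h2.congr_of_eventuallyEq
    filter_upwards [Ioi_mem_nhds h] with s hs
    rw [max_eq_left (le_of_lt hs)]

lemma mono_help {G G' D D' : ℝ → ℝ} {a b : ℝ} (hab : a ≤ b) (hG : ∀ t ∈ Icc a b, HasDerivAt G (G' t) t)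
    (hD : ∀ t ∈ Icc a b, HasDerivAt D (D' t) t) (h : ∀ t ∈ Icc a b, G' t ≤ D' t) : G b - G a ≤ D b - D a := by
  have d : ∀ t ∈ Icc a b, HasDerivAt (fun t => D t - G t) (D' t - G' t) t := fun t ht => (hD t ht).sub (hG t ht)
  have m : MonotoneOn (fun t => D t - G t) (Icc a b) := by
    apply monotoneOn_of_deriv_nonneg (convex_Icc a b)
    · exact fun t ht => (d t ht).continuousAt.continuousWithinAt
    · exact fun t ht => (d t (interior_subset ht)).differentiableAt.differentiableWithinAt
    · intro t ht
      rw [(d t (interior_subset ht)).deriv]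
      linarith [h t (interior_subset ht)]
  have := m (left_mem_Icc.2 hab) (right_mem_Icc.2 hab) hab
  simp only at this
  linarith

lemma aw_le4 {p ε s : ℝ} (hp1 : 1 < p) (hp2 : p < 2) (hε : 0 < ε) (hs : 1 / 4 ≤ s) : aw p ε s ≤ 4 := by
  unfold aw
  calc _ ≤ (1/16 : ℝ) ^ ((p - 2) / 2) :=
        Real.rpow_le_rpow_of_nonpos (by norm_num) (by nlinarith) (by linarith)
    _ ≤ (1/16 : ℝ) ^ (-1/2 : ℝ) := Real.rpow_le_rpow_of_exponent_ge (by norm_num) (by norm_num) (by linarith)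
    _ = 4 := by
      rw [show (1/16 : ℝ) = 4 ^ (-2:ℝ) by rw [Real.rpow_neg (by norm_num)]; norm_num,
        ← Real.rpow_mul (by norm_num)]; norm_num

section TS
variable {N : ℕ} {p ε Λ : ℝ} {f v : EE N → ℝ} {e : EE N} {R k0 c κ C0 : ℝ} {Q1 Q2 : ℝ → ℝ}

noncomputable def mz (k0 c κ t : ℝ) : ℝ := max ((t - k0) / c - κ) 0

lemma mz_cont : Continuous (mz k0 c κ) := by unfold mz; fun_prop

lemma mz_nn (t : ℝ) : 0 ≤ mz k0 c κ t := le_max_right _ _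

lemma mz_pow (n : ℕ) (t : ℝ) : HasDerivAt (fun t => mz k0 c κ t ^ (n + 2)) ((n + 2) * mz k0 c κ t ^ (n + 1) * (1 / c)) t :=
  HasDerivAt.comp (h₂ := fun t => max t 0 ^ (n + 2)) t (mx_pow n ((t - k0) / c - κ)) ((((hasDerivAt_id t).sub_const k0).div_const c).sub_const κ)

lemma mz_sq (t : ℝ) : HasDerivAt (fun t => mz k0 c κ t ^ 2) (2 * mz k0 c κ t / c) t := by
  refine HasDerivAt.congr_deriv (mz_pow 0 t) ?_
  push_cast; ring

lemma mz_cube (t : ℝ) : HasDerivAt (fun t => 4 / 3 * mz k0 c κ t ^ 3 / c) ((2 * mz k0 c κ t / c) ^ 2) t := by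
  refine HasDerivAt.congr_deriv (((mz_pow 1 t).const_mul (4/3)).div_const c) ?_
  push_cast; ring

lemma dgw (hN : 1 ≤ N) (hp2 : p < 2) (hε : 0 < ε) (he : ‖e‖ = 1) {K : NNReal} (hv : LipschitzWith K v)
    (hR : 0 < R) (hR1 : R ≤ 1 / 2) (h1 : Continuous Q1) (h2 : Continuous Q2)
    (H : ∀ h, 0 < h → R + h < 1 → ∫ x, eta R x ^ 2 * (2 * mz k0 c κ (dq v h e x) / c) ^ 2 * ‖Yh v h e x‖ ^ 2 ≤
      ∫ x in ball (0:EE N) R, (aw p ε ‖gradient v x‖ * Q1 (dq v h e x) + Q2 (dq v h e x)))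
    (hb : ∀ᵐ x, x ∈ ball (0:EE N) (1/2) → (aw p ε ‖gradient v x‖ * Q1 (ww v e x) +
        (Q2 (ww v e x) + 4 * (mz k0 c κ (ww v e x) ^ 2) ^ 2)) ≤ if κ < (ww v e x - k0) / c then C0 / 2 else 0) (y : EE N) :
    ∫⁻ x, ENNReal.ofReal ((eta R (x + y) * (max ((ww v e (x + y) - k0) / c - κ) 0) ^ 2
      - eta R x * (max ((ww v e x - k0) / c - κ) 0) ^ 2) ^ 2)
      ≤ ENNReal.ofReal (C0 * volume.real {x | x ∈ ball (0:EE N) R ∧ κ < (ww v e x - k0) / c} * ‖y‖ ^ 2) := by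
  have mc := mz_cont (k0 := k0) (c := c) (κ := κ)
  have l := lim_glob hN hp2 hε he hv hR (by linarith) (by fun_prop) mz_sq h1 h2 H y
  refine l.trans (ENNReal.ofReal_le_ofReal ?_)
  apply mul_le_mul_of_nonneg_right _ (by positivity)
  have wm := ww_meas (v := v) (e := e)
  have mS : MeasurableSet {x : EE N | κ < (ww v e x - k0) / c} := measurableSet_lt measurable_const (by fun_prop)
  have b : BM fun x => (aw p ε ‖gradient v x‖ * Q1 (ww v e x) + (Q2 (ww v e x) + 4 * (mz k0 c κ (ww v e x) ^ 2) ^ 2)) :=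
    ((aw_BM hp2 hε).mul ((ww_BM hv).comp h1)).add (((ww_BM hv).comp h2).add ((BM.const 4).mul ((ww_BM hv).comp mc).sq.sq))
  have fin : IsFiniteMeasure (volume.restrict (ball (0:EE N) R)) := isFiniteMeasure_restrict.2 measure_ball_lt_top.ne
  have : ∫ x in ball (0:EE N) R, (aw p ε ‖gradient v x‖ * Q1 (ww v e x) + (Q2 (ww v e x) + 4 * (mz k0 c κ (ww v e x) ^ 2) ^ 2))
      ≤ ∫ x in ball (0:EE N) R, {x : EE N | κ < (ww v e x - k0) / c}.indicator (fun _ => C0 / 2) x := by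
    apply integral_mono_ae (b.on measure_ball_lt_top.ne) ((integrable_const _).indicator mS)
    filter_upwards [ae_restrict_of_ae hb, ae_restrict_mem measurableSet_ball] with x hx hx2
    have := hx (ball_subset_ball hR1 hx2)
    rw [indicator_apply]
    exact this
  rw [integral_indicator_const _ mS, measureReal_restrict_apply mS] at this
  have e1 : {x : EE N | κ < (ww v e x - k0) / c} ∩ ball 0 R = {x | x ∈ ball (0:EE N) R ∧ κ < (ww v e x - k0) / c} := by
    ext x; simp [and_comm]
  rw [e1, smul_eq_mul] at this
  linarith

lemma ww_neg (v : EE N → ℝ) (e x : EE N) : ww v (-e) x = - ww v e x := inner_neg_right _ _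

lemma ww_abs (S : Sol p ε f Λ v) (he : ‖e‖ = 1) : ∀ᵐ x, x ∈ ball (0:EE N) 1 → |ww v e x| ≤ 1 := by
  filter_upwards [S.grad1] with x hx h
  refine (abs_real_inner_le_norm _ _).trans ?_
  rw [he, mul_one]; exact hx h

theorem lemT (hN : 1 ≤ N) (hp1 : 1 < p) (hp2 : p < 2) : ∃ ν : ℝ, 0 < ν ∧ ∀ (ε Λ : ℝ) (f v : EE N → ℝ) (e : EE N),
    0 < ε → ε ≤ 1 → Sol p ε f Λ v → Λ ≤ 1 → ‖e‖ = 1 →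
    volume.real {x | x ∈ ball (0:EE N) (1/2) ∧ ww v e x < 1/2} ≤ ν →
    ∀ᵐ x, x ∈ ball (0:EE N) (1/4) → 1/4 ≤ ww v e x := by
  have hp0 : 0 < p - 1 := by linarith
  set C0 := 2 * (256 / (p - 1) ^ 2 * 2304 + 4 / (p - 1) * 25 * 1152 + 4 * 1296) with hC0
  obtain ⟨ν, hν, H⟩ := dg1 (N := N) hN (C0 := C0) (by positivity)
  refine ⟨ν, hν, fun ε Λ f v e hε hε1 S hΛ he hm => ?_⟩
  obtain ⟨K, hv⟩ := S.lip
  have he' : ‖-e‖ = 1 := by rwa [norm_neg]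
  have wm := ww_meas (v := v) (e := -e)
  have h0 := H (fun x => (ww v (-e) x - (-1/2)) / (1/4)) (by fun_prop) ?_ ?_
  · have : ∀ᵐ x : EE N, x ∉ {x | x ∈ ball (0:EE N) (1/4) ∧ 1 < (ww v (-e) x - (-1/2)) / (1/4)} :=
      measure_eq_zero_iff_ae_notMem.1 h0
    filter_upwards [this] with x hx h
    by_contra h3
    refine hx ⟨h, ?_⟩
    rw [ww_neg, lt_div_iff₀ (by norm_num)]
    linarith
  · intro κ R hκ hκ1 hR4 hR2 y
    have mc := mz_cont (k0 := -1/2) (c := 1/4) (κ := κ)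
    have mn := mz_nn (k0 := -1/2) (c := 1/4) (κ := κ)
    refine dgw (Q1 := fun _ => 0) (Q2 := fun t => 256 / (p - 1) ^ 2 * (2 * mz (-1/2) (1/4) κ t / (1/4)) ^ 2 +
      4 / (p - 1) * (Λ + 24) * (4 / 3 * mz (-1/2) (1/4) κ t ^ 3 / (1/4))) hN hp2 hε he' hv (by linarith) hR2 (by fun_prop) (by fun_prop) ?_ ?_ y
    · intro h hh hRh
      simp only [mul_zero, zero_add]
      exact cacT hN hp1 hp2 hε hε1 S he' hh (by linarith) hRh (by fun_prop) (mz_cube (k0 := -1/2) (c := 1/4) (κ := κ)) (fun t => by have := mn t; positivity)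
    · filter_upwards [ww_abs S he'] with x hx hxb
      have hw := hx (ball_subset_ball (by norm_num) hxb)
      set t := ww v (-e) x
      split_ifs with hκt
      · have b1 : mz (-1/2) (1/4) κ t ≤ 6 := by
          unfold mz
          refine max_le ?_ (by norm_num)
          have := (abs_le.1 hw).2
          rw [sub_le_iff_le_add, div_le_iff₀ (by norm_num)]; linarith
        have b0 := mn t
        set m := mz (-1/2) (1/4) κ t
        have b2 : m ^ 2 ≤ 36 := by nlinarith only [b0, b1]
        have b3 : m ^ 3 ≤ 216 := by nlinarith only [b0, b1, b2]
        have b4 : (m ^ 2) ^ 2 ≤ 1296 := by nlinarith only [b2, sq_nonneg m]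
        have c1 : 256 / (p - 1) ^ 2 * (2 * m / (1/4)) ^ 2 ≤ 256 / (p - 1) ^ 2 * 2304 := by gcongr; linarith only [b2]
        have c2 : 4 / (p - 1) * (Λ + 24) * (4 / 3 * m ^ 3 / (1/4)) ≤ 4 / (p - 1) * 25 * 1152 := by
          gcongr <;> linarith
        rw [hC0]; linarith
      · have : mz (-1/2) (1/4) κ t = 0 := max_eq_right (by linarith)
        rw [this]; norm_num
  · refine le_trans (le_of_eq ?_) hm
    congr 1; ext x
    simp only [mem_setOf_eq, and_congr_right_iff]
    intro _
    rw [ww_neg]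
    constructor <;> intro h
    · by_contra h2
      exact absurd h (not_lt.2 (div_nonpos_of_nonpos_of_nonneg (by linarith) (by norm_num)))
    · exact div_pos (by linarith) (by norm_num)

theorem lemS2 (hN : 1 ≤ N) (hp1 : 1 < p) (hp2 : p < 2) : ∃ ν : ℝ, 0 < ν ∧ ∀ (ε Λ : ℝ) (f v : EE N → ℝ) (e : EE N) (k0 c : ℝ),
    0 < ε → ε ≤ 1 → Sol p ε f Λ v → 0 < c → Λ ≤ c → ‖e‖ = 1 →
    (∀ᵐ x, x ∈ ball (0:EE N) (1/2) → ww v e x ≤ k0 + 2 * c) →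
    (∀ᵐ x, x ∈ ball (0:EE N) (1/2) → k0 < ww v e x → 1/4 ≤ ‖gradient v x‖) →
    volume.real {x | x ∈ ball (0:EE N) (1/2) ∧ k0 < ww v e x} ≤ ν →
    ∀ᵐ x, x ∈ ball (0:EE N) (1/4) → ww v e x ≤ k0 + c := by
  have hp0 : 0 < p - 1 := by linarith
  set C0 := 2 * (4 * (128 / (p - 1) ^ 2 * 8) + 4 / (p - 1) * 11 + 64) with hC0
  obtain ⟨ν, hν, H⟩ := dg1 (N := N) hN (C0 := C0) (by positivity)
  refine ⟨ν, hν, fun ε Λ f v e k0 c hε hε1 S hc hΛ he hw1 hw2 hm => ?_⟩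
  obtain ⟨K, hv⟩ := S.lip
  have wm := ww_meas (v := v) (e := e)
  have h0 := H (fun x => (ww v e x - k0) / c) (by fun_prop) ?_ ?_
  · have : ∀ᵐ x : EE N, x ∉ {x | x ∈ ball (0:EE N) (1/4) ∧ 1 < (ww v e x - k0) / c} :=
      measure_eq_zero_iff_ae_notMem.1 h0
    filter_upwards [this] with x hx h
    by_contra h3
    refine hx ⟨h, ?_⟩
    rw [lt_div_iff₀ hc]
    linarith
  · intro κ R hκ hκ1 hR4 hR2 y
    have mc := mz_cont (k0 := k0) (c := c) (κ := κ)
    have mn := mz_nn (k0 := k0) (c := c) (κ := κ)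
    refine dgw (Q1 := fun t => 128 / (p - 1) ^ 2 * (2 / 3 * mz k0 c κ t ^ 2) ^ 2) (Q2 := fun t =>
      4 / (p - 1) * (Λ * (4 / 3 * mz k0 c κ t ^ 3 / c))) hN hp2 hε he hv (by linarith) hR2 (by fun_prop) (by fun_prop) ?_ ?_ y
    · intro h hh hRh
      have := cacS (Q := fun t => 2 / 3 * mz k0 c κ t ^ 2) hN hp1 hp2 hε hε1 S he hh (by linarith : 0 < R) hRh (by fun_prop) (by fun_prop) (fun t => by have := mn t; positivity) mz_cube (fun t => by have := mn t; positivity)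
        (fun t => le_of_eq (by ring))
      refine this.trans (le_of_eq ?_)
      congr 1; ext x; ring
    · filter_upwards [hw1, hw2] with x hx1 hx2 hxb
      have hw := hx1 hxb
      have hw' := hx2 hxb
      set t := ww v e x
      split_ifs with hκt
      · have b1 : mz k0 c κ t ≤ 2 := by
          unfold mz
          refine max_le ?_ (by norm_num)
          rw [sub_le_iff_le_add, div_le_iff₀ hc]; nlinarith
        have b5 : aw p ε ‖gradient v x‖ ≤ 4 := by
          apply aw_le4 hp1 hp2 hε (hw' _)
          rw [lt_div_iff₀ hc] at hκt
          nlinarith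
        have b6 := (aw_pos (p := p) hε ‖gradient v x‖).le
        have b0 := mn t
        set m := mz k0 c κ t
        have b2 : m ^ 2 ≤ 4 := by nlinarith only [b0, b1]
        have b3 : m ^ 3 ≤ 8 := by nlinarith only [b0, b1, b2]
        have b4 : (m ^ 2) ^ 2 ≤ 16 := by nlinarith only [b2, sq_nonneg m]
        have c1 : aw p ε ‖gradient v x‖ * (128 / (p - 1) ^ 2 * (2 / 3 * m ^ 2) ^ 2) ≤ 4 * (128 / (p - 1) ^ 2 * 8) := by
          gcongr; linarith only [b4]
        have c2 : Λ * (4 / 3 * m ^ 3 / c) ≤ 11 := by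
          calc _ ≤ c * (4 / 3 * m ^ 3 / c) := by gcongr
            _ = 4 / 3 * m ^ 3 := by field_simp
            _ ≤ 11 := by linarith
        have c3 : 4 / (p - 1) * (Λ * (4 / 3 * m ^ 3 / c)) ≤ 4 / (p - 1) * 11 := by gcongr
        rw [hC0]; linarith
      · have : mz k0 c κ t = 0 := max_eq_right (by linarith)
        rw [this]; norm_num
  · refine le_trans (le_of_eq ?_) hm
    congr 1; ext x
    simp only [mem_setOf_eq, and_congr_right_iff]
    intro _
    rw [lt_div_iff₀ hc, zero_mul, sub_pos]

end TS
end AP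

namespace AP
open Filter Topology

noncomputable def fh (σ t : ℝ) : ℝ := min (max t 0) 1 / (max (1 - t) 0 + σ)
noncomputable def Fh (σ t : ℝ) : ℝ := ∫ s in (0:ℝ)..t, fh σ s
noncomputable def Gh (σ t : ℝ) : ℝ := ∫ s in (0:ℝ)..t, fh σ s ^ 2
noncomputable def Qh (σ t : ℝ) : ℝ := max t 0 + max (t - 1) 0 / σ

section hat
variable {σ t : ℝ}

lemma fh_cont (hσ : 0 < σ) : Continuous (fh σ) := by
  unfold fh
  apply Continuous.div (by fun_prop) (by fun_prop)
  intro x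
  have : 0 ≤ max (1 - x) 0 := le_max_right _ _
  positivity

lemma fh_nn (hσ : 0 < σ) (t : ℝ) : 0 ≤ fh σ t := by
  unfold fh
  have : 0 ≤ max (1 - t) 0 := le_max_right _ _
  have : 0 ≤ max t 0 := le_max_right _ _
  positivity

lemma fh_neg (ht : t ≤ 0) : fh σ t = 0 := by simp [fh, max_eq_right ht]

lemma fh_mid (h0 : 0 ≤ t) (h1 : t ≤ 1) : fh σ t = t / (1 - t + σ) := by
  unfold fh; rw [max_eq_left h0, min_eq_left h1, max_eq_left (by linarith)]

lemma fh_big (h1 : 1 ≤ t) : fh σ t = 1 / σ := by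
  unfold fh; rw [max_eq_left (by linarith), min_eq_right h1, max_eq_right (by linarith), zero_add]

lemma Fh_der (hσ : 0 < σ) (t : ℝ) : HasDerivAt (Fh σ) (fh σ t) t :=
  intervalIntegral.integral_hasDerivAt_right ((fh_cont hσ).intervalIntegrable _ _)
    ((fh_cont hσ).stronglyMeasurableAtFilter _ _) (fh_cont hσ).continuousAt

lemma Gh_der (hσ : 0 < σ) (t : ℝ) : HasDerivAt (Gh σ) (fh σ t ^ 2) t :=
  intervalIntegral.integral_hasDerivAt_right (((fh_cont hσ).pow 2).intervalIntegrable _ _)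
    (((fh_cont hσ).pow 2).stronglyMeasurableAtFilter _ _) ((fh_cont hσ).pow 2).continuousAt

lemma Fh0 : Fh σ 0 = 0 := by simp [Fh]
lemma Gh0 : Gh σ 0 = 0 := by simp [Gh]

lemma Fh_neg (hσ : 0 < σ) (ht : t ≤ 0) : Fh σ t = 0 := by
  have h1 := mono_help ht (fun s _ => Fh_der hσ s) (fun s _ => hasDerivAt_const s (0:ℝ)) (fun s hs => (fh_neg hs.2).le)
  have h2 := mono_help ht (fun s _ => hasDerivAt_const s (0:ℝ)) (fun s _ => Fh_der hσ s) (fun s hs => (fh_nn hσ s))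
  rw [Fh0] at *; linarith

lemma Gh_neg (hσ : 0 < σ) (ht : t ≤ 0) : Gh σ t = 0 := by
  have h1 := mono_help ht (fun s _ => Gh_der hσ s) (fun s _ => hasDerivAt_const s (0:ℝ)) (fun s hs => by rw [fh_neg hs.2]; simp)
  have h2 := mono_help ht (fun s _ => hasDerivAt_const s (0:ℝ)) (fun s _ => Gh_der hσ s) (fun s hs => sq_nonneg _)
  rw [Gh0] at *; linarith

lemma Gh_nn (hσ : 0 < σ) (t : ℝ) : 0 ≤ Gh σ t := by
  rcases le_total t 0 with h | h
  · rw [Gh_neg hσ h]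
  · have h2 := mono_help h (fun s _ => hasDerivAt_const s (0:ℝ)) (fun s _ => Gh_der hσ s) (fun s hs => sq_nonneg _)
    rw [Gh0] at h2; linarith

lemma Fh_mono (hσ : 0 < σ) : Monotone (Fh σ) := fun a b h => by
  have h2 := mono_help h (fun s _ => hasDerivAt_const s (0:ℝ)) (fun s _ => Fh_der hσ s) (fun s hs => fh_nn hσ s)
  linarith

lemma Gh_le_mid (hσ : 0 < σ) (h0 : 0 ≤ t) (h1 : t ≤ 1) : Gh σ t ≤ fh σ t * t := by
  have hd : ∀ s ∈ Icc 0 t, HasDerivAt (fun s => s ^ 2 / (1 - s + σ)) ((2 * s * (1 - s + σ) + s ^ 2) / (1 - s + σ) ^ 2) s := by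
    intro s hs
    have h3 : HasDerivAt (fun s => 1 - s + σ) (-1) s := ((hasDerivAt_id s).const_sub 1).add_const σ
    refine ((hasDerivAt_pow 2 s).div h3 (by linarith [hs.2])).congr_deriv ?_
    push_cast; ring
  have := mono_help h0 (fun s _ => Gh_der hσ s) hd (fun s hs => by
    have : 0 < 1 - s + σ := by linarith [hs.2]
    rw [fh_mid hs.1 (hs.2.trans h1), div_pow]
    gcongr
    have := hs.1
    have : 0 ≤ 2 * s * (1 - s + σ) := by positivity
    linarith)
  rw [Gh0] at this
  rw [fh_mid h0 h1]
  refine le_trans (by linarith) (le_trans this (le_of_eq ?_))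
  ring

lemma Gh_le (hσ : 0 < σ) (t : ℝ) : Gh σ t ≤ fh σ t * Qh σ t := by
  unfold Qh
  rcases le_total t 0 with h | h
  · rw [Gh_neg hσ h, fh_neg h, zero_mul]
  rcases le_total t 1 with h1 | h1
  · rw [max_eq_left h, max_eq_right (by linarith : t - 1 ≤ 0), zero_div, add_zero]
    exact Gh_le_mid hσ h h1
  · rw [max_eq_left h, max_eq_left (by linarith : 0 ≤ t - 1), fh_big h1]
    have h2 := Gh_le_mid hσ zero_le_one le_rfl
    rw [fh_big le_rfl] at h2
    have h3 := mono_help h1 (fun s _ => Gh_der hσ s) (fun s _ => (hasDerivAt_id s).const_mul ((1/σ)^2)) (fun s hs => by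
      rw [fh_big hs.1]; simp)
    simp only [id] at h3
    have e1 : (1/σ)^2 * t - (1/σ)^2 * 1 = 1 / σ * ((t - 1) / σ) := by field_simp
    have : 0 ≤ 1 / σ * (t - 1) := mul_nonneg (by positivity) (by linarith)
    linarith

lemma Fh_ge (hσ : 0 < σ) (hσ4 : σ ≤ 1 / 4) : 1 / 2 * Real.log (1 / (4 * σ)) ≤ Fh σ (1 - σ) := by
  have hd : ∀ s ∈ Icc (1/2) (1 - σ), HasDerivAt (fun s => -(1/2) * Real.log (1 - s + σ)) (1/2 / (1 - s + σ)) s := by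
    intro s hs
    have h3 : HasDerivAt (fun s => 1 - s + σ) (-1) s := ((hasDerivAt_id s).const_sub 1).add_const σ
    refine ((h3.log (by linarith [hs.2])).const_mul (-(1/2))).congr_deriv ?_
    ring
  have := mono_help (by linarith : (1:ℝ)/2 ≤ 1 - σ) hd (fun s _ => Fh_der hσ s) (fun s hs => by
    have : 0 < 1 - s + σ := by linarith [hs.2]
    rw [fh_mid (by linarith [hs.1]) (by linarith [hs.2])]
    gcongr; exact hs.1)
  have h2 : 0 ≤ Fh σ (1/2) := by rw [← Fh0 (σ := σ)]; exact Fh_mono hσ (by norm_num)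
  have e1 : Real.log (1 / (4 * σ)) = Real.log (1/2) - Real.log (1 - (1 - σ) + σ) := by
    rw [← Real.log_div (by norm_num) (by linarith)]
    congr 1; rw [show 1 - (1 - σ) + σ = 2 * σ by ring]; field_simp; norm_num
  have e2 : Real.log (1/2) ≤ Real.log (1 - 1/2 + σ) := Real.log_le_log (by norm_num) (by linarith)
  rw [e1]; linarith
end hat

variable {N : ℕ} {p : ℝ}

theorem lemS1 (hN : 1 ≤ N) (hp1 : 1 < p) (hp2 : p < 2) {ν ν1 : ℝ} (hν : 0 < ν) (hν1 : 0 < ν1) :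
    ∃ σ : ℝ, 0 < σ ∧ σ ≤ 1/4 ∧ ∀ (ε Λ : ℝ) (f v : EE N → ℝ) (e : EE N) (k s : ℝ),
    0 < ε → ε ≤ 1 → Sol p ε f Λ v → 0 < s → Λ ≤ σ * s / 2 → ‖e‖ = 1 →
    (∀ᵐ x, x ∈ ball (0:EE N) 1 → ww v e x ≤ k + s) →
    (∀ᵐ x, x ∈ ball (0:EE N) 1 → k < ww v e x → 1/4 ≤ ‖gradient v x‖) →
    ν ≤ volume.real {x | x ∈ ball (0:EE N) (1/2) ∧ ww v e x ≤ k} →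
    volume.real {x | x ∈ ball (0:EE N) (1/2) ∧ k + (1 - σ) * s < ww v e x} ≤ ν1 := by
  have hp0 : 0 < p - 1 := by linarith
  set ω := volume.real (ball (0:EE N) 1)
  have hω : 0 ≤ ω := measureReal_nonneg
  set C1 := 4 * (128 / (p - 1) ^ 2) + 4 / (p - 1) with hC1
  have C1p : 0 < C1 := by positivity
  set A := 16 * (C1 * ω) * ω / (ν * ν1) with hA
  have A0 : 0 ≤ A := by positivity
  refine ⟨1 / 4 * Real.exp (-2 * (A + 1)), by positivity, ?_, ?_⟩
  · have : Real.exp (-2 * (A + 1)) ≤ 1 := Real.exp_le_one_iff.2 (by linarith)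
    linarith
  have hσ4 : 1 / 4 * Real.exp (-2 * (A + 1)) ≤ 1/4 := by
    have : Real.exp (-2 * (A + 1)) ≤ 1 := Real.exp_le_one_iff.2 (by linarith)
    linarith
  have hσ : 0 < 1 / 4 * Real.exp (-2 * (A + 1)) := by positivity
  have hL : A + 1 ≤ Fh (1 / 4 * Real.exp (-2 * (A + 1))) (1 - 1 / 4 * Real.exp (-2 * (A + 1))) := by
    refine le_trans (le_of_eq ?_) (Fh_ge hσ hσ4)
    rw [show 1 / (4 * (1 / 4 * Real.exp (-2 * (A + 1)))) = Real.exp (2 * (A + 1)) by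
      rw [← mul_assoc, show (4:ℝ) * (1/4) = 1 by norm_num, one_mul, one_div, ← Real.exp_neg]; ring_nf, Real.log_exp]
    ring
  set σ := 1 / 4 * Real.exp (-2 * (A + 1))
  intro ε Λ f v e k s hε hε1 S hs hΛ he hw1 hw2 hm
  obtain ⟨K, hv⟩ := S.lip
  have wm := ww_meas (v := v) (e := e)
  have fc := fh_cont hσ
  have Gc : Continuous (Gh σ) := continuous_iff_continuousAt.2 fun t => (Gh_der hσ t).continuousAt
  have Fc : Continuous (Fh σ) := continuous_iff_continuousAt.2 fun t => (Fh_der hσ t).continuousAt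
  have Qc : Continuous (Qh σ) := by unfold Qh; fun_prop
  have lin : ∀ t, HasDerivAt (fun t => (t - k) / s) (1 / s) t := fun t => ((hasDerivAt_id t).sub_const k).div_const s
  have Fd : ∀ t, HasDerivAt (fun t => Fh σ ((t - k) / s)) (fh σ ((t - k) / s) / s) t := fun t =>
    (HasDerivAt.comp (h₂ := Fh σ) t (Fh_der hσ _) (lin t)).congr_deriv (by ring)
  have Gd : ∀ t, HasDerivAt (fun t => Gh σ ((t - k) / s) / s) ((fh σ ((t - k) / s) / s) ^ 2) t := fun t =>
    ((HasDerivAt.comp (h₂ := Gh σ) t (Gh_der hσ _) (lin t)).div_const s).congr_deriv (by ring)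
  have L := lim_loc (v := v) (e := e) (Φ := fun t => Fh σ ((t - k) / s)) (φ := fun t => fh σ ((t - k) / s) / s)
    (Q1 := fun t => 128 / (p - 1) ^ 2 * Qh σ ((t - k) / s) ^ 2) (Q2 := fun t => 4 / (p - 1) * (Λ * (Gh σ ((t - k) / s) / s)))
    hp2 hε he hv (by fun_prop) Fd (by fun_prop) (by fun_prop) (by
      intro h hh hRh
      have := cacS (Q := fun t => Qh σ ((t - k) / s)) hN hp1 hp2 hε hε1 S he hh (by norm_num : (0:ℝ) < 3/4) hRh (by fun_prop) (by fun_prop)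
        (fun t => div_nonneg (fh_nn hσ _) hs.le) Gd (fun t => div_nonneg (Gh_nn hσ _) hs.le)
        (fun t => by
          rw [div_mul_eq_mul_div]
          gcongr
          exact Gh_le hσ _)
      refine this.trans (le_of_eq ?_)
      congr 1; ext x; ring)
  have bd : ∫ x in ball (0:EE N) (3/4), (aw p ε ‖gradient v x‖ * (128 / (p - 1) ^ 2 * Qh σ ((ww v e x - k) / s) ^ 2) +
        4 / (p - 1) * (Λ * (Gh σ ((ww v e x - k) / s) / s))) ≤ C1 * ω := by
    have fin : IsFiniteMeasure (volume.restrict (ball (0:EE N) (3/4))) := isFiniteMeasure_restrict.2 measure_ball_lt_top.ne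
    have wB := ww_BM (e := e) hv
    have b : BM fun x => (aw p ε ‖gradient v x‖ * (128 / (p - 1) ^ 2 * Qh σ ((ww v e x - k) / s) ^ 2) +
        4 / (p - 1) * (Λ * (Gh σ ((ww v e x - k) / s) / s))) :=
      ((aw_BM hp2 hε).mul (wB.comp (h := fun t => 128 / (p - 1) ^ 2 * Qh σ ((t - k) / s) ^ 2) (by fun_prop))).add
        (wB.comp (h := fun t => 4 / (p - 1) * (Λ * (Gh σ ((t - k) / s) / s))) (by fun_prop))
    have : ∫ x in ball (0:EE N) (3/4), (aw p ε ‖gradient v x‖ * (128 / (p - 1) ^ 2 * Qh σ ((ww v e x - k) / s) ^ 2) +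
        4 / (p - 1) * (Λ * (Gh σ ((ww v e x - k) / s) / s))) ≤ ∫ x in ball (0:EE N) (3/4), C1 := by
      apply integral_mono_ae (b.on measure_ball_lt_top.ne) (integrable_const _)
      filter_upwards [ae_restrict_of_ae hw1, ae_restrict_of_ae hw2, ae_restrict_mem measurableSet_ball] with x h1 h2 hx
      have hx1 : x ∈ ball (0:EE N) 1 := ball_subset_ball (by norm_num) hx
      have h1 := h1 hx1
      have h2 := h2 hx1
      by_cases hk : ww v e x ≤ k
      · have : (ww v e x - k) / s ≤ 0 := div_nonpos_of_nonpos_of_nonneg (by linarith) hs.le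
        rw [Gh_neg hσ this, Qh, max_eq_right this, max_eq_right (by linarith)]
        simp [C1p.le]
      · rw [not_le] at hk
        have t0 : 0 ≤ (ww v e x - k) / s := div_nonneg (by linarith) hs.le
        have t1 : (ww v e x - k) / s ≤ 1 := by rw [div_le_one hs]; linarith
        have g1 := Gh_le_mid hσ t0 t1
        have g0 := Gh_nn hσ ((ww v e x - k) / s)
        have q1 : Qh σ ((ww v e x - k) / s) = (ww v e x - k) / s := by
          rw [Qh, max_eq_left t0, max_eq_right (by linarith)]; simp
        rw [q1]
        set t := (ww v e x - k) / s
        have g2 : Gh σ t ≤ 1 / σ := by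
          refine g1.trans ?_
          rw [fh_mid t0 t1, div_mul_eq_mul_div]
          have : t * t ≤ 1 := by nlinarith only [t0, t1]
          gcongr; linarith
        have b5 : aw p ε ‖gradient v x‖ ≤ 4 := aw_le4 hp1 hp2 hε (h2 hk)
        have b6 := (aw_pos (p := p) hε ‖gradient v x‖).le
        have c1 : aw p ε ‖gradient v x‖ * (128 / (p - 1) ^ 2 * t ^ 2) ≤ 4 * (128 / (p - 1) ^ 2) := by
          have : t ^ 2 ≤ 1 := by nlinarith only [t0, t1]
          have : 128 / (p - 1) ^ 2 * t ^ 2 ≤ 128 / (p - 1) ^ 2 := mul_le_of_le_one_right (by positivity) this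
          gcongr
        have c2 : Λ * (Gh σ t / s) ≤ 1 := by
          calc _ ≤ (σ * s / 2) * (Gh σ t / s) := by gcongr
            _ = σ * Gh σ t / 2 := by field_simp
            _ ≤ σ * (1 / σ) / 2 := by gcongr
            _ ≤ 1 := by field_simp; norm_num
        have c3 : 4 / (p - 1) * (Λ * (Gh σ t / s)) ≤ 4 / (p - 1) := mul_le_of_le_one_right (by positivity) c2
        rw [hC1]; linarith
    refine this.trans ?_
    rw [setIntegral_const, smul_eq_mul, mul_comm]
    gcongr
    exact measureReal_mono (ball_subset_ball (by norm_num)) measure_ball_lt_top.ne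
  have mZ : MeasurableSet {x | x ∈ ball (0:EE N) (1/2) ∧ ww v e x ≤ k} :=
    measurableSet_ball.inter (measurableSet_le wm measurable_const)
  have mA : MeasurableSet {x | x ∈ ball (0:EE N) (1/2) ∧ k + (1 - σ) * s < ww v e x} :=
    measurableSet_ball.inter (measurableSet_lt measurable_const wm)
  have fA : volume {x | x ∈ ball (0:EE N) (1/2) ∧ k + (1 - σ) * s < ww v e x} ≠ ⊤ :=
    measure_ne_top_of_subset (fun x hx => hx.1) measure_ball_lt_top.ne
  have fZ : volume {x | x ∈ ball (0:EE N) (1/2) ∧ ww v e x ≤ k} ≠ ⊤ :=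
    measure_ne_top_of_subset (fun x hx => hx.1) measure_ball_lt_top.ne
  have P := poinc (F := fun x => Fh σ ((ww v e x - k) / s)) mZ le_rfl (fun x hx => hx.1) (by fun_prop)
    (fun x hx => Fh_neg hσ (div_nonpos_of_nonpos_of_nonneg (by linarith [hx.2]) hs.le))
    (K := 16 * (C1 * ω)) (by positivity) (fun y => (L y).trans (ENNReal.ofReal_le_ofReal (by gcongr)))
  set Z := {x | x ∈ ball (0:EE N) (1/2) ∧ ww v e x ≤ k}
  set B := {x | x ∈ ball (0:EE N) (1/2) ∧ k + (1 - σ) * s < ww v e x}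
  have q1 : ENNReal.ofReal ((A + 1) ^ 2) * volume B ≤ ∫⁻ x in ball 0 (1/2), ENNReal.ofReal (Fh σ ((ww v e x - k) / s) ^ 2) := by
    rw [← setLIntegral_const]
    refine le_trans ?_ (lintegral_mono_set (fun x (hx : x ∈ B) => hx.1))
    apply setLIntegral_mono' mA
    rintro x ⟨a, b⟩
    apply ENNReal.ofReal_le_ofReal
    have : 1 - σ ≤ (ww v e x - k) / s := by rw [le_div_iff₀ hs]; linarith
    have := hL.trans (Fh_mono hσ this)
    gcongr
  have q2 := (mul_le_mul_left q1 (volume Z)).trans P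
  rw [← ENNReal.ofReal_toReal fA, ← ENNReal.ofReal_toReal fZ, ← ENNReal.ofReal_toReal (measure_ball_lt_top (x := (0:EE N)) (r := 1)).ne,
    ← ENNReal.ofReal_mul (by positivity), ← ENNReal.ofReal_mul (by positivity), ← ENNReal.ofReal_mul (by positivity),
    ENNReal.ofReal_le_ofReal_iff (by positivity)] at q2
  change (A + 1) ^ 2 * volume.real B * volume.real Z ≤ ω * _ at q2
  have nB : 0 ≤ volume.real B := measureReal_nonneg
  by_contra hcon
  rw [not_le] at hcon
  have q3 : (A + 1) * (ν * ν1) ≤ ω * (16 * (C1 * ω)) := by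
    refine le_trans ?_ q2
    calc (A + 1) * (ν * ν1) ≤ ((A + 1) * (A + 1)) * (ν * ν1) := by
          gcongr; nlinarith only [A0]
      _ = (A + 1) ^ 2 * ν1 * ν := by ring
      _ ≤ _ := by gcongr
  have q4 : A * (ν * ν1) = 16 * (C1 * ω) * ω := by rw [hA]; field_simp
  have : 0 < ν * ν1 := by positivity
  linarith

theorem lemS (hN : 1 ≤ N) (hp1 : 1 < p) (hp2 : p < 2) {ν : ℝ} (hν : 0 < ν) :
    ∃ σ : ℝ, 0 < σ ∧ σ ≤ 1/4 ∧ ∀ (ε Λ : ℝ) (f v : EE N → ℝ) (e : EE N) (k s : ℝ),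
    0 < ε → ε ≤ 1 → Sol p ε f Λ v → 0 < s → Λ ≤ σ * s / 2 → ‖e‖ = 1 →
    (∀ᵐ x, x ∈ ball (0:EE N) 1 → ww v e x ≤ k + s) →
    (∀ᵐ x, x ∈ ball (0:EE N) 1 → k < ww v e x → 1/4 ≤ ‖gradient v x‖) →
    ν ≤ volume.real {x | x ∈ ball (0:EE N) (1/2) ∧ ww v e x ≤ k} →
    ∀ᵐ x, x ∈ ball (0:EE N) (1/4) → ww v e x ≤ k + (1 - σ / 2) * s := by
  obtain ⟨ν1, hν1, H2⟩ := lemS2 (N := N) hN hp1 hp2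
  obtain ⟨σ, hσ, hσ4, H1⟩ := lemS1 (N := N) hN hp1 hp2 hν hν1
  refine ⟨σ, hσ, hσ4, fun ε Λ f v e k s hε hε1 S hs hΛ he hw1 hw2 hm => ?_⟩
  have h1 := H1 ε Λ f v e k s hε hε1 S hs hΛ he hw1 hw2 hm
  have hb : ∀ x, x ∈ ball (0:EE N) (1/2) → x ∈ ball (0:EE N) 1 := fun x hx => ball_subset_ball (by norm_num) hx
  have h2 := H2 ε Λ f v e (k + (1 - σ) * s) (σ * s / 2) hε hε1 S (by positivity) hΛ he ?_ ?_ h1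
  · filter_upwards [h2] with x hx h
    have := hx h
    linarith
  · filter_upwards [hw1] with x hx h
    have := hx (hb x h); linarith
  · filter_upwards [hw2] with x hx h hk
    have : 0 < (1 - σ) * s := mul_pos (by linarith) hs
    exact hx (hb x h) (by linarith)

end AP

namespace AP
open Filter Topology
variable {N : ℕ} {p ε Λ : ℝ} {f v : EE N → ℝ} {e : EE N}

lemma ae_smul {P : EE N → Prop} (h : ∀ᵐ x, P x) {ρ : ℝ} (hρ : 0 < ρ) : ∀ᵐ x, P (ρ • x) := by
  rw [ae_iff] at *
  have := Measure.addHaar_preimage_smul (volume : Measure (EE N)) hρ.ne' {x | ¬ P x}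
  rw [h, mul_zero] at this
  exact this

lemma grad_scale (v : EE N → ℝ) (ρ c : ℝ) (y : EE N) :
    gradient (fun y => c * v (ρ • y)) y = (c * ρ) • gradient v (ρ • y) := by
  have h : fderiv ℝ (fun y => c * v (ρ • y)) y = c • (ρ • fderiv ℝ v (ρ • y)) := by
    rw [← fderiv_comp_smul]; exact congrFun (fderiv_const_smul_field (𝕜 := ℝ) (f := fun y => v (ρ • y)) c) y
  unfold gradient
  rw [h, smul_smul]; simp

lemma aw_scale {m s : ℝ} (hm : 0 < m) : aw p (ε / m) (s / m) = m ^ (2 - p) * aw p ε s := by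
  unfold aw
  have : (ε / m) ^ 2 + (s / m) ^ 2 = (m ^ 2)⁻¹ * (ε ^ 2 + s ^ 2) := by field_simp
  rw [this, Real.mul_rpow (by positivity) (by positivity), Real.inv_rpow (by positivity), ← Real.rpow_neg (by positivity)]
  congr 1
  rw [← Real.rpow_natCast, ← Real.rpow_mul hm.le]; congr 1; push_cast; ring

lemma Av_scale {m : ℝ} (hm : 0 < m) (ξ : EE N) : Av p (ε / m) (m⁻¹ • ξ) = m ^ (1 - p) • Av p ε ξ := by
  unfold Av
  have : ‖m⁻¹ • ξ‖ = ‖ξ‖ / m := by rw [norm_smul, Real.norm_of_nonneg (by positivity)]; ring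
  rw [this, aw_scale hm, smul_smul, smul_smul]
  congr 1
  rw [show (1 - p) = (2 - p) - 1 by ring, Real.rpow_sub_one hm.ne']; field_simp

lemma rescale {ρ m : ℝ} (hρ : 0 < ρ) (hm : 0 < m) (hlip : ∃ K : NNReal, LipschitzWith K v)
    (hg : ∀ᵐ x, x ∈ ball (0:EE N) ρ → ‖gradient v x‖ ≤ m) (hf : Continuous f)
    (hfl : ∀ x ∈ ball (0 : EE N) ρ, ∀ y ∈ ball (0 : EE N) ρ, |f x - f y| ≤ Λ * ‖x - y‖)
    (el : ∀ (ψ : EE N → ℝ) (K : NNReal) (R : ℝ), LipschitzWith K ψ → R < ρ →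
      (∀ x, x ∉ closedBall (0 : EE N) R → ψ x = 0) →
      ∫ x, ⟪gradient ψ x, Av p ε (gradient v x)⟫_ℝ = ∫ x, f x * ψ x) :
    Sol p (ε / m) (fun y => ρ * m ^ (1 - p) * f (ρ • y)) (ρ ^ 2 * m ^ (1 - p) * Λ) (fun y => (ρ * m)⁻¹ * v (ρ • y)) ∧
    ∀ y, gradient (fun y => (ρ * m)⁻¹ * v (ρ • y)) y = m⁻¹ • gradient v (ρ • y) := by
  have hgr : ∀ y, gradient (fun y => (ρ * m)⁻¹ * v (ρ • y)) y = m⁻¹ • gradient v (ρ • y) := by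
    intro y; rw [grad_scale]; congr 1; field_simp
  have hbm : ∀ x : EE N, x ∈ ball (0:EE N) 1 → ρ • x ∈ ball (0:EE N) ρ := by
    intro x hx
    rw [mem_ball_zero_iff] at *
    rw [norm_smul, Real.norm_of_nonneg hρ.le]; nlinarith
  have hm1 : 0 < m ^ (1 - p) := Real.rpow_pos_of_pos hm _
  refine ⟨⟨?_, ?_, by fun_prop, ?_, ?_⟩, hgr⟩
  · obtain ⟨K, hK⟩ := hlip
    refine ⟨Real.toNNReal ((ρ * m)⁻¹ * (K * ρ)), LipschitzWith.of_dist_le_mul fun x y => ?_⟩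
    rw [Real.coe_toNNReal _ (by positivity), Real.dist_eq, ← mul_sub, abs_mul, abs_of_pos (by positivity), mul_assoc]
    gcongr
    have := hK.dist_le_mul (ρ • x) (ρ • y)
    rw [dist_smul₀, Real.norm_of_nonneg hρ.le, Real.dist_eq] at this
    linarith
  · filter_upwards [ae_smul hg hρ] with x hx hb
    rw [hgr, norm_smul, Real.norm_of_nonneg (by positivity), inv_mul_le_iff₀ hm, mul_one]
    exact hx (hbm x hb)
  · intro x hx y hy
    rw [← mul_sub, abs_mul, abs_of_pos (by positivity)]
    have := hfl _ (hbm x hx) _ (hbm y hy)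
    rw [← smul_sub, norm_smul, Real.norm_of_nonneg hρ.le] at this
    calc _ ≤ ρ * m ^ (1 - p) * (Λ * (ρ * ‖x - y‖)) := by gcongr
      _ = _ := by ring
  · intro ψ K R hψ hR hs
    have h1 := el (fun x => 1 * ψ (ρ⁻¹ • x)) (K * ‖ρ⁻¹‖₊) (ρ * R) (by
        simp only [one_mul]; exact hψ.comp (lipschitzWith_smul ρ⁻¹)) (by nlinarith) (by
      intro x hx
      rw [one_mul]; apply hs
      rw [mem_closedBall_zero_iff, not_le] at *
      rw [norm_smul, Real.norm_of_nonneg (by positivity), lt_inv_mul_iff₀ hρ]; exact hx)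
    simp only [grad_scale] at h1
    simp only [one_mul] at h1
    have c1 := Measure.integral_comp_smul (volume : Measure (EE N)) (fun x => ⟪ρ⁻¹ • gradient ψ (ρ⁻¹ • x), Av p ε (gradient v x)⟫_ℝ) ρ
    have c2 := Measure.integral_comp_smul (volume : Measure (EE N)) (fun x => f x * ψ (ρ⁻¹ • x)) ρ
    rw [h1, ← c2] at c1
    simp only [inv_smul_smul₀ hρ.ne', real_inner_smul_left] at c1
    rw [integral_const_mul] at c1
    simp only [hgr, Av_scale hm, real_inner_smul_right]
    rw [integral_const_mul]
    have e2 : ∫ x, ρ * m ^ (1 - p) * f (ρ • x) * ψ x = ρ * m ^ (1 - p) * ∫ x, f (ρ • x) * ψ x := by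
      rw [← integral_const_mul]; congr 1; ext x; ring
    rw [e2, ← c1]; field_simp

lemma Sol.rescale (S : Sol p ε f Λ v) {ρ m : ℝ} (hρ : 0 < ρ) (hρ1 : ρ ≤ 1) (hm : 0 < m)
    (hg : ∀ᵐ x, x ∈ ball (0:EE N) ρ → ‖gradient v x‖ ≤ m) :
    Sol p (ε / m) (fun y => ρ * m ^ (1 - p) * f (ρ • y)) (ρ ^ 2 * m ^ (1 - p) * Λ) (fun y => (ρ * m)⁻¹ * v (ρ • y)) ∧
    ∀ y, gradient (fun y => (ρ * m)⁻¹ * v (ρ • y)) y = m⁻¹ • gradient v (ρ • y) := by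
  have := ball_subset_ball (x := (0:EE N)) hρ1
  exact AP.rescale hρ hm S.lip hg S.fcont (fun x hx y hy => S.flip x (this hx) y (this hy))
    (fun ψ K R h1 h2 h3 => S.el ψ K R h1 (by linarith) h3)

lemma ball_quarter {n : ℕ} {x : EE N} (hx : x ∈ ball (0:EE N) ((1/4) ^ (n + 1))) : (4:ℝ) • x ∈ ball (0:EE N) ((1/4) ^ n) := by
  rw [mem_ball_zero_iff, pow_succ] at *
  rw [norm_smul, Real.norm_of_nonneg (by norm_num)]; linarith

lemma quarter (x : EE N) : (1/4:ℝ) • (4:ℝ) • x = x := by rw [smul_smul]; norm_num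

lemma mem_quarter {x : EE N} (hx : x ∈ ball (0:EE N) 1) : (1/4:ℝ) • x ∈ ball (0:EE N) (1/4) := by
  rw [mem_ball_zero_iff] at *
  rw [norm_smul, Real.norm_of_nonneg (by norm_num)]; linarith

theorem lemE (hN : 1 ≤ N) (hp1 : 1 < p) (hp2 : p < 2) : ∃ σ : ℝ, 0 < σ ∧ σ ≤ 1/4 ∧ ∀ (n : ℕ) (ε Λ : ℝ)
    (f v : EE N → ℝ) (e : EE N) (b ω : ℝ), 0 < ε → ε ≤ 1 → Sol p ε f Λ v → ‖e‖ = 1 →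
    (∀ᵐ x, x ∈ ball (0:EE N) 1 → 1/4 ≤ ‖gradient v x‖) → 0 < ω → Λ ≤ σ * ω / 4 →
    (∀ᵐ x, x ∈ ball (0:EE N) 1 → b ≤ ww v e x ∧ ww v e x ≤ b + ω) →
    ∃ b', ∀ᵐ x, x ∈ ball (0:EE N) ((1/4) ^ n) → b' ≤ ww v e x ∧ ww v e x ≤ b' + (1 - σ / 4) ^ n * ω := by
  set ν := volume.real (ball (0:EE N) (1/2)) / 2 with hν
  have ν0 : 0 < ν := by
    have : 0 < volume.real (ball (0:EE N) (1/2)) :=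
      ENNReal.toReal_pos (measure_ball_pos _ _ (by norm_num)).ne' measure_ball_lt_top.ne
    positivity
  obtain ⟨σ, hσ, hσ4, H⟩ := lemS (N := N) hN hp1 hp2 ν0
  refine ⟨σ, hσ, hσ4, fun n => ?_⟩
  induction n with
  | zero =>
    intro ε Λ f v e b ω _ _ _ _ _ _ _ h
    exact ⟨b, by simpa using h⟩
  | succ n ih =>
    intro ε Λ f v e b ω hε hε1 S he hg hω hΛ hw
    have step : ∃ b1, ∀ᵐ x, x ∈ ball (0:EE N) (1/4) → b1 ≤ ww v e x ∧ ww v e x ≤ b1 + (1 - σ / 4) * ω := by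
      have hbb : ∀ x, x ∈ ball (0:EE N) (1/4) → x ∈ ball (0:EE N) 1 := fun x hx => ball_subset_ball (by norm_num) hx
      by_cases hc : ν ≤ volume.real {x | x ∈ ball (0:EE N) (1/2) ∧ ww v e x ≤ b + ω / 2}
      · have := H ε Λ f v e (b + ω / 2) (ω / 2) hε hε1 S (by positivity) (by linarith) he
          (by filter_upwards [hw] with x h hx using by linarith [(h hx).2])
          (by filter_upwards [hg] with x h hx _ using h hx) hc
        refine ⟨b, ?_⟩
        filter_upwards [this, hw] with x h1 h2 hx
        exact ⟨(h2 (hbb x hx)).1, by linarith [h1 hx]⟩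
      · have hc2 : ν ≤ volume.real {x | x ∈ ball (0:EE N) (1/2) ∧ ww v (-e) x ≤ -(b + ω / 2)} := by
          rw [not_le] at hc
          have hu : ball (0:EE N) (1/2) ⊆ {x | x ∈ ball (0:EE N) (1/2) ∧ ww v e x ≤ b + ω / 2} ∪
              {x | x ∈ ball (0:EE N) (1/2) ∧ ww v (-e) x ≤ -(b + ω / 2)} := by
            intro x hx
            rcases le_total (ww v e x) (b + ω / 2) with h | h
            · exact Or.inl ⟨hx, h⟩
            · exact Or.inr ⟨hx, by rw [ww_neg]; linarith⟩
          have := (measureReal_mono (μ := volume) hu (measure_union_ne_top (measure_ne_top_of_subset (fun x hx => hx.1) measure_ball_lt_top.ne)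
            (measure_ne_top_of_subset (fun x hx => hx.1) measure_ball_lt_top.ne))).trans (measureReal_union_le _ _)
          linarith
        have := H ε Λ f v (-e) (-(b + ω / 2)) (ω / 2) hε hε1 S (by positivity) (by linarith) (by rwa [norm_neg])
          (by filter_upwards [hw] with x h hx using by rw [ww_neg]; linarith [(h hx).1])
          (by filter_upwards [hg] with x h hx _ using h hx) hc2
        refine ⟨b + σ * ω / 4, ?_⟩
        filter_upwards [this, hw] with x h1 h2 hx
        have h1 := h1 hx
        rw [ww_neg] at h1
        exact ⟨by linarith, by linarith [(h2 (hbb x hx)).2]⟩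
    obtain ⟨b1, hb1⟩ := step
    obtain ⟨S2, hgr⟩ := S.rescale (ρ := 1/4) (m := 1) (by norm_num) (by norm_num) one_pos (by
      filter_upwards [S.grad1] with x h hx using h (ball_subset_ball (by norm_num) hx))
    have hww : ∀ y, ww (fun y => (1 / 4 * 1)⁻¹ * v ((1 / 4 : ℝ) • y)) e y = ww v e ((1/4:ℝ) • y) := by
      intro y; unfold ww; rw [hgr]; simp
    have hq : 15 / 16 ≤ 1 - σ / 4 := by linarith
    have := ih (ε / 1) _ _ _ e b1 ((1 - σ / 4) * ω) (by simpa) (by simpa) S2 he ?_ (by nlinarith) ?_ ?_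
    · obtain ⟨b', hb'⟩ := this
      refine ⟨b', ?_⟩
      filter_upwards [ae_smul hb' (by norm_num : (0:ℝ) < 4)] with x h hx
      have := h (ball_quarter hx)
      rw [hww, quarter] at this
      rwa [pow_succ, mul_assoc]
    · filter_upwards [ae_smul hg (by norm_num : (0:ℝ) < 1/4)] with x h hx
      rw [hgr, norm_smul]
      simpa using h (ball_subset_ball (by norm_num) (mem_quarter hx))
    · rw [Real.one_rpow]
      have : σ * ω / 4 * (15/16) ≤ σ * ((1 - σ / 4) * ω) / 4 := by nlinarith [mul_pos hσ hω]
      nlinarith [mul_pos hσ hω]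
    · filter_upwards [ae_smul hb1 (by norm_num : (0:ℝ) < 1/4)] with x h hx
      rw [hww]
      exact h (mem_quarter hx)

lemma norm_of_coord {N : ℕ} (hN : 1 ≤ N) {x : EE N} {t : ℝ} (ht : 0 ≤ t) (h : ∀ i, |x i| ≤ t) : ‖x‖ ≤ N * t := by
  have h1 : ‖x‖ ^ 2 ≤ N * t ^ 2 := by
    rw [EuclideanSpace.norm_sq_eq]
    refine (Finset.sum_le_card_nsmul _ _ (t ^ 2) fun i _ => ?_).trans (le_of_eq (by simp))
    have := h i
    rw [Real.norm_eq_abs]; gcongr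
  have hN' : (1:ℝ) ≤ N := by exact_mod_cast hN
  apply abs_le_of_sq_le_sq' _ (by positivity) |>.2
  nlinarith [sq_nonneg t]

lemma norm_of_dense {m : ℝ} (hm : 0 ≤ m) {s : Set (sphere (0:EE N) 1)} (hs : Dense s) {G : EE N}
    (h : ∀ e ∈ s, ⟪G, (e : EE N)⟫_ℝ ≤ m) : ‖G‖ ≤ m := by
  have h2 : ∀ e : sphere (0:EE N) 1, ⟪G, (e : EE N)⟫_ℝ ≤ m := by
    intro e
    have hc : IsClosed {e : sphere (0:EE N) 1 | ⟪G, (e : EE N)⟫_ℝ ≤ m} := isClosed_le (by fun_prop) continuous_const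
    have := hc.closure_subset_iff.2 h
    rw [hs.closure_eq] at this
    exact this (mem_univ e)
  rcases eq_or_ne G 0 with h0 | h0
  · simpa [h0]
  · have := h2 ⟨‖G‖⁻¹ • G, by rw [mem_sphere_zero_iff_norm, norm_smul, norm_inv, norm_norm, inv_mul_cancel₀ (norm_ne_zero_iff.2 h0)]⟩
    simp only [real_inner_smul_right, real_inner_self_eq_norm_sq] at this
    have hn := norm_ne_zero_iff.2 h0
    rwa [pow_two, inv_mul_cancel_left₀ hn] at this

theorem lemP (hN : 1 ≤ N) (hp1 : 1 < p) (hp2 : p < 2) : ∃ σ0 θ C : ℝ, 0 < σ0 ∧ 0 < θ ∧ θ < 1 ∧ 0 < C ∧ ∀ (n : ℕ) (ε Λ : ℝ)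
    (f v : EE N → ℝ), 0 < ε → ε ≤ 1 → Sol p ε f Λ v → Λ ≤ σ0 →
    ∃ ξ : EE N, ∀ᵐ x, x ∈ ball (0:EE N) ((1/4) ^ n) → ‖gradient v x - ξ‖ ≤ C * (θ ^ n + ε) := by
  obtain ⟨ν0, hν0, HT⟩ := lemT (N := N) hN hp1 hp2
  obtain ⟨σ, hσ, hσ4, HS⟩ := lemS (N := N) hN hp1 hp2 hν0
  obtain ⟨τ, hτ, hτ4, HE⟩ := lemE (N := N) hN hp1 hp2
  have hN' : (1:ℝ) ≤ N := by exact_mod_cast hN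
  set θ := max (1 - σ / 4) (1 - τ / 4)
  have hθ1 : 1 - σ / 4 ≤ θ := le_max_left _ _
  have hθ2 : 1 - τ / 4 ≤ θ := le_max_right _ _
  have hθ3 : θ < 1 := max_lt (by linarith) (by linarith)
  have hθ0 : 1 / 2 ≤ θ := by linarith
  refine ⟨min (σ / 4) (τ / 2), θ, 4 * N, by positivity, by linarith, hθ3, by positivity, fun n => ?_⟩
  induction n with
  | zero =>
    intro ε Λ f v hε hε1 S hΛ
    refine ⟨0, ?_⟩
    filter_upwards [S.grad1] with x h hx
    rw [pow_zero] at *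
    rw [sub_zero]
    nlinarith [h hx]
  | succ n ih =>
    intro ε Λ f v hε hε1 S hΛ
    have hΛ1 := hΛ.trans (min_le_left _ _)
    have hΛ2 := hΛ.trans (min_le_right _ _)
    by_cases hc : ∀ e : EE N, ‖e‖ = 1 → ν0 ≤ volume.real {x | x ∈ ball (0:EE N) (1/2) ∧ ww v e x ≤ 1/2}
    · set m := 1 - σ / 4
      have hm : 15 / 16 ≤ m := by simp only [m]; linarith
      have hgm : ∀ᵐ x, x ∈ ball (0:EE N) (1/4) → ‖gradient v x‖ ≤ m := by
        obtain ⟨s, sc, sd⟩ := TopologicalSpace.exists_countable_dense (sphere (0:EE N) 1)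
        have : ∀ᵐ x, ∀ e ∈ s, x ∈ ball (0:EE N) (1/4) → ww v (e : EE N) x ≤ m := by
          rw [ae_ball_iff sc]
          intro e _
          have he : ‖(e : EE N)‖ = 1 := by simpa using e.2
          have := HS ε Λ f v e (1/2) (1/2) hε hε1 S (by norm_num) (by linarith) he
            (by filter_upwards [ww_abs S he] with x h hx using by linarith [(abs_le.1 (h hx)).2])
            (by
              filter_upwards with x hx h
              have := (real_inner_le_norm (gradient v x) (e : EE N))
              rw [he, mul_one] at this
              have h' : 1/2 < ⟪gradient v x, (e : EE N)⟫_ℝ := h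
              linarith) (hc e he)
          filter_upwards [this] with x h hx
          have := h hx
          simp only [m]; linarith
        filter_upwards [this] with x h hx
        exact norm_of_dense (by linarith) sd fun e he => h e he hx
      have hsub : ball (0:EE N) ((1/4) ^ (n + 1)) ⊆ ball (0:EE N) (1/4) := by
        apply ball_subset_ball
        rw [pow_succ]
        have : ((1:ℝ)/4) ^ n ≤ 1 := pow_le_one₀ (by norm_num) (by norm_num)
        linarith
      by_cases hεm : m < ε
      · refine ⟨0, ?_⟩
        filter_upwards [hgm] with x h hx
        have := h (hsub hx)
        rw [sub_zero]
        have : 0 ≤ θ ^ (n + 1) := by positivity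
        nlinarith
      · rw [not_lt] at hεm
        obtain ⟨S2, hgr⟩ := S.rescale (ρ := 1/4) (m := m) (by norm_num) (by norm_num) (by linarith) hgm
        have hm0 : 0 < m := by linarith
        have hmp : m ^ (1 - p) ≤ 16 := by
          calc m ^ (1 - p) ≤ m ^ (-1:ℝ) := Real.rpow_le_rpow_of_exponent_ge hm0 (by simp only [m]; linarith) (by linarith)
            _ = m⁻¹ := Real.rpow_neg_one m
            _ ≤ 16 := by rw [inv_le_comm₀ hm0 (by norm_num)]; linarith
        have hmp0 : 0 < m ^ (1 - p) := by positivity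
        obtain ⟨ξ, hξ⟩ := ih (ε / m) _ _ _ (by positivity) (by rwa [div_le_one hm0]) S2 (by
          have : 0 < min (σ / 4) (τ / 2) := by positivity
          calc (1/4 : ℝ) ^ 2 * m ^ (1 - p) * Λ ≤ (1/4 : ℝ) ^ 2 * m ^ (1 - p) * min (σ / 4) (τ / 2) := by gcongr
            _ ≤ (1/4 : ℝ) ^ 2 * 16 * min (σ / 4) (τ / 2) := by gcongr
            _ = _ := by ring)
        refine ⟨m • ξ, ?_⟩
        filter_upwards [ae_smul hξ (by norm_num : (0:ℝ) < 4)] with x h hx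
        have := h (ball_quarter hx)
        rw [hgr, quarter] at this
        have e1 : gradient v x - m • ξ = m • (m⁻¹ • gradient v x - ξ) := by
          rw [smul_sub, smul_inv_smul₀ hm0.ne']
        rw [e1, norm_smul, Real.norm_of_nonneg hm0.le]
        calc _ ≤ m * (4 * N * (θ ^ n + ε / m)) := by gcongr
          _ = 4 * N * (m * θ ^ n + ε) := by field_simp
          _ ≤ _ := by
            have : m * θ ^ n ≤ θ ^ n * θ := by rw [mul_comm]; gcongr
            rw [pow_succ]; gcongr
    · push Not at hc
      obtain ⟨e, he, hlt⟩ := hc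
      have h4 := HT ε Λ f v e hε hε1 S (by linarith) he (le_trans (measureReal_mono (s₁ := {x | x ∈ ball 0 (1/2) ∧ ww v e x < 1/2}) (s₂ := {x | x ∈ ball 0 (1/2) ∧ ww v e x ≤ 1/2}) (fun x hx => ⟨hx.1, hx.2.le⟩)
        (measure_ne_top_of_subset (fun x hx => hx.1) (measure_ball_lt_top (x := (0:EE N)) (r := 1/2)).ne)) hlt.le)
      obtain ⟨S2, hgr⟩ := S.rescale (ρ := 1/4) (m := 1) (by norm_num) (by norm_num) one_pos (by
        filter_upwards [S.grad1] with x h hx using h (ball_subset_ball (by norm_num) hx))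
      have hE := fun i : Fin N => HE n (ε / 1) _ _ _ (EuclideanSpace.single i (1:ℝ)) (-1) 2 (by simpa) (by simpa) S2 (by simp) (by
          filter_upwards [ae_smul h4 (by norm_num : (0:ℝ) < 1/4)] with x h hx
          rw [hgr]
          have h5 : 1/4 ≤ ⟪gradient v ((1/4:ℝ) • x), e⟫_ℝ := h (mem_quarter hx)
          have := (real_inner_le_norm (gradient v ((1/4:ℝ) • x)) e)
          rw [he, mul_one] at this
          simp only [inv_one, one_smul]; linarith) (by norm_num) (by rw [Real.one_rpow]; linarith) (by
          filter_upwards [ww_abs S2 (e := EuclideanSpace.single i (1:ℝ)) (by simp)] with x h hx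
          have := abs_le.1 (h hx)
          exact ⟨this.1, by linarith⟩)
      choose b hb using hE
      refine ⟨WithLp.toLp 2 b, ?_⟩
      filter_upwards [ae_smul (ae_all_iff.2 hb) (by norm_num : (0:ℝ) < 4)] with x h hx
      have hq0 : 0 ≤ 1 - τ / 4 := by linarith
      have : ‖gradient v x - WithLp.toLp 2 b‖ ≤ N * ((1 - τ / 4) ^ n * 2) := by
        apply norm_of_coord hN (by positivity)
        intro i
        have := h i (ball_quarter hx)
        unfold ww at this
        rw [hgr, quarter, EuclideanSpace.inner_single_right] at this
        simp at this
        simp only [PiLp.sub_apply]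
        rw [abs_le]
        have : 0 ≤ (1 - τ / 4) ^ n * 2 := by positivity
        constructor <;> linarith
      refine this.trans ?_
      have h6 : (1 - τ / 4) ^ n ≤ θ ^ n := by gcongr
      have h7 : 0 ≤ θ ^ n := by positivity
      rw [pow_succ]
      calc (N:ℝ) * ((1 - τ / 4) ^ n * 2) ≤ N * (θ ^ n * 2) := by gcongr
        _ ≤ 4 * N * (θ ^ n * θ + ε) := by nlinarith [mul_nonneg h7 (by linarith : 0 ≤ θ - 1/2)]

end AP

namespace AP
open Filter Topology
variable {N : ℕ} {p ε : ℝ} {m q v w : EE N → ℝ} {K K' : NNReal}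

def Cl (K : NNReal) (v : EE N → ℝ) : Prop :=
  LipschitzWith K v ∧ ∀ x, x ∉ closedBall (0 : EE N) 4 → v x = 0

noncomputable def jd (p ε : ℝ) (m q v : EE N → ℝ) (x : EE N) : ℝ :=
  ph p ε (gradient v x) - ph p ε (0 : EE N) + m x / 2 * (v x - q x) ^ 2

noncomputable def JJ (p ε : ℝ) (m q v : EE N → ℝ) : ℝ := ∫ x, jd p ε m q v x

lemma Cl.bd (hN : 1 ≤ N) (h : Cl K v) (x : EE N) : |v x| ≤ 9 * K := by
  by_cases hx : x ∈ closedBall (0 : EE N) 4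
  · set y : EE N := x + (9:ℝ) • EuclideanSpace.single ⟨0, hN⟩ (1:ℝ) with hy
    have n9 : ‖(9:ℝ) • EuclideanSpace.single (⟨0, hN⟩ : Fin N) (1:ℝ)‖ = 9 := by
      rw [norm_smul]; simp
    have h1 : y ∉ closedBall (0 : EE N) 4 := by
      rw [mem_closedBall_zero_iff] at *
      have := norm_sub_norm_le ((9:ℝ) • EuclideanSpace.single (⟨0, hN⟩ : Fin N) (1:ℝ)) (-x)
      rw [n9, norm_neg, sub_neg_eq_add, add_comm _ x] at this
      rw [hy]; linarith
    have h2 := h.1.norm_sub_le x y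
    rw [h.2 y h1, sub_zero, hy, sub_add_cancel_left, norm_neg, n9] at h2
    rw [← Real.norm_eq_abs]; linarith
  · rw [h.2 x hx, abs_zero]; positivity

lemma Cl.BL (hN : 1 ≤ N) (h : Cl K v) : BL v := BL.mk' h.1 (h.bd hN)

lemma Cl.mono (h : Cl K v) (hK : K ≤ K') : Cl K' v := ⟨h.1.weaken hK, h.2⟩

lemma Cl.hsub (hv : Cl K v) (hw : Cl K' w) : Cl (K + K') (fun x => v x - w x) :=
  ⟨hv.1.sub hw.1, fun x hx => by simp only [hv.2 x hx, hw.2 x hx, sub_zero]⟩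

lemma BM.compE {h : EE N → ℝ} (hc : Continuous h) {f : EE N → EE N} (hf : BM f) : BM fun x => h (f x) := by
  obtain ⟨mf, C, hC⟩ := hf
  obtain ⟨D, hD⟩ := (isCompact_closedBall (0:EE N) C).exists_bound_of_continuousOn hc.continuousOn
  exact ⟨hc.measurable.comp mf, D, fun x => hD _ (by simpa using hC x)⟩

lemma jd_off (hq : Cl K' q) (hv : Cl K v) (x : EE N) (hx : x ∉ closedBall (0 : EE N) 4) : jd p ε m q v x = 0 := by
  unfold jd
  rw [grad_zero_off hv.2 hx, hq.2 x hx, hv.2 x hx]; ring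

lemma jd_int (hN : 1 ≤ N) (hε : 0 < ε) (hm : BM m) (hq : Cl K' q) (hv : Cl K v) : Integrable (jd p ε m q v) := by
  refine BM.off (R := 4) ?_ (jd_off hq hv)
  unfold jd
  refine ((BM.compE (ph_cont hε) (BM.grad hv.1)).sub (BM.const _)).add (BM.mul ?_ ((hv.BL hN).sub (hq.BL hN)).BM.sq)
  simpa [div_eq_mul_inv] using hm.mul (BM.const (2:ℝ)⁻¹)

lemma ph_min (hp1 : 1 < p) (hp2 : p < 2) (hε : 0 < ε) (ξ : EE N) : ph p ε (0 : EE N) ≤ ph p ε ξ := by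
  unfold ph
  gcongr
  simp

lemma jd_nonneg (hp1 : 1 < p) (hp2 : p < 2) (hε : 0 < ε) (hm0 : ∀ x, 0 ≤ m x) (x : EE N) : 0 ≤ jd p ε m q v x := by
  unfold jd
  have := ph_min hp1 hp2 hε (gradient v x)
  have := mul_nonneg (div_nonneg (hm0 x) zero_le_two) (sq_nonneg (v x - q x))
  linarith

lemma jd_mid (hp1 : 1 < p) (hp2 : p < 2) (hε : 0 < ε) {m0 : ℝ} (hm0 : ∀ x, m0 ≤ m x)
    (hv : Cl K v) (hw : Cl K w) : ∀ᵐ x, jd p ε m q (fun x => 2⁻¹ * (v x + w x)) x +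
      min ((p - 1) / 8 * aw p ε K) (m0 / 8) * (‖gradient v x - gradient w x‖ ^ 2 + (v x - w x) ^ 2)
      ≤ (jd p ε m q v x + jd p ε m q w x) / 2 := by
  filter_upwards [grad_ae hv.1, grad_ae hw.1] with x h1 h2
  have h3 := (hg_cmul 2⁻¹ (hg_add h1 h2)).gradient
  unfold jd
  rw [h3]
  set a := gradient v x
  set b := gradient w x
  have ha : ‖a‖ ≤ K := grad_le hv.1 x
  have hb : ‖b‖ ≤ K := grad_le hw.1 x
  have hab : ‖(2:ℝ)⁻¹ • (a + b)‖ ≤ K := by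
    rw [norm_smul]; have := norm_add_le a b; norm_num; linarith
  have c1 := ph_conv hp1 hp2 hε ha hab
  have c2 := ph_conv hp1 hp2 hε hb hab
  have e1 : a - (2:ℝ)⁻¹ • (a + b) = (2:ℝ)⁻¹ • (a - b) := by module
  have e2 : b - (2:ℝ)⁻¹ • (a + b) = -((2:ℝ)⁻¹ • (a - b)) := by module
  rw [e1] at c1
  rw [e2, norm_neg, inner_neg_right] at c2
  have e3 : ‖(2:ℝ)⁻¹ • (a - b)‖ ^ 2 = ‖a - b‖ ^ 2 / 4 := by rw [norm_smul]; norm_num; ring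
  rw [e3] at c1 c2
  have g1 := mul_le_mul_of_nonneg_right (min_le_left ((p - 1) / 8 * aw p ε K) (m0 / 8)) (sq_nonneg ‖a - b‖)
  have g2 := mul_le_mul_of_nonneg_right ((min_le_right ((p - 1) / 8 * aw p ε K) (m0 / 8)).trans (div_le_div_of_nonneg_right (hm0 x) (by norm_num))) (sq_nonneg (v x - w x))
  nlinarith

lemma sup_L2 (hN : 1 ≤ N) (K : NNReal) {η : ℝ} (hη : 0 < η) : ∃ δ > 0, ∀ w : EE N → ℝ, LipschitzWith K w →
    Integrable (fun x => w x ^ 2) → ∫ x, w x ^ 2 ≤ δ → ∀ x, |w x| ≤ η := by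
  set r := η / (2 * (K + 1)) with hr
  have hr0 : 0 < r := by positivity
  have hv0 : 0 < volume.real (ball (0:EE N) r) :=
    ENNReal.toReal_pos (measure_ball_pos _ _ hr0).ne' measure_ball_lt_top.ne
  refine ⟨(η / 2) ^ 2 * volume.real (ball (0:EE N) r) / 2, by positivity, fun w hw hi hle x => ?_⟩
  by_contra hc
  push Not at hc
  have hvx : volume.real (ball x r) = volume.real (ball (0:EE N) r) := by
    unfold Measure.real; rw [Measure.addHaar_ball_center]
  have h1 : (η / 2) ^ 2 * volume.real (ball x r) ≤ ∫ y in ball x r, w y ^ 2 := by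
    have : ∫ y in ball x r, (η / 2) ^ 2 ≤ ∫ y in ball x r, w y ^ 2 := by
      apply setIntegral_mono_on (integrableOn_const measure_ball_lt_top.ne) hi.integrableOn measurableSet_ball
      intro y hy
      have h2 := hw.norm_sub_le x y
      rw [mem_ball, dist_comm, dist_eq_norm] at hy
      have h3 : (K:ℝ) * ‖x - y‖ ≤ η / 2 := by
        calc _ ≤ ((K:ℝ) + 1) * r := by gcongr; linarith
          _ = _ := by rw [hr]; field_simp
      have h4 : |w x| - |w y| ≤ |w x - w y| := abs_sub_abs_le_abs_sub _ _
      rw [Real.norm_eq_abs] at h2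
      rw [← sq_abs (w y)]
      apply pow_le_pow_left₀ (by positivity); linarith
    simpa [mul_comm] using this
  have h5 := setIntegral_le_integral (s := ball x r) hi (Eventually.of_forall fun y => sq_nonneg (w y))
  rw [hvx] at h1
  have : 0 < (η / 2) ^ 2 * volume.real (ball (0:EE N) r) := by positivity
  linarith

lemma dq_glob (hw : Cl K w) {e : EE N} {h : ℝ} (hh : 0 < h) :
    ∫⁻ x, ENNReal.ofReal (dq w h e x ^ 2) ≤ ∫⁻ x, ENNReal.ofReal (ww w e x ^ 2) := by
  have h1 := fd_glob hw.1 hw.2 2 two_ne_zero (h • e)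
  have key : ∀ a : ℝ, ENNReal.ofReal ((h⁻¹ * a) ^ 2) = ENNReal.ofReal (h⁻¹ ^ 2) * ENNReal.ofReal (a ^ 2) := by
    intro a; rw [mul_pow, ENNReal.ofReal_mul (by positivity)]
  calc _ = ENNReal.ofReal (h⁻¹ ^ 2) * ∫⁻ x, ENNReal.ofReal (‖w (x + h • e) - w x‖ ^ 2) := by
        rw [← lintegral_const_mul' _ _ ENNReal.ofReal_ne_top]
        congr 1; ext x; unfold dq; rw [key, Real.norm_eq_abs, sq_abs]
    _ ≤ ENNReal.ofReal (h⁻¹ ^ 2) * ∫⁻ x, ENNReal.ofReal (‖fderiv ℝ w x (h • e)‖ ^ 2) := by gcongr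
    _ = _ := by
        rw [← lintegral_const_mul' _ _ ENNReal.ofReal_ne_top]
        congr 1; ext x
        rw [map_smul, smul_eq_mul, Real.norm_eq_abs, sq_abs, ← key, inv_mul_cancel_left₀ hh.ne']
        unfold ww gradient; simp

lemma lsc (w : EE N → ℝ) (wk : ℕ → EE N → ℝ) (hk : ∀ k, Cl K (wk k)) (hw : Cl K w)
    (ht : ∀ x, Tendsto (fun k => wk k x) atTop (𝓝 (w x))) {c : ℝ}
    (hc : ∀ k, ∫⁻ x, ENNReal.ofReal (‖gradient (wk k) x‖ ^ 2) ≤ ENNReal.ofReal c) :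
    ∫⁻ x, ENNReal.ofReal (‖gradient w x‖ ^ 2) ≤ N * ENNReal.ofReal c := by
  have h1 : ∀ i : Fin N, ∫⁻ x, ENNReal.ofReal (ww w (EuclideanSpace.single i (1:ℝ)) x ^ 2) ≤ ENNReal.ofReal c := by
    intro i
    set e : EE N := EuclideanSpace.single i (1:ℝ)
    obtain ⟨h, hh, -, h0⟩ := seq_h (R := 0) one_pos
    apply fat (F := fun n => dq w (h n) e) (c := fun _ => c) _ (dq_lim hw.1 hh h0) tendsto_const_nhds
    · intro n
      apply fat (F := fun k => dq (wk k) (h n) e) (c := fun _ => c) _ _ tendsto_const_nhds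
      · intro k
        refine (dq_glob (hk k) (hh n)).trans (le_trans (lintegral_mono fun x => ?_) (hc k))
        apply ENNReal.ofReal_le_ofReal
        rw [← sq_abs]
        apply pow_le_pow_left₀ (abs_nonneg _)
        exact (abs_real_inner_le_norm _ _).trans (by simp [e])
      · intro k
        have := (hk k).1.continuous
        exact (by unfold dq; fun_prop : Continuous (dq (wk k) (h n) e)).measurable
      · refine Eventually.of_forall fun x => ?_
        unfold dq
        exact ((ht _).sub (ht _)).const_mul _
    · intro n
      have := hw.1.continuous
      exact (by unfold dq; fun_prop : Continuous (dq w (h n) e)).measurable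
  have h2 : ∀ x, ENNReal.ofReal (‖gradient w x‖ ^ 2) = ∑ i : Fin N, ENNReal.ofReal (ww w (EuclideanSpace.single i (1:ℝ)) x ^ 2) := by
    intro x
    rw [← ENNReal.ofReal_sum_of_nonneg (fun i _ => sq_nonneg _), EuclideanSpace.norm_sq_eq]
    congr 1; apply Finset.sum_congr rfl; intro i _
    unfold ww; rw [EuclideanSpace.inner_single_right]; simp only [one_mul, conj_trivial, Real.norm_eq_abs, sq_abs]
  simp_rw [h2]
  rw [lintegral_finset_sum _ (fun i _ => (ww_meas.pow_const 2).ennreal_ofReal)]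
  exact (Finset.sum_le_sum fun i _ => h1 i).trans (by simp)

lemma lint_ofReal {g : EE N → ℝ} (hi : Integrable g) (h0 : ∀ x, 0 ≤ g x) {c : ℝ} :
    ∫⁻ x, ENNReal.ofReal (g x) ≤ ENNReal.ofReal c ↔ ∫ x, g x ≤ max c 0 := by
  rw [← ofReal_integral_eq_lintegral_ofReal hi (Eventually.of_forall h0), ENNReal.ofReal_le_ofReal_iff']
  simp only [le_max_iff]

lemma gr_int (hv : Cl K v) (hw : Cl K' w) : Integrable fun x => ‖gradient v x - gradient w x‖ ^ 2 :=
  (((BM.grad hv.1).sub (BM.grad hw.1)).norm.sq).off (R := 4) fun x hx => by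
    rw [grad_zero_off hv.2 hx, grad_zero_off hw.2 hx]; simp

lemma sq_int (hN : 1 ≤ N) (hv : Cl K v) (hw : Cl K' w) : Integrable fun x => (v x - w x) ^ 2 :=
  (((hv.BL hN).BM.sub (hw.BL hN).BM).sq).off (R := 4) fun x hx => by
    rw [hv.2 x hx, hw.2 x hx]; simp

lemma exist_min (hN : 1 ≤ N) (hp1 : 1 < p) (hp2 : p < 2) (hε : 0 < ε) (hm : BM m) {m0 : ℝ} (hm00 : 0 < m0)
    (hm0 : ∀ x, m0 ≤ m x) (hq : Cl K' q) (K : NNReal) :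
    ∃ v, Cl K v ∧ ∀ w, Cl K w → JJ p ε m q v ≤ JJ p ε m q w := by
  set S : Set ℝ := {t | ∃ v, Cl K v ∧ JJ p ε m q v = t} with hS
  have hmn : ∀ x, 0 ≤ m x := fun x => hm00.le.trans (hm0 x)
  have hbd : BddBelow S := ⟨0, by rintro _ ⟨v, -, rfl⟩; exact integral_nonneg (jd_nonneg hp1 hp2 hε hmn)⟩
  have hne : S.Nonempty := ⟨_, fun _ => 0, ⟨LipschitzWith.const' 0, fun _ _ => rfl⟩, rfl⟩
  have hseq : ∀ j : ℕ, ∃ v, Cl K v ∧ JJ p ε m q v < sInf S + 1 / ((j:ℝ) + 1) := by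
    intro j
    obtain ⟨_, ⟨v, hv, rfl⟩, h⟩ := exists_lt_of_csInf_lt hne (lt_add_of_pos_right (sInf S) (by positivity : 0 < 1 / ((j:ℝ) + 1)))
    exact ⟨v, hv, h⟩
  choose V hV hJ using hseq
  have hinf : ∀ w, Cl K w → sInf S ≤ JJ p ε m q w := fun w hw => csInf_le hbd ⟨w, hw, rfl⟩
  set κ := min ((p - 1) / 8 * aw p ε K) (m0 / 8) with hκ
  have hκ0 : 0 < κ := lt_min (mul_pos (by linarith) (aw_pos hε _)) (by positivity)
  set c : ℕ → ℝ := fun j => κ⁻¹ * (1 / ((j:ℝ) + 1)) with hc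
  have hc0 : ∀ j, 0 ≤ c j := fun j => by positivity
  have hct : Tendsto c atTop (𝓝 0) := by
    have := (tendsto_one_div_add_atTop_nhds_zero_nat (𝕜 := ℝ)).const_mul κ⁻¹
    rwa [mul_zero] at this
  have hD : ∀ j k, j ≤ k → (∫ x, ‖gradient (V j) x - gradient (V k) x‖ ^ 2) + ∫ x, (V j x - V k x) ^ 2 ≤ c j := by
    intro j k hjk
    have hmid : Cl K (fun x => 2⁻¹ * (V j x + V k x)) := by
      refine ⟨LipschitzWith.of_dist_le_mul fun x y => ?_, fun x hx => by simp only [(hV j).2 x hx, (hV k).2 x hx]; simp⟩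
      have h1 := (hV j).1.dist_le_mul x y
      have h2 := (hV k).1.dist_le_mul x y
      rw [Real.dist_eq] at *
      have : 2⁻¹ * (V j x + V k x) - 2⁻¹ * (V j y + V k y) = 2⁻¹ * ((V j x - V j y) + (V k x - V k y)) := by ring
      rw [this, abs_mul, abs_of_pos (by norm_num : (0:ℝ) < 2⁻¹)]
      have := abs_add_le (V j x - V j y) (V k x - V k y)
      linarith
    have i1 := jd_int (p := p) hN hε hm hq hmid
    have i2 := jd_int (p := p) hN hε hm hq (hV j)
    have i3 := jd_int (p := p) hN hε hm hq (hV k)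
    have i4 := gr_int (hV j) (hV k)
    have i5 := sq_int hN (hV j) (hV k)
    have i6 : Integrable fun x => κ * (‖gradient (V j) x - gradient (V k) x‖ ^ 2 + (V j x - V k x) ^ 2) := (i4.add i5).const_mul κ
    have h := integral_mono_ae (i1.add i6) ((i2.add i3).div_const 2)
      (by filter_upwards [jd_mid (m := m) (q := q) hp1 hp2 hε hm0 (hV j) (hV k)] with x hx; simpa using hx)
    simp only [Pi.add_apply] at h
    rw [integral_add i1 i6, integral_const_mul, integral_div, integral_add i2 i3, integral_add i4 i5] at h
    have a1 := hinf _ hmid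
    have a2 := hJ j
    have a3 := hJ k
    have a4 : 1 / ((k:ℝ) + 1) ≤ 1 / ((j:ℝ) + 1) := by gcongr
    unfold JJ at a1 a2 a3
    rw [hc]
    simp only
    rw [le_inv_mul_iff₀ hκ0]
    linarith
  have hDs : ∀ j k, j ≤ k → ∫ x, (V j x - V k x) ^ 2 ≤ c j := fun j k h => by
    have := hD j k h
    have : 0 ≤ ∫ x, ‖gradient (V j) x - gradient (V k) x‖ ^ 2 := integral_nonneg fun x => sq_nonneg _
    linarith
  have hDg : ∀ j k, j ≤ k → ∫ x, ‖gradient (V j) x - gradient (V k) x‖ ^ 2 ≤ c j := fun j k h => by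
    have := hD j k h
    have : 0 ≤ ∫ x, (V j x - V k x) ^ 2 := integral_nonneg fun x => sq_nonneg _
    linarith
  have hlim : ∀ x, ∃ y, Tendsto (fun j => V j x) atTop (𝓝 y) := by
    intro x
    apply cauchySeq_tendsto_of_complete
    rw [Metric.cauchySeq_iff']
    intro η hη
    obtain ⟨δ, hδ, H⟩ := sup_L2 hN (K + K) (half_pos hη)
    obtain ⟨j, hj⟩ := (hct.eventually (gt_mem_nhds hδ)).exists
    refine ⟨j, fun n hn => ?_⟩
    have := H _ ((hV j).hsub (hV n)).1 (sq_int hN (hV j) (hV n)) ((hDs j n hn).trans hj.le) x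
    rw [dist_comm, Real.dist_eq]; linarith
  choose v hv using hlim
  have hvC : Cl K v := by
    refine ⟨LipschitzWith.of_dist_le_mul fun x y => ?_, fun x hx => ?_⟩
    · exact le_of_tendsto ((hv x).dist (hv y)) (Eventually.of_forall fun j => (hV j).1.dist_le_mul x y)
    · refine tendsto_nhds_unique (hv x) ?_
      simp only [(hV _).2 x hx]; exact tendsto_const_nhds
  have hvs : ∀ j, ∫ x, (V j x - v x) ^ 2 ≤ c j := by
    intro j
    have := fat (μ := volume) (F := fun k x => V j x - V (j + k) x) (G := fun x => V j x - v x) (c := fun _ => c j) (c0 := c j)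
      (fun k => ((hV j).1.continuous.sub (hV (j + k)).1.continuous).measurable)
      (Eventually.of_forall fun x => tendsto_const_nhds.sub (by
        simpa [add_comm] using (tendsto_add_atTop_iff_nat j).2 (hv x))) tendsto_const_nhds
      (fun k => (lint_ofReal (sq_int hN (hV j) (hV (j + k))) (fun x => sq_nonneg _)).2
        ((hDs j _ (by omega)).trans (le_max_left _ _)))
    rw [lint_ofReal (sq_int hN (hV j) hvC) (fun x => sq_nonneg _), max_eq_left (hc0 j)] at this
    exact this
  have hgs : ∀ {a b : EE N → ℝ}, Cl K a → Cl K b → ∀ᵐ x, gradient (fun x => a x - b x) x = gradient a x - gradient b x := by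
    intro a b ha hb
    filter_upwards [grad_ae ha.1, grad_ae hb.1] with x h1 h2 using (hg_sub h1 h2).gradient
  have hvg : ∀ j, ∫ x, ‖gradient (V j) x - gradient v x‖ ^ 2 ≤ N * c j := by
    intro j
    have := lsc (K := K + K) (fun x => V j x - v x) (fun k x => V j x - V (j + k) x) (fun k => (hV j).hsub (hV _)) ((hV j).hsub hvC)
      (fun x => tendsto_const_nhds.sub (by
        simpa [add_comm] using (tendsto_add_atTop_iff_nat j).2 (hv x))) (c := c j) (by
        intro k
        have e : ∫⁻ x, ENNReal.ofReal (‖gradient (fun x => V j x - V (j + k) x) x‖ ^ 2) =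
          ∫⁻ x, ENNReal.ofReal (‖gradient (V j) x - gradient (V (j + k)) x‖ ^ 2) := by
            apply lintegral_congr_ae
            filter_upwards [hgs (hV j) (hV (j + k))] with x hx; rw [hx]
        rw [e, lint_ofReal (gr_int (hV j) (hV _)) (fun x => sq_nonneg _)]
        exact (hDg j _ (by omega)).trans (le_max_left _ _))
    have e : ∫⁻ x, ENNReal.ofReal (‖gradient (fun x => V j x - v x) x‖ ^ 2) =
      ∫⁻ x, ENNReal.ofReal (‖gradient (V j) x - gradient v x‖ ^ 2) := by
        apply lintegral_congr_ae
        filter_upwards [hgs (hV j) hvC] with x hx; rw [hx]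
    rw [e, ← ENNReal.ofReal_natCast, ← ENNReal.ofReal_mul (by positivity),
      lint_ofReal (gr_int (hV j) hvC) (fun x => sq_nonneg _), max_eq_left (by have := hc0 j; positivity)] at this
    exact this
  refine ⟨v, hvC, fun w hw => ?_⟩
  -- constants
  obtain ⟨Cm, hCm⟩ := hm.2
  obtain ⟨-, Ca, hCa⟩ := (BM.grad hvC.1).av hp1 hp2 hε
  set A := max Ca (Cm / 2 * (18 * K + 18 * K')) with hA
  have hA0 : 0 ≤ A := le_max_of_le_left ((norm_nonneg _).trans (hCa 0))
  set V4 := volume.real (closedBall (0:EE N) 4) with hV4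
  have key : ∀ δ > 0, ∀ j, JJ p ε m q v ≤ JJ p ε m q (V j) + A * (2 * δ * V4 + δ⁻¹ * ((N + 1) * c j)) := by
    intro δ hδ j
    have hyoung : ∀ t : ℝ, t ≤ δ + δ⁻¹ * t ^ 2 := by
      intro t
      have : δ + δ⁻¹ * t ^ 2 - t = δ⁻¹ * ((δ - t / 2) ^ 2 + 3 / 4 * t ^ 2) := by field_simp; ring
      have : 0 ≤ δ⁻¹ * ((δ - t / 2) ^ 2 + 3 / 4 * t ^ 2) := by positivity
      linarith
    have iv := jd_int (p := p) (m := m) hN hε hm hq hvC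
    have ij := jd_int (p := p) (m := m) hN hε hm hq (hV j)
    have i4 := gr_int (hV j) hvC
    have i5 := sq_int hN (hV j) hvC
    have i6 : Integrable ((closedBall (0:EE N) 4).indicator fun _ => 2 * δ) :=
      (integrable_indicator_iff measurableSet_closedBall).2 (integrableOn_const measure_closedBall_lt_top.ne)
    have i7 : Integrable fun x => δ⁻¹ * (‖gradient (V j) x - gradient v x‖ ^ 2 + (V j x - v x) ^ 2) := (i4.add i5).const_mul _
    have i8 : Integrable fun x => A * ((closedBall (0:EE N) 4).indicator (fun _ => 2 * δ) x +
      δ⁻¹ * (‖gradient (V j) x - gradient v x‖ ^ 2 + (V j x - v x) ^ 2)) := (i6.add i7).const_mul _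
    have h := integral_mono iv (ij.add i8) (by
      intro x
      simp only [Pi.add_apply]
      by_cases hx : x ∈ closedBall (0:EE N) 4
      · rw [indicator_of_mem hx]
        have h1 := ph_le hp1 hp2 hε (gradient v x) (gradient (V j) x)
        have h2 := (real_inner_le_norm (Av p ε (gradient v x)) (gradient v x - gradient (V j) x)).trans
          (mul_le_mul_of_nonneg_right ((hCa x).trans (le_max_left _ _ : Ca ≤ A)) (norm_nonneg _))
        rw [norm_sub_rev] at h2
        have h3 : m x / 2 * (v x - q x) ^ 2 - m x / 2 * (V j x - q x) ^ 2 ≤ A * |V j x - v x| := by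
          have e : m x / 2 * (v x - q x) ^ 2 - m x / 2 * (V j x - q x) ^ 2 =
            (m x / 2 * (2 * q x - v x - V j x)) * (V j x - v x) := by ring
          rw [e]
          refine (le_abs_self _).trans ?_
          rw [abs_mul]
          gcongr
          refine le_trans ?_ (le_max_right _ _)
          rw [abs_mul]
          have b1 := abs_le.1 (hvC.bd hN x)
          have b2 := abs_le.1 ((hV j).bd hN x)
          have b3 := abs_le.1 (hq.bd hN x)
          gcongr
          · exact (norm_nonneg _).trans (hCm 0) |>.trans' (by norm_num) |> fun h => div_nonneg h zero_le_two
          · have := hCm x; rw [Real.norm_eq_abs] at this; rw [abs_div, abs_two]; gcongr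
          · rw [abs_le]; constructor <;> linarith
        have h4 := hyoung ‖gradient (V j) x - gradient v x‖
        have h5 := hyoung |V j x - v x|
        rw [sq_abs] at h5
        have h6 := mul_le_mul_of_nonneg_left h4 hA0
        have h7 := mul_le_mul_of_nonneg_left h5 hA0
        unfold jd
        linarith
      · rw [indicator_of_notMem hx, jd_off hq hvC x hx, jd_off hq (hV j) x hx]
        positivity)
    simp only [Pi.add_apply] at h
    rw [integral_add ij i8, integral_const_mul, integral_add i6 i7, integral_const_mul, integral_add i4 i5,
      integral_indicator measurableSet_closedBall, setIntegral_const, smul_eq_mul] at h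
    unfold JJ
    have := hvg j
    have := hvs j
    refine h.trans ?_
    rw [mul_comm (volume.real _)]
    gcongr
    linarith
  have k2 : ∀ δ > 0, JJ p ε m q v ≤ sInf S + A * (2 * δ * V4) := by
    intro δ hδ
    have t1 : Tendsto (fun j : ℕ => sInf S + 1 / ((j:ℝ) + 1) + A * (2 * δ * V4 + δ⁻¹ * ((N + 1) * c j))) atTop
        (𝓝 (sInf S + 0 + A * (2 * δ * V4 + δ⁻¹ * ((N + 1) * 0)))) :=
      (tendsto_const_nhds.add (tendsto_one_div_add_atTop_nhds_zero_nat (𝕜 := ℝ))).add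
        ((tendsto_const_nhds.add ((hct.const_mul _).const_mul _)).const_mul _)
    have := ge_of_tendsto' t1 fun j => (key δ hδ j).trans (by gcongr; exact (hJ j).le)
    simpa using this
  have k3 : JJ p ε m q v ≤ sInf S := by
    apply le_of_forall_pos_le_add
    intro η hη
    have h0 : 0 ≤ V4 := measureReal_nonneg
    refine (k2 (η / (2 * (A * V4 + 1))) (by positivity)).trans ?_
    gcongr
    have : A * (2 * (η / (2 * (A * V4 + 1))) * V4) = η * ((A * V4) / (A * V4 + 1)) := by field_simp
    rw [this]
    have : (A * V4) / (A * V4 + 1) ≤ 1 := by rw [div_le_one (by positivity)]; linarith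
    nlinarith
  exact k3.trans (hinf w hw)

end AP

namespace AP
open Filter Topology
variable {N : ℕ} {p ε : ℝ} {m q v w : EE N → ℝ} {K K' : NNReal}

lemma touch {f g : EE N → ℝ} {a b x : EE N} (h : ∀ y, f y ≤ g y) (hx : f x = g x)
    (hf : HasGradientAt f a x) (hg : HasGradientAt g b x) : a = b := by
  have h1 := hg_sub hg hf
  have h2 : IsLocalMin (fun y => g y - f y) x := Eventually.of_forall fun y => by
    simp only [hx]; linarith [h y]
  have h3 := h2.hasFDerivAt_eq_zero (hasGradientAt_iff_hasFDerivAt.1 h1)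
  rw [map_sub, sub_eq_zero] at h3
  exact ((InnerProductSpace.toDual ℝ (EE N)).injective h3).symm

lemma grad_min {a b : EE N → ℝ} (ha : LipschitzWith K a) (hb : LipschitzWith K' b) :
    ∀ᵐ x, (a x ≤ b x → gradient (fun y => min (a y) (b y)) x = gradient a x) ∧
      (b x ≤ a x → gradient (fun y => min (a y) (b y)) x = gradient b x) := by
  filter_upwards [grad_ae ha, grad_ae hb, grad_ae (ha.min hb)] with x h1 h2 h3
  exact ⟨fun h => touch (fun y => min_le_left _ _) (min_eq_left h) h3 h1,
    fun h => touch (fun y => min_le_right _ _) (min_eq_right h) h3 h2⟩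

lemma grad_max {a b : EE N → ℝ} (ha : LipschitzWith K a) (hb : LipschitzWith K' b) :
    ∀ᵐ x, (b x ≤ a x → gradient (fun y => max (a y) (b y)) x = gradient a x) ∧
      (a x ≤ b x → gradient (fun y => max (a y) (b y)) x = gradient b x) := by
  filter_upwards [grad_ae ha, grad_ae hb, grad_ae (ha.max hb)] with x h1 h2 h3
  exact ⟨fun h => (touch (fun y => le_max_left _ _) (max_eq_left h).symm h1 h3).symm,
    fun h => (touch (fun y => le_max_right _ _) (max_eq_right h).symm h2 h3).symm⟩

lemma int_grad (hw : Cl K w) (c : EE N) : ∫ x, ⟪c, gradient w x⟫_ℝ = 0 := by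
  have hcs : HasCompactSupport w := HasCompactSupport.intro (isCompact_closedBall (0:EE N) 4) hw.2
  have h := LipschitzWith.integral_lineDeriv_mul_eq (μ := volume) (LipschitzWith.const' (1:ℝ) (K := 0)) hw.1 hcs (-c)
  have h0 : ∀ x : EE N, lineDeriv ℝ (fun _ : EE N => (1:ℝ)) x (-c) = 0 := fun x => by simp [lineDeriv]
  simp only [neg_neg, mul_one, h0, zero_mul, integral_zero] at h
  rw [h]
  apply integral_congr_ae
  filter_upwards [grad_ae hw.1] with x hx
  rw [hx.hasFDerivAt.hasLineDerivAt c |>.lineDeriv, real_inner_comm]; simp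

lemma q_zero {Q : EE N → ℝ} (hc : Continuous Q) (hi : Integrable Q) (h0 : ∀ x, 0 ≤ Q x) (h : ∫ x, Q x ≤ 0) (x : EE N) : Q x = 0 := by
  by_contra hx
  have := integral_pos_of_integrable_nonneg_nonzero hc hi h0 hx
  linarith

def IsMin (p ε : ℝ) (m q : EE N → ℝ) (K : NNReal) (v : EE N → ℝ) : Prop :=
  Cl K v ∧ ∀ w, Cl K w → JJ p ε m q v ≤ JJ p ε m q w

lemma grad_neg (v : EE N → ℝ) (x : EE N) : gradient (fun x => - v x) x = - gradient v x := by
  unfold gradient; rw [fderiv_fun_neg, map_neg]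

lemma Cl.neg (h : Cl K v) : Cl K (fun x => - v x) :=
  ⟨by have := h.1.neg; exact this, fun x hx => by simp [h.2 x hx]⟩

lemma IsMin.neg (h : IsMin p ε m q K v) : IsMin p ε m (fun x => - q x) K (fun x => - v x) := by
  have key : ∀ w, JJ p ε m (fun x => - q x) w = JJ p ε m q (fun x => - w x) := by
    intro w
    unfold JJ jd
    congr 1; ext x
    rw [grad_neg]
    unfold ph; rw [norm_neg]; ring
  refine ⟨h.1.neg, fun w hw => ?_⟩
  rw [key, key]
  simpa using h.2 _ hw.neg

lemma comp_affine (hN : 1 ≤ N) (hp1 : 1 < p) (hp2 : p < 2) (hε : 0 < ε) (hm : BM m) (hmc : Continuous m)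
    (hm0 : ∀ x, 0 < m x) (hq : Cl K' q) (h : IsMin p ε m q K v) (a : ℝ) (c : EE N) (hcK : ‖c‖ ≤ K)
    (hl : ∀ x ∈ closedBall (0:EE N) 4, 0 ≤ a + ⟪c, x⟫_ℝ ∧ q x ≤ a + ⟪c, x⟫_ℝ) :
    ∀ x ∈ closedBall (0:EE N) 4, v x ≤ a + ⟪c, x⟫_ℝ := by
  set l : EE N → ℝ := fun x => a + ⟪c, x⟫_ℝ with hldef
  have hlg : ∀ x, HasGradientAt l c x := by
    intro x
    rw [hasGradientAt_iff_hasFDerivAt]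
    exact ((innerSL ℝ c).hasFDerivAt.const_add a).congr_fderiv (by ext; simp)
  have hlL : LipschitzWith K l := LipschitzWith.of_dist_le_mul fun x y => by
    rw [dist_eq_norm, dist_eq_norm]
    have : l x - l y = ⟪c, x - y⟫_ℝ := by simp [hldef, inner_sub_right]
    rw [this]
    exact (norm_inner_le_norm _ _).trans (by gcongr)
  have hlp : LipschitzWith K (fun x => max (l x) 0) := by simpa using hlL.max_const 0
  set g : EE N → ℝ := fun x => min (v x) (max (l x) 0) with hg
  have hgC : Cl K g := ⟨by have := h.1.1.min hlp; rwa [max_self] at this, fun x hx => by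
    simp only [hg, h.1.2 x hx]; exact min_eq_left (le_max_right _ _)⟩
  have hk := hgC.hsub h.1
  set Q : EE N → ℝ := fun x => m x / 2 * ((v x - q x) ^ 2 - (g x - q x) ^ 2) with hQ
  have hQc : Continuous Q := by
    have := h.1.1.continuous; have := hgC.1.continuous; have := hq.1.continuous
    fun_prop
  have hcase : ∀ x, v x ≤ max (l x) 0 ∧ g x = v x ∨ (max (l x) 0 < v x ∧ x ∈ closedBall (0:EE N) 4 ∧ 0 ≤ l x ∧ q x ≤ l x ∧ g x = l x) := by
    intro x
    rcases le_or_gt (v x) (max (l x) 0) with h1 | h1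
    · exact Or.inl ⟨h1, min_eq_left h1⟩
    · have hx : x ∈ closedBall (0:EE N) 4 := by
        by_contra hx
        rw [h.1.2 x hx] at h1
        exact absurd (le_max_right (l x) 0) (not_le.2 h1)
      exact Or.inr ⟨h1, hx, (hl x hx).1, (hl x hx).2, by simp only [hg]; rw [min_eq_right h1.le, max_eq_left (hl x hx).1]⟩
  have hQ0 : ∀ x, 0 ≤ Q x := by
    intro x
    rcases hcase x with ⟨h1, h2⟩ | ⟨h1, hx, h2, h3, h4⟩
    · simp only [hQ, h2]; simp
    · simp only [hQ, h4]
      rw [max_eq_left h2] at h1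
      have := hm0 x
      apply mul_nonneg (by positivity)
      nlinarith
  have ig := jd_int (p := p) hN hε hm hq hgC
  have iv := jd_int (p := p) hN hε hm hq h.1
  have iQ : Integrable Q := by
    refine BM.off (R := 4) (BM.mul (by simpa [div_eq_mul_inv] using hm.mul (BM.const (2:ℝ)⁻¹))
      (((h.1.BL hN).sub (hq.BL hN)).BM.sq.sub ((hgC.BL hN).sub (hq.BL hN)).BM.sq)) fun x hx => ?_
    simp only [hQ, h.1.2 x hx, hgC.2 x hx]; ring
  have ik : Integrable fun x => ⟪Av p ε c, gradient (fun x => g x - v x) x⟫_ℝ :=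
    ((BM.const _).inner (BM.grad hk.1)).off (R := 4) fun x hx => by rw [grad_zero_off hk.2 hx]; simp
  have hint := integral_mono_ae (ig.sub iv) (ik.sub iQ) (by
    filter_upwards [grad_min h.1.1 hlp, grad_max hlL (LipschitzWith.const' (0:ℝ) (K := 0)), grad_ae h.1.1, grad_ae hgC.1] with x h1 h2 h3 h4
    simp only [Pi.sub_apply]
    rw [(hg_sub h4 h3).gradient]
    rcases hcase x with ⟨c1, c2⟩ | ⟨c1, hx, c2, c3, c4⟩
    · have := h1.1 c1
      simp only [jd, hQ, c2]
      rw [show gradient g x = gradient v x from this]; simp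
    · have e1 : gradient g x = c := by
        rw [show gradient g x = _ from h1.2 c1.le, h2.1 c2, (hlg x).gradient]
      have := ph_le hp1 hp2 hε c (gradient v x)
      simp only [jd, hQ]
      rw [e1]; linarith)
  rw [integral_sub' ig iv, integral_sub' ik iQ, int_grad hk] at hint
  have hJ := h.2 g hgC
  unfold JJ at hJ
  have hz := q_zero hQc iQ hQ0 (by linarith)
  intro x hx
  by_contra hc
  push Not at hc
  rcases hcase x with ⟨c1, c2⟩ | ⟨c1, hx, c2, c3, c4⟩
  · rw [max_eq_left (hl x hx).1] at c1; exact absurd c1 (not_le.2 hc)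
  · have := hz x
    simp only [hQ, c4] at this
    have h1 : l x < v x := hc
    have h2 : 0 < m x / 2 := half_pos (hm0 x)
    rcases mul_eq_zero.1 this with h3 | h3
    · linarith
    · nlinarith

lemma transl (hN : 1 ≤ N) (hε : 0 < ε) (hm : BM m) (hmc : Continuous m)
    (hm0 : ∀ x, 0 < m x) (hq : Cl K' q) (h : IsMin p ε m q K v) (e : EE N) (t : ℝ)
    (hb1 : ∀ x, x ∉ closedBall (0:EE N) 4 → v (x + e) ≤ t) (hb2 : ∀ x, x ∉ closedBall (0:EE N) 4 → - t ≤ v (x - e))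
    (hs : ∀ x, t < v (x + e) - v x → (m x - m (x + e)) * (v x + v (x + e) - t - 2 * q x) < 2 * m (x + e) * (t - (q (x + e) - q x))) :
    ∀ x, v (x + e) - v x ≤ t := by
  have hC := h.1
  have hsh : ∀ (a : EE N) (s : ℝ), LipschitzWith K fun x => v (x + a) + s := fun a s =>
    LipschitzWith.of_dist_le_mul fun x y => by
      have := hC.1.dist_le_mul (x + a) (y + a)
      rw [dist_add_right] at this; rwa [dist_add_right]
  set g1 : EE N → ℝ := fun x => max (v x) (v (x + e) + -t) with hg1
  set g2 : EE N → ℝ := fun x => min (v x) (v (x + -e) + t) with hg2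
  have c1 : Cl K g1 := ⟨by have := hC.1.max (hsh e (-t)); rwa [max_self] at this, fun x hx => by
    simp only [hg1, hC.2 x hx]; exact max_eq_left (by linarith [hb1 x hx])⟩
  have c2 : Cl K g2 := ⟨by have := hC.1.min (hsh (-e) t); rwa [max_self] at this, fun x hx => by
    have := hb2 x hx
    rw [sub_eq_add_neg] at this
    simp only [hg2, hC.2 x hx]; exact min_eq_left (by linarith)⟩
  set Q : EE N → ℝ := fun x => max (v (x + e) - t - v x) 0 / 2 *
    (2 * m (x + e) * (t - (q (x + e) - q x)) - (m x - m (x + e)) * (v x + v (x + e) - t - 2 * q x)) with hQ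
  have hQc : Continuous Q := by
    have := hC.1.continuous; have := hq.1.continuous
    fun_prop
  have hQ0 : ∀ x, 0 ≤ Q x := by
    intro x
    rcases le_or_gt (v (x + e) - t - v x) 0 with h1 | h1
    · simp only [hQ]; rw [max_eq_right h1]; simp
    · have := hs x (by linarith)
      apply mul_nonneg <;> [positivity; linarith]
  have i1 := jd_int (p := p) hN hε hm hq c1
  have i2 := (jd_int (p := p) hN hε hm hq c2).comp_add_right e
  have i3 := jd_int (p := p) hN hε hm hq hC
  have i4 := (jd_int (p := p) hN hε hm hq hC).comp_add_right e
  have hae : ∀ᵐ x, Q x = (jd p ε m q v x + jd p ε m q v (x + e)) - (jd p ε m q g1 x + jd p ε m q g2 (x + e)) := by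
    filter_upwards [grad_max hC.1 (hsh e (-t)), ae_shift (grad_min hC.1 (hsh (-e) t)) e, ae_shift (grad_ae hC.1) e, grad_ae hC.1] with x h1 h2 h3 h4
    have a1 : gradient (fun y => v (y + e) + -t) x = gradient v (x + e) := by
      have := hg_add (hg_shift e h3) (hasGradientAt_const x (-t))
      rw [this.gradient, add_zero]
    have a2 : gradient (fun y => v (y + -e) + t) (x + e) = gradient v x := by
      have := hg_add (hg_shift (x := x + e) (-e) (f := v) (f' := gradient v x) (by simpa using h4)) (hasGradientAt_const (x + e) t)
      rw [this.gradient, add_zero]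
    rw [a1] at h1
    rw [a2] at h2
    simp only [add_neg_cancel_right] at h2
    rcases le_total (v (x + e) - t - v x) 0 with hd | hd
    · have b1 : g1 x = v x := max_eq_left (by linarith)
      have b2 : g2 (x + e) = v (x + e) := by simp only [hg2, add_neg_cancel_right]; exact min_eq_left (by linarith)
      have b3 : gradient g1 x = gradient v x := h1.1 (by linarith)
      have b4 : gradient g2 (x + e) = gradient v (x + e) := h2.1 (by linarith)
      simp only [jd, b1, b2, b3, b4, hQ]; rw [max_eq_right hd]; ring
    · have b1 : g1 x = v (x + e) + -t := max_eq_right (by linarith)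
      have b2 : g2 (x + e) = v x + t := by simp only [hg2, add_neg_cancel_right]; exact min_eq_right (by linarith)
      have b3 : gradient g1 x = gradient v (x + e) := h1.2 (by linarith)
      have b4 : gradient g2 (x + e) = gradient v x := h2.2 (by linarith)
      simp only [jd, b1, b2, b3, b4, hQ]; rw [max_eq_left hd]; ring
  have iQ : Integrable Q := ((i3.add i4).sub (i1.add i2)).congr (by filter_upwards [hae] with x hx; rw [hx]; rfl)
  have hint : ∫ x, Q x ≤ 0 := by
    have i34 : Integrable fun x => jd p ε m q v x + jd p ε m q v (x + e) := i3.add i4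
    have i12 : Integrable fun x => jd p ε m q g1 x + jd p ε m q g2 (x + e) := i1.add i2
    rw [integral_congr_ae hae, integral_sub i34 i12, integral_add i3 i4, integral_add i1 i2,
      integral_add_right_eq_self (jd p ε m q v) e, integral_add_right_eq_self (jd p ε m q g2) e]
    have := h.2 g1 c1
    have := h.2 g2 c2
    unfold JJ at *
    linarith
  intro x
  by_contra hc
  push Not at hc
  have h1 := q_zero hQc iQ hQ0 hint x
  have h2 := hs x hc
  simp only [hQ] at h1
  rw [max_eq_left (by linarith)] at h1
  rcases mul_eq_zero.1 h1 with h3 | h3 <;> linarith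

lemma el_min (hN : 1 ≤ N) (hp1 : 1 < p) (hp2 : p < 2) (hε : 0 < ε) (hm : BM m) (hq : Cl K' q)
    (h : IsMin p ε m q (K + 1) v) (hv : LipschitzWith K v) {K2 : NNReal} {ψ : EE N → ℝ} (hψ : Cl K2 ψ) :
    ∫ x, ⟪gradient ψ x, Av p ε (gradient v x)⟫_ℝ = ∫ x, m x * (q x - v x) * ψ x := by
  have iA : Integrable fun x => ⟪gradient ψ x, Av p ε (gradient v x)⟫_ℝ :=
    ((BM.grad hψ.1).inner ((BM.grad hv).av hp1 hp2 hε)).off (R := 4) fun x hx => by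
      rw [grad_zero_off hψ.2 hx]; simp
  have iB : Integrable fun x => m x * (q x - v x) * ψ x :=
    ((hm.mul ((hq.BL hN).sub (h.1.BL hN)).BM).mul (hψ.BL hN).BM).off (R := 4) fun x hx => by rw [hψ.2 x hx]; ring
  have iC : Integrable fun x => 2 * aw p ε 0 * ‖gradient ψ x‖ ^ 2 + m x / 2 * ψ x ^ 2 := by
    refine (((BM.const _).mul (BM.grad hψ.1).norm.sq).add (BM.mul (by simpa [div_eq_mul_inv] using hm.mul (BM.const (2:ℝ)⁻¹)) (hψ.BL hN).BM.sq)).off (R := 4) fun x hx => ?_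
    rw [grad_zero_off hψ.2 hx, hψ.2 x hx]; simp
  set X := (∫ x, ⟪gradient ψ x, Av p ε (gradient v x)⟫_ℝ) - ∫ x, m x * (q x - v x) * ψ x with hX
  set Z := ∫ x, (2 * aw p ε 0 * ‖gradient ψ x‖ ^ 2 + m x / 2 * ψ x ^ 2) with hZ
  have key : ∀ t : ℝ, |t| * K2 ≤ 1 → 0 ≤ t * X + t ^ 2 * Z := by
    intro t ht
    have hC : Cl (K + 1) fun x => v x + t * ψ x := by
      refine ⟨LipschitzWith.of_dist_le_mul fun x y => ?_, fun x hx => by simp [h.1.2 x hx, hψ.2 x hx]⟩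
      have h1 := hv.dist_le_mul x y
      have h2 := hψ.1.dist_le_mul x y
      rw [Real.dist_eq] at *
      have e : v x + t * ψ x - (v y + t * ψ y) = (v x - v y) + t * (ψ x - ψ y) := by ring
      rw [e]
      refine (abs_add_le _ _).trans ?_
      rw [abs_mul]
      have h3 : |t| * |ψ x - ψ y| ≤ 1 * dist x y := by
        calc _ ≤ |t| * (K2 * dist x y) := by gcongr
          _ = (|t| * K2) * dist x y := by ring
          _ ≤ _ := by gcongr
      push_cast; linarith
    have i1 := jd_int (p := p) hN hε hm hq hC
    have i2 := jd_int (p := p) hN hε hm hq h.1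
    have i3 : Integrable fun x => t * (⟪gradient ψ x, Av p ε (gradient v x)⟫_ℝ - m x * (q x - v x) * ψ x) := (iA.sub iB).const_mul t
    have hint := integral_mono_ae (i1.sub i2) (i3.add (iC.const_mul (t ^ 2))) (by
      filter_upwards [grad_ae hv, grad_ae hψ.1] with x h1 h2
      simp only [Pi.sub_apply, Pi.add_apply]
      unfold jd
      rw [(hg_add h1 (hg_cmul t h2)).gradient]
      have a1 := ph_le hp1 hp2 hε (gradient v x + t • gradient ψ x) (gradient v x)
      rw [add_sub_cancel_left] at a1
      have a2 := Av_lip0 hp1 hp2 hε (gradient v x + t • gradient ψ x) (gradient v x)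
      rw [add_sub_cancel_left] at a2
      have a3 := (real_inner_le_norm (Av p ε (gradient v x + t • gradient ψ x) - Av p ε (gradient v x)) (t • gradient ψ x)).trans
        (mul_le_mul_of_nonneg_right a2 (norm_nonneg _))
      rw [inner_sub_left] at a3
      have a4 : ‖t • gradient ψ x‖ ^ 2 = t ^ 2 * ‖gradient ψ x‖ ^ 2 := by rw [norm_smul, mul_pow, Real.norm_eq_abs, sq_abs]
      have a5 : ⟪Av p ε (gradient v x), t • gradient ψ x⟫_ℝ = t * ⟪gradient ψ x, Av p ε (gradient v x)⟫_ℝ := by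
        rw [real_inner_smul_right, real_inner_comm]
      have a6 : 2 * aw p ε 0 * ‖t • gradient ψ x‖ * ‖t • gradient ψ x‖ = t ^ 2 * (2 * aw p ε 0 * ‖gradient ψ x‖ ^ 2) := by
        rw [mul_assoc, ← pow_two, a4]; ring
      nlinarith)
    rw [integral_sub' i1 i2, integral_add' i3 (iC.const_mul _), integral_const_mul, integral_const_mul, integral_sub iA iB] at hint
    have := h.2 _ hC
    unfold JJ at this
    linarith
  have hX0 : X = 0 := by
    by_contra hne
    have hZ0 : 0 ≤ |Z| + 1 := by positivity
    set s := min (1 / ((K2:ℝ) + 1)) (|X| / (2 * (|Z| + 1))) with hs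
    have hs0 : 0 < s := lt_min (by positivity) (by have := abs_pos.2 hne; positivity)
    have hs1 : s * K2 ≤ 1 := by
      have : s ≤ 1 / ((K2:ℝ) + 1) := min_le_left _ _
      rw [le_div_iff₀ (by positivity)] at this
      linarith
    have hs2 : s * (2 * (|Z| + 1)) ≤ |X| := by
      rw [← le_div_iff₀ (by positivity)]; exact min_le_right _ _
    have hle := le_abs_self Z
    have hXp := abs_pos.2 hne
    rcases lt_or_gt_of_ne hne with hneg | hpos
    · have := key s (by rwa [abs_of_pos hs0])
      rw [abs_of_neg hneg] at hs2
      have h3 : 0 ≤ X + s * Z := by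
        by_contra hc; push Not at hc; nlinarith
      nlinarith
    · have := key (-s) (by rwa [abs_neg, abs_of_pos hs0])
      rw [abs_of_pos hpos] at hs2
      have h3 : 0 ≤ - X + s * Z := by
        by_contra hc; push Not at hc; nlinarith
      nlinarith
  linarith

end AP

namespace AP
open Filter Topology
variable {N : ℕ} {p ε lam : ℝ} {q v w : EE N → ℝ} {K K' : NNReal}

noncomputable def mm (lam : ℝ) (x : EE N) : ℝ := Real.exp (lam * (4 * min ‖x‖ 4 - 6))

lemma mm_cont : Continuous (mm lam : EE N → ℝ) := by unfold mm; fun_prop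

lemma mm_pos (x : EE N) : 0 < mm lam x := Real.exp_pos _

lemma mm_le (hl : 0 ≤ lam) (x : EE N) : mm lam x ≤ Real.exp (lam * 10) := by
  unfold mm
  gcongr
  linarith [min_le_right ‖x‖ 4]

lemma mm_ge (hl : 0 ≤ lam) (x : EE N) : Real.exp (lam * (-6)) ≤ mm lam x := by
  unfold mm
  gcongr
  have : 0 ≤ min ‖x‖ 4 := le_min (norm_nonneg _) (by norm_num)
  linarith

lemma mm_BM (hl : 0 ≤ lam) : BM (mm lam : EE N → ℝ) :=
  ⟨mm_cont.measurable, _, fun x => by rw [Real.norm_of_nonneg (mm_pos x).le]; exact mm_le hl x⟩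

lemma mm_sub (hl : 0 ≤ lam) (x y : EE N) (h : 4 * lam * ‖x - y‖ ≤ 1) : |mm lam x - mm lam y| ≤ 8 * lam * ‖x - y‖ * mm lam y := by
  have h1 : mm lam x = Real.exp (4 * lam * (min ‖x‖ 4 - min ‖y‖ 4)) * mm lam y := by
    unfold mm; rw [← Real.exp_add]; congr 1; ring
  have h2 : |4 * lam * (min ‖x‖ 4 - min ‖y‖ 4)| ≤ 4 * lam * ‖x - y‖ := by
    rw [abs_mul, abs_of_nonneg (by positivity : 0 ≤ 4 * lam)]
    gcongr
    exact (abs_inf_sub_inf_le_abs _ _ _).trans (abs_norm_sub_norm_le _ _)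
  have h3 := Real.abs_exp_sub_one_le (h2.trans h)
  have h4 := mm_pos (lam := lam) y
  rw [h1, ← sub_one_mul, abs_mul, abs_of_pos h4]
  gcongr
  linarith

lemma exist3 (hN : 1 ≤ N) (hp1 : 1 < p) (hp2 : p < 2) (hε : 0 < ε) (hε1 : ε ≤ 1) (hl : 1 ≤ lam)
    (hq : LipschitzWith 2 q) (hq2 : ∀ x, |q x| ≤ 2) (hq3 : ∀ x, |q x| ≤ 2 * max (3 - ‖x‖) 0) :
    ∃ v : EE N → ℝ, (∀ x y, |v x - v y| ≤ (48 * lam + 3) * ‖x - y‖) ∧ (∀ x, |v x| ≤ 2) ∧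
      (∀ x, x ∉ closedBall (0:EE N) 4 → v x = 0) ∧
      (∀ ψ K2, Cl K2 ψ → ∫ x, ⟪gradient ψ x, Av p ε (gradient v x)⟫_ℝ = ∫ x, mm lam x * (q x - v x) * ψ x) ∧
      ∫ x, mm lam x * (q x - v x) ^ 2 ≤ 10 * volume.real (closedBall (0:EE N) 4) := by
  have hl0 : 0 ≤ lam := by linarith
  set L : NNReal := ⟨48 * lam + 3, by positivity⟩ with hL
  have hLr : (L:ℝ) = 48 * lam + 3 := rfl
  have hqC : Cl 2 q := ⟨hq, fun x hx => by
    rw [mem_closedBall_zero_iff, not_le] at hx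
    have := hq3 x
    rw [max_eq_right (by linarith), mul_zero] at this
    exact abs_nonpos_iff.1 this⟩
  obtain ⟨v, hv⟩ := exist_min (p := p) (ε := ε) hN hp1 hp2 hε (mm_BM hl0) (Real.exp_pos _) (mm_ge hl0) hqC (L + 1)
  have hv : IsMin p ε (mm lam) q (L + 1) v := hv
  have bd : ∀ {q v : EE N → ℝ}, Cl 2 q → (∀ x, |q x| ≤ 2) → (∀ x, |q x| ≤ 2 * max (3 - ‖x‖) 0) →
      IsMin p ε (mm lam) q (L + 1) v → ∀ x, v x ≤ 2 ∧ v x ≤ L * max (4 - ‖x‖) 0 := by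
    intro q v hq hq2 hq3 hv x
    have hCA := comp_affine hN hp1 hp2 hε (mm_BM hl0) mm_cont mm_pos hq hv
    by_cases hx : x ∈ closedBall (0:EE N) 4
    · constructor
      · simpa using hCA 2 0 (by simp; positivity) (fun y hy => by simpa using (abs_le.1 (hq2 y)).2) x hx
      · obtain ⟨ν, hν, hνx⟩ : ∃ ν : EE N, ‖ν‖ = 1 ∧ ⟪ν, x⟫_ℝ = ‖x‖ := by
          by_cases h0 : x = 0
          · exact ⟨EuclideanSpace.single ⟨0, hN⟩ 1, by simp, by simp [h0]⟩
          · have := norm_pos_iff.2 h0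
            refine ⟨‖x‖⁻¹ • x, by rw [norm_smul]; simp [this.ne'], ?_⟩
            rw [real_inner_smul_left, real_inner_self_eq_norm_sq]; field_simp
        have := hCA (4 * L) (-(L:ℝ) • ν) (by
            rw [norm_smul, hν, mul_one, norm_neg, Real.norm_of_nonneg (NNReal.coe_nonneg L)]; push_cast; linarith) (fun y hy => by
          rw [mem_closedBall_zero_iff] at hy
          have h1 := real_inner_le_norm ν y
          rw [hν, one_mul] at h1
          rw [real_inner_smul_left]
          have h2 : (0:ℝ) ≤ L := L.2
          have h3 := (abs_le.1 (hq3 y)).2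
          have h4 : max (3 - ‖y‖) 0 ≤ 4 - ‖y‖ := max_le (by linarith) (by linarith)
          have h5 : (L:ℝ) * (4 - ‖y‖) ≤ L * (4 - ⟪ν, y⟫_ℝ) := by gcongr
          have h6 : 2 * (4 - ‖y‖) ≤ L * (4 - ‖y‖) := by gcongr <;> linarith
          constructor <;> nlinarith) x hx
        rw [real_inner_smul_left, hνx] at this
        rw [mem_closedBall_zero_iff] at hx
        rw [max_eq_left (by linarith)]; linarith
    · rw [hv.1.2 x hx]
      exact ⟨by norm_num, by positivity⟩
  have b1 := bd hqC hq2 hq3 hv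
  have b2 := bd hqC.neg (by simpa using hq2) (by simpa using hq3) hv.neg
  have v2 : ∀ x, |v x| ≤ 2 := fun x => abs_le.2 ⟨by linarith [(b2 x).1], (b1 x).1⟩
  have key : ∀ e x : EE N, v (x + e) - v x ≤ L * ‖e‖ := by
    intro e
    have hLn : (0:ℝ) ≤ L := L.2
    have hout : ∀ x y : EE N, x ∉ closedBall (0:EE N) 4 → ‖x - y‖ = ‖e‖ → (L:ℝ) * max (4 - ‖y‖) 0 ≤ L * ‖e‖ := by
      intro x y hx hxy
      rw [mem_closedBall_zero_iff, not_le] at hx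
      gcongr
      have := norm_sub_norm_le x y
      exact max_le (by linarith) (norm_nonneg _)
    apply transl hN hε (mm_BM hl0) mm_cont mm_pos hqC hv e
    · intro x hx
      exact (b1 _).2.trans (hout x (x + e) hx (by simp))
    · intro x hx
      have := (b2 (x - e)).2.trans (hout x (x - e) hx (by simp))
      linarith
    · intro x hx
      have hx1 := abs_le.1 (v2 x)
      have hx2 := abs_le.1 (v2 (x + e))
      have hx3 := abs_le.1 (hq2 x)
      have he : 0 < ‖e‖ := by
        rw [norm_pos_iff]; rintro rfl; simp at hx
      have hsm : 4 * lam * ‖e‖ ≤ 1 := by rw [hLr] at hx; nlinarith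
      have hms := mm_sub hl0 x (x + e) (by simpa using hsm)
      rw [sub_add_cancel_left, norm_neg] at hms
      have hmp := mm_pos (lam := lam) (x + e)
      have hA : |v x + v (x + e) - L * ‖e‖ - 2 * q x| ≤ 12 := by
        rw [abs_le]
        have : 0 ≤ (L:ℝ) * ‖e‖ := by positivity
        constructor <;> linarith
      have hB : q (x + e) - q x ≤ 2 * ‖e‖ := by
        have := (le_abs_self _).trans (hq.norm_sub_le (x + e) x)
        simpa using this
      calc _ ≤ |(mm lam x - mm lam (x + e)) * (v x + v (x + e) - L * ‖e‖ - 2 * q x)| := le_abs_self _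
        _ ≤ (8 * lam * ‖e‖ * mm lam (x + e)) * 12 := by rw [abs_mul]; gcongr
        _ < 2 * mm lam (x + e) * (L * ‖e‖ - 2 * ‖e‖) := by
          rw [hLr]
          have := mul_pos hmp he
          nlinarith
        _ ≤ _ := by gcongr
  have hvL : ∀ x y, |v x - v y| ≤ (48 * lam + 3) * ‖x - y‖ := by
    intro x y
    have h1 := key (x - y) y
    have h2 := key (y - x) x
    rw [add_sub_cancel, hLr] at h1 h2
    rw [norm_sub_rev y x] at h2
    rw [abs_le]; constructor <;> linarith
  refine ⟨v, hvL, v2, hv.1.2, fun ψ K2 hψ => el_min hN hp1 hp2 hε (mm_BM hl0) hqC hv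
    (LipschitzWith.of_dist_le_mul fun x y => by rw [Real.dist_eq, dist_eq_norm]; exact hvL x y) hψ, ?_⟩
  have hJ := hv.2 q (hqC.mono (by rw [← NNReal.coe_le_coe]; push_cast; rw [hLr]; linarith))
  have iM : Integrable fun x => mm lam x * (q x - v x) ^ 2 :=
    ((mm_BM hl0).mul ((hqC.BL hN).sub (hv.1.BL hN)).BM.sq).off (R := 4) fun x hx => by
      rw [hqC.2 x hx, hv.1.2 x hx]; ring
  have h1 : (∫ x, mm lam x * (q x - v x) ^ 2) / 2 ≤ JJ p ε (mm lam) q v := by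
    rw [← integral_div]
    apply integral_mono (iM.div_const 2) (jd_int hN hε (mm_BM hl0) hqC hv.1)
    intro x
    have := ph_min hp1 hp2 hε (gradient v x)
    unfold jd
    simp only
    have e : mm lam x * (q x - v x) ^ 2 / 2 = mm lam x / 2 * (v x - q x) ^ 2 := by ring
    rw [e]; linarith
  have h2 : JJ p ε (mm lam) q q ≤ 5 * volume.real (closedBall (0:EE N) 4) := by
    have i6 : Integrable ((closedBall (0:EE N) 4).indicator fun _ => (5:ℝ)) :=
      (integrable_indicator_iff measurableSet_closedBall).2 (integrableOn_const measure_closedBall_lt_top.ne)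
    have := integral_mono (jd_int (p := p) hN hε (mm_BM hl0) hqC hqC) i6 (by
      intro x
      by_cases hx : x ∈ closedBall (0:EE N) 4
      · rw [indicator_of_mem hx]
        unfold jd
        have a1 := ph_le_norm hp1 hp2 hε (gradient q x)
        have a2 : 0 ≤ ph p ε (0:EE N) := by unfold ph; positivity
        have a3 : ‖gradient q x‖ ^ p ≤ 4 := by
          calc ‖gradient q x‖ ^ p ≤ (2:ℝ) ^ p := by gcongr; exact grad_le hq x
            _ ≤ (2:ℝ) ^ (2:ℝ) := Real.rpow_le_rpow_of_exponent_le (by norm_num) hp2.le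
            _ = 4 := by norm_num
        have a4 : ε ^ p ≤ 1 := Real.rpow_le_one hε.le hε1 (by linarith)
        have a5 : ‖gradient q x‖ ^ p / p + ε ^ p / p ≤ 5 := by
          rw [← add_div, div_le_iff₀ (by linarith)]; linarith
        simp only [sub_self]; linarith
      · rw [indicator_of_notMem hx, jd_off hqC hqC x hx])
    rw [integral_indicator measurableSet_closedBall, setIntegral_const, smul_eq_mul, mul_comm] at this
    exact this
  linarith

end AP

namespace AP
open Filter Topology
variable {N : ℕ} {p ε lam : ℝ} {q v w : EE N → ℝ} {K K' : NNReal}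

noncomputable def zz (x : EE N) : ℝ := min 1 (max (7.8 - 4 * ‖x‖) 0)

lemma zz_lip : LipschitzWith 4 (zz : EE N → ℝ) := by
  unfold zz
  refine LipschitzWith.const_min (LipschitzWith.max_const ?_ 0) 1
  refine LipschitzWith.of_dist_le_mul fun x y => ?_
  rw [dist_eq_norm, dist_eq_norm, Real.norm_eq_abs]
  have : 7.8 - 4 * ‖x‖ - (7.8 - 4 * ‖y‖) = -(4 * (‖x‖ - ‖y‖)) := by ring
  rw [this, abs_neg, abs_mul]
  have := abs_norm_sub_norm_le x y
  norm_num; linarith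

lemma zz_nonneg (x : EE N) : 0 ≤ zz x := le_min zero_le_one (le_max_right _ _)
lemma zz_le (x : EE N) : zz x ≤ 1 := min_le_left _ _
lemma zz_one {x : EE N} (h : ‖x‖ ≤ 1.7) : zz x = 1 := by
  unfold zz; apply min_eq_left; apply le_max_of_le_left; linarith
lemma zz_zero {x : EE N} (h : 1.95 ≤ ‖x‖) : zz x = 0 := by
  unfold zz; rw [max_eq_right (by linarith)]; simp
lemma zz_BL : BL (zz : EE N → ℝ) := BL.mk' zz_lip (C := 1) fun x => by
  rw [Real.norm_of_nonneg (zz_nonneg x)]; exact zz_le x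

lemma zz_grad {x : EE N} (h : ‖x‖ < 1.7) : gradient (zz : EE N → ℝ) x = 0 := by
  have : (zz : EE N → ℝ) =ᶠ[𝓝 x] fun _ => 1 := by
    filter_upwards [(continuous_norm.isOpen_preimage _ isOpen_Iio).mem_nhds (show x ∈ (fun x => ‖x‖) ⁻¹' Iio (1.7:ℝ) from h)] with y hy using zz_one (le_of_lt hy)
  rw [this.gradient_eq]; simp

lemma zz_err (hl : 0 ≤ lam) (x : EE N) (a : ℝ) : |a| * ‖gradient (zz : EE N → ℝ) x‖ ≤
    2 * Real.exp (-lam / 4) * (1 + mm lam x * a ^ 2) := by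
  have h0 := mm_pos (lam := lam) x
  rcases lt_or_ge ‖x‖ 1.7 with h | h
  · rw [zz_grad h]; simp; positivity
  · have h1 : ‖gradient (zz : EE N → ℝ) x‖ ≤ 4 := grad_le zz_lip x
    have h2 : Real.exp (lam / 4) ^ 2 ≤ mm lam x := by
      rw [← Real.exp_nat_mul]; unfold mm
      apply Real.exp_le_exp.2
      have : 1.7 ≤ min ‖x‖ 4 := le_min h (by norm_num)
      push_cast; nlinarith
    set s := Real.exp (lam / 4) with hs
    have hs0 : 0 < s := Real.exp_pos _
    have h3 : Real.exp (-lam / 4) = s⁻¹ := by rw [hs, ← Real.exp_neg]; congr 1; ring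
    rw [h3]
    have h4 : 2 * |a| ≤ s⁻¹ * (1 + s ^ 2 * a ^ 2) := by
      rw [inv_mul_eq_div, le_div_iff₀ hs0]
      have := sq_nonneg (1 - s * |a|)
      have := sq_abs a
      nlinarith
    calc |a| * ‖gradient (zz : EE N → ℝ) x‖ ≤ |a| * 4 := by gcongr
      _ ≤ 2 * (s⁻¹ * (1 + s ^ 2 * a ^ 2)) := by linarith
      _ ≤ 2 * (s⁻¹ * (1 + mm lam x * a ^ 2)) := by gcongr
      _ = _ := by ring

lemma ph_cvx (hp1 : 1 < p) (hp2 : p < 2) (hε : 0 < ε) (a b : EE N) {t : ℝ} (h0 : 0 ≤ t) (h1 : t ≤ 1) :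
    ph p ε ((1 - t) • a + t • b) ≤ (1 - t) * ph p ε a + t * ph p ε b := by
  set P := (1 - t) • a + t • b with hP
  have e1 := ph_le hp1 hp2 hε P a
  have e2 := ph_le hp1 hp2 hε P b
  have e3 : (1 - t) * ⟪Av p ε P, P - a⟫_ℝ + t * ⟪Av p ε P, P - b⟫_ℝ = 0 := by
    rw [← real_inner_smul_right, ← real_inner_smul_right, ← inner_add_right]
    have : (1 - t) • (P - a) + t • (P - b) = 0 := by rw [hP]; module
    rw [this, inner_zero_right]
  nlinarith [mul_le_mul_of_nonneg_left e1 (sub_nonneg.2 h1), mul_le_mul_of_nonneg_left e2 h0]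

lemma Av_norm_le' (hp1 : 1 < p) (hp2 : p < 2) (hε : 0 < ε) (hε1 : ε ≤ 1) (ξ : EE N) : ‖Av p ε ξ‖ ≤ 1 + ‖ξ‖ := by
  refine (Av_norm_le hp1 hε ξ).trans ?_
  have h1 : ε ^ 2 + ‖ξ‖ ^ 2 ≤ (1 + ‖ξ‖) ^ 2 := by nlinarith [norm_nonneg ξ]
  calc (ε ^ 2 + ‖ξ‖ ^ 2) ^ ((p - 1) / 2) ≤ ((1 + ‖ξ‖) ^ 2) ^ ((p - 1) / 2) := by gcongr
    _ = (1 + ‖ξ‖) ^ (p - 1) := by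
        rw [← Real.rpow_natCast_mul (by positivity)]; congr 1; push_cast; ring
    _ ≤ (1 + ‖ξ‖) ^ (1:ℝ) := Real.rpow_le_rpow_of_exponent_le (by linarith [norm_nonneg ξ]) (by linarith)
    _ = _ := Real.rpow_one _

lemma aw_ge (hp1 : 1 < p) (hp2 : p < 2) (hε : 0 < ε) (hε1 : ε ≤ 1) {L : ℝ} (hL : 1 ≤ L) : 1 / (2 * L) ≤ aw p ε L := by
  unfold aw
  have h1 : ε ^ 2 + L ^ 2 ≤ (2 * L) ^ 2 := by nlinarith
  calc 1 / (2 * L) = (2 * L) ^ (-1:ℝ) := by rw [Real.rpow_neg_one, one_div]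
    _ ≤ (2 * L) ^ (p - 2) := Real.rpow_le_rpow_of_exponent_le (by linarith) (by linarith)
    _ = ((2 * L) ^ 2) ^ ((p - 2) / 2) := by
        rw [← Real.rpow_natCast_mul (by positivity)]; congr 1; push_cast; ring
    _ ≤ _ := Real.rpow_le_rpow_of_nonpos (by positivity) h1 (by linarith)

lemma OS1 (hN : 1 ≤ N) (hp1 : 1 < p) (hp2 : p < 2) : ∃ C > 0, ∀ (ε lam κ : ℝ) (q : EE N → ℝ), 0 < ε → ε ≤ 1 → 1 ≤ lam →
    LipschitzWith 2 q → (∀ x, |q x| ≤ 2) → (∀ x, |q x| ≤ 2 * max (3 - ‖x‖) 0) →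
    (∀ (W : EE N → ℝ) (K : NNReal), LipschitzWith K W → (∀ x, x ∉ ball (0:EE N) 2 → W x = q x) → (∀ x, |W x - q x| ≤ 4) →
      ∫ x in ball (0:EE N) 2, ‖gradient q x‖ ^ p / p ≤ (∫ x in ball (0:EE N) 2, ‖gradient W x‖ ^ p / p) + κ) →
    ∃ v : EE N → ℝ, (∀ x y, |v x - v y| ≤ (48 * lam + 3) * ‖x - y‖) ∧ (∀ x, |v x| ≤ 2) ∧
      (∀ ψ K2, Cl K2 ψ → ∫ x, ⟪gradient ψ x, Av p ε (gradient v x)⟫_ℝ = ∫ x, mm lam x * (q x - v x) * ψ x) ∧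
      ∫ x in ball (0:EE N) 1, ‖gradient q x - gradient v x‖ ^ 2 ≤ C * (48 * lam + 3) ^ 2 * (κ + ε + Real.exp (-lam / 4)) := by
  set V4 := volume.real (closedBall (0:EE N) 4) with hV4
  have hV40 : 0 ≤ V4 := measureReal_nonneg
  have hp' : 0 < p - 1 := by linarith
  refine ⟨4 / (p - 1) * (1 + 88 * V4), by positivity, fun ε lam κ q hε hε1 hl hq hq2 hq3 ham => ?_⟩
  obtain ⟨v, hv, hv2, hv4, el, hE⟩ := exist3 hN hp1 hp2 hε hε1 hl hq hq2 hq3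
  refine ⟨v, hv, hv2, el, ?_⟩
  set L := 48 * lam + 3 with hL
  have hL51 : 51 ≤ L := by linarith
  set D := ball (0:EE N) 2
  have hDt : volume D ≠ ⊤ := measure_ball_lt_top.ne
  have hDV : volume.real D ≤ V4 := measureReal_mono (ball_subset_closedBall.trans (closedBall_subset_closedBall (by norm_num))) measure_closedBall_lt_top.ne
  have hvl : LipschitzWith (Real.toNNReal L) v := by
    refine LipschitzWith.of_dist_le_mul fun x y => ?_
    rw [dist_eq_norm, dist_eq_norm, Real.coe_toNNReal _ (by linarith)]; exact hv x y
  have hgv : ∀ x, ‖gradient v x‖ ≤ L := fun x => by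
    have := grad_le hvl x; rwa [Real.coe_toNNReal _ (by linarith)] at this
  have hgq : ∀ x, ‖gradient q x‖ ≤ 2 := fun x => by simpa using grad_le hq x
  have hgz : ∀ x, ‖gradient (zz : EE N → ℝ) x‖ ≤ 4 := fun x => by simpa using grad_le zz_lip x
  have bq : BL q := BL.mk' hq hq2
  have bv : BL v := BL.mk' hvl hv2
  have hqv : ∀ x, |q x - v x| ≤ 4 := fun x => (abs_sub _ _).trans (by linarith [hq2 x, hv2 x])
  set W : EE N → ℝ := fun x => q x + zz x * (v x - q x) with hW
  have bW : BL W := bq.add (zz_BL.mul (bv.sub bq))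
  obtain ⟨KW, hKW⟩ := bW.lip
  have hgW : ∀ᵐ x, gradient W x = (1 - zz x) • gradient q x + zz x • gradient v x + (v x - q x) • gradient (zz : EE N → ℝ) x := by
    filter_upwards [grad_ae hq, grad_ae hvl, grad_ae (zz_lip (N := N))] with x h1 h2 h3
    rw [(hg_add h1 (hg_mul h3 (hg_sub h2 h1))).gradient]; module
  set ψ : EE N → ℝ := fun x => zz x * (q x - v x) with hψ
  obtain ⟨Kψ, hKψ⟩ := (zz_BL.mul (bq.sub bv)).lip
  have hψ0 : ∀ x, x ∉ closedBall (0:EE N) 1.95 → ψ x = 0 := fun x hx => by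
    rw [mem_closedBall_zero_iff, not_le] at hx
    simp only [hψ]; rw [zz_zero hx.le, zero_mul]
  have hgψ : ∀ᵐ x, gradient ψ x = zz x • (gradient q x - gradient v x) + (q x - v x) • gradient (zz : EE N → ℝ) x := by
    filter_upwards [grad_ae hq, grad_ae hvl, grad_ae (zz_lip (N := N))] with x h1 h2 h3
    rw [(hg_mul h3 (hg_sub h1 h2)).gradient]
  have cont_pow : Continuous fun ξ : EE N => ‖ξ‖ ^ p / p :=
    (continuous_norm.rpow_const fun _ => Or.inr (by linarith)).div_const _
  -- BM facts
  have bgq := BM.grad hq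
  have bgv := BM.grad hvl
  have bA := BM.compE (ph_cont (p := p) hε) bgq
  have bB := BM.compE (ph_cont (p := p) hε) bgv
  have bgW := BM.grad hKW
  have bE : BM fun x => |q x - v x| * ‖gradient (zz : EE N → ℝ) x‖ := ((bq.sub bv).BM.norm).mul (BM.grad zz_lip).norm
  have bS : BM fun x => ⟪gradient q x - gradient v x, Av p ε (gradient v x)⟫_ℝ := (bgq.sub bgv).inner (bgv.av hp1 hp2 hε)
  have bz := (zz_BL (N := N)).BM
  -- step 1
  have s1 : ∫ x in D, ph p ε (gradient q x) ≤ (∫ x in D, ph p ε (gradient W x)) + κ + ε * volume.real D := by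
    have h1 := ham W KW hKW (fun x hx => by
      rw [mem_ball_zero_iff, not_lt] at hx
      simp only [hW]; rw [zz_zero (by linarith)]; ring) (fun x => by
      simp only [hW]; rw [add_sub_cancel_left, abs_mul, abs_of_nonneg (zz_nonneg x), abs_sub_comm]
      nlinarith only [zz_le x, zz_nonneg x, hqv x, abs_nonneg (q x - v x)])
    have h2 : ∫ x in D, ph p ε (gradient q x) ≤ ∫ x in D, (‖gradient q x‖ ^ p / p + ε) := by
      refine integral_mono (bA.on hDt) (((BM.compE cont_pow bgq).add (BM.const ε)).on hDt) fun x => ?_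
      refine (ph_le_norm hp1 hp2 hε _).trans ?_
      have : ε ^ p / p ≤ ε := by
        rw [div_le_iff₀ (by linarith)]
        calc ε ^ p ≤ ε ^ (1:ℝ) := Real.rpow_le_rpow_of_exponent_ge hε hε1 hp1.le
          _ = ε := Real.rpow_one _
          _ ≤ _ := by nlinarith only [hε, hp1]
      linarith
    have i1 : IntegrableOn (fun x => ‖gradient q x‖ ^ p / p) D := (BM.compE cont_pow bgq).on hDt
    rw [integral_add i1 ((BM.const ε).on hDt), setIntegral_const, smul_eq_mul] at h2
    have h3 : ∫ x in D, ‖gradient W x‖ ^ p / p ≤ ∫ x in D, ph p ε (gradient W x) :=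
      integral_mono ((BM.compE cont_pow bgW).on hDt) ((BM.compE (ph_cont (p := p) hε) bgW).on hDt) fun x => ph_ge_norm hp1 hε _
    linarith
  -- step 2
  have i_A : IntegrableOn (fun x => ph p ε (gradient q x)) D := bA.on hDt
  have i_zAB : IntegrableOn (fun x => zz x * (ph p ε (gradient q x) - ph p ε (gradient v x))) D := (bz.mul (bA.sub bB)).on hDt
  have i_E : IntegrableOn (fun x => |q x - v x| * ‖gradient (zz : EE N → ℝ) x‖) D := bE.on hDt
  have i_S : IntegrableOn (fun x => zz x * ⟪gradient q x - gradient v x, Av p ε (gradient v x)⟫_ℝ) D := (bz.mul bS).on hDt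
  have s2 : ∫ x in D, ph p ε (gradient W x) ≤ ∫ x in D, ((ph p ε (gradient q x) -
      zz x * (ph p ε (gradient q x) - ph p ε (gradient v x))) + 2 * L * (|q x - v x| * ‖gradient (zz : EE N → ℝ) x‖)) := by
    refine integral_mono_ae ((BM.compE (ph_cont (p := p) hε) bgW).on hDt) ((i_A.sub i_zAB).add (i_E.const_mul _)) ?_
    filter_upwards [ae_restrict_of_ae hgW] with x hx
    have z0 := zz_nonneg x
    have z1 := zz_le x
    have e1 := ph_cvx hp1 hp2 hε (gradient q x) (gradient v x) z0 z1
    have e2 := ph_le hp1 hp2 hε (gradient W x) ((1 - zz x) • gradient q x + zz x • gradient v x)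
    have e3 : gradient W x - ((1 - zz x) • gradient q x + zz x • gradient v x) = (v x - q x) • gradient (zz : EE N → ℝ) x := by
      rw [hx]; abel
    have n1 : ‖gradient W x‖ ≤ 2 + L + 16 := by
      rw [hx]
      refine (norm_add_le _ _).trans (add_le_add ((norm_add_le _ _).trans (add_le_add ?_ ?_)) ?_)
      · rw [norm_smul, Real.norm_of_nonneg (by linarith)]; nlinarith only [hgq x, norm_nonneg (gradient q x), z0, z1]
      · rw [norm_smul, Real.norm_of_nonneg z0]; nlinarith only [hgv x, norm_nonneg (gradient v x), z0, z1]
      · rw [norm_smul, Real.norm_eq_abs, abs_sub_comm]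
        calc _ ≤ (4:ℝ) * 4 := mul_le_mul (hqv x) (hgz x) (norm_nonneg _) (by norm_num)
          _ = 16 := by norm_num
    have n2 := Av_norm_le' hp1 hp2 hε hε1 (gradient W x)
    have e4 : ⟪Av p ε (gradient W x), gradient W x - ((1 - zz x) • gradient q x + zz x • gradient v x)⟫_ℝ
        ≤ 2 * L * (|q x - v x| * ‖gradient (zz : EE N → ℝ) x‖) := by
      rw [e3]
      refine (real_inner_le_norm _ _).trans ?_
      rw [norm_smul, Real.norm_eq_abs, abs_sub_comm]
      gcongr; linarith
    linarith
  have i_B2 : IntegrableOn (fun x => ph p ε (gradient q x) - zz x * (ph p ε (gradient q x) - ph p ε (gradient v x))) D := i_A.sub i_zAB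
  rw [integral_add i_B2 (i_E.const_mul _), integral_sub i_A i_zAB, integral_const_mul] at s2
  -- step 3
  have s3 : 0 ≤ (∫ x in D, zz x * ⟪gradient q x - gradient v x, Av p ε (gradient v x)⟫_ℝ) +
      2 * L * ∫ x in D, |q x - v x| * ‖gradient (zz : EE N → ℝ) x‖ := by
    have h1 := el ψ Kψ ⟨hKψ, fun x hx => hψ0 x fun h => hx (closedBall_subset_closedBall (by norm_num) h)⟩
    have h2 : 0 ≤ ∫ x, mm lam x * (q x - v x) * ψ x := integral_nonneg fun x => by
      have := mm_pos (lam := lam) x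
      have h3 : mm lam x * (q x - v x) * ψ x = mm lam x * zz x * (q x - v x) ^ 2 := by simp only [hψ]; ring
      simp only [h3, Pi.zero_apply]
      have := zz_nonneg x
      positivity
    rw [← h1, ← setIntegral_eq_integral_of_forall_compl_eq_zero (s := D) (fun x hx => by
      rw [grad_zero_off hψ0 (fun h => hx (closedBall_subset_ball (by norm_num) h)), inner_zero_left])] at h2
    refine h2.trans ?_
    rw [← integral_const_mul, ← integral_add i_S (i_E.const_mul _)]
    refine integral_mono_ae (((BM.grad hKψ).inner (bgv.av hp1 hp2 hε)).on hDt) (i_S.add (i_E.const_mul _)) ?_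
    filter_upwards [ae_restrict_of_ae hgψ] with x hx
    rw [hx, inner_add_left, real_inner_smul_left, real_inner_smul_left]
    have n2 := Av_norm_le' hp1 hp2 hε hε1 (gradient v x)
    have e4 : (q x - v x) * ⟪gradient (zz : EE N → ℝ) x, Av p ε (gradient v x)⟫_ℝ ≤ 2 * L * (|q x - v x| * ‖gradient (zz : EE N → ℝ) x‖) := by
      refine (le_abs_self _).trans ?_
      rw [abs_mul]
      have := abs_real_inner_le_norm (gradient (zz : EE N → ℝ) x) (Av p ε (gradient v x))
      have h5 : ‖Av p ε (gradient v x)‖ ≤ 2 * L := by linarith [hgv x]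
      calc _ ≤ |q x - v x| * (‖gradient (zz : EE N → ℝ) x‖ * (2 * L)) := by gcongr; exact this.trans (by gcongr)
        _ = _ := by ring
    linarith
  -- step 4
  set c := (p - 1) / 2 * aw p ε L with hc
  have hc1 : (p - 1) / (4 * L) ≤ c := by
    have := aw_ge hp1 hp2 hε hε1 (L := L) (by linarith)
    rw [hc]
    calc (p - 1) / (4 * L) = (p - 1) / 2 * (1 / (2 * L)) := by field_simp; norm_num
      _ ≤ _ := by gcongr
  have i_G : IntegrableOn (fun x => ‖gradient q x - gradient v x‖ ^ 2) (ball (0:EE N) 1) := ((bgq.sub bgv).norm.sq).on measure_ball_lt_top.ne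
  have s4 : c * ∫ x in ball (0:EE N) 1, ‖gradient q x - gradient v x‖ ^ 2 ≤
      (∫ x in D, zz x * (ph p ε (gradient q x) - ph p ε (gradient v x))) -
        ∫ x in D, zz x * ⟪gradient q x - gradient v x, Av p ε (gradient v x)⟫_ℝ := by
    have hz2 : ∀ x, zz x * (c * ‖gradient q x - gradient v x‖ ^ 2) ≤ zz x * (ph p ε (gradient q x) - ph p ε (gradient v x)) - zz x * ⟪gradient q x - gradient v x, Av p ε (gradient v x)⟫_ℝ := by
      intro x
      rw [← mul_sub]
      apply mul_le_mul_of_nonneg_left _ (zz_nonneg x)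
      have := ph_conv hp1 hp2 hε (ξ := gradient q x) (ζ := gradient v x) (R := L) (by linarith [hgq x]) (hgv x)
      rw [real_inner_comm] at this
      rw [← hc] at this
      linarith
    have hc0 : 0 ≤ c := by have := aw_pos (p := p) hε L; positivity
    rw [← integral_const_mul, ← integral_sub i_zAB i_S]
    calc _ = ∫ x in ball (0:EE N) 1, zz x * (c * ‖gradient q x - gradient v x‖ ^ 2) := by
          refine setIntegral_congr_fun measurableSet_ball fun x hx => ?_
          rw [mem_ball_zero_iff] at hx
          rw [zz_one (by linarith), one_mul]
      _ ≤ ∫ x in D, zz x * (c * ‖gradient q x - gradient v x‖ ^ 2) := by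
          refine setIntegral_mono_set ((bz.mul ((BM.const c).mul (bgq.sub bgv).norm.sq)).on hDt) (Eventually.of_forall fun x => ?_) (ball_subset_ball (by norm_num)).eventuallyLE
          have := zz_nonneg x
          simp only [Pi.zero_apply]; positivity
      _ ≤ _ := integral_mono ((bz.mul ((BM.const c).mul (bgq.sub bgv).norm.sq)).on hDt) (i_zAB.sub i_S) hz2
  -- step 5
  have s5 : ∫ x in D, |q x - v x| * ‖gradient (zz : EE N → ℝ) x‖ ≤ 22 * Real.exp (-lam / 4) * V4 := by
    have bm : BM fun x => mm lam x * (q x - v x) ^ 2 := (mm_BM (by linarith)).mul (bq.sub bv).BM.sq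
    have i_m : Integrable fun x => mm lam x * (q x - v x) ^ 2 := bm.off (R := 4) fun x hx => by
      have h3 := hq3 x
      rw [mem_closedBall_zero_iff, not_le] at hx
      rw [max_eq_right (by linarith), mul_zero] at h3
      rw [abs_nonpos_iff.1 h3, hv4 x (by simpa using hx)]; simp
    have h2 : ∫ x in D, mm lam x * (q x - v x) ^ 2 ≤ 10 * V4 := (setIntegral_le_integral i_m (Eventually.of_forall fun x => by
      have := mm_pos (lam := lam) x
      simp only [Pi.zero_apply]; positivity)).trans hE
    calc _ ≤ ∫ x in D, 2 * Real.exp (-lam / 4) * (1 + mm lam x * (q x - v x) ^ 2) :=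
          integral_mono i_E (((BM.const (2 * Real.exp (-lam / 4))).mul ((BM.const (1:ℝ)).add bm)).on hDt) fun x => zz_err (by linarith) x _
      _ = 2 * Real.exp (-lam / 4) * (volume.real D + ∫ x in D, mm lam x * (q x - v x) ^ 2) := by
          rw [integral_const_mul, integral_add ((BM.const (1:ℝ)).on hDt) i_m.integrableOn, setIntegral_const, smul_eq_mul, mul_one]
      _ ≤ 2 * Real.exp (-lam / 4) * (V4 + 10 * V4) := by gcongr
      _ = _ := by ring
  set I := ∫ x in ball (0:EE N) 1, ‖gradient q x - gradient v x‖ ^ 2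
  have hI : 0 ≤ I := integral_nonneg fun x => by positivity
  set e := Real.exp (-lam / 4)
  have he : 0 < e := Real.exp_pos _
  have hκ : 0 ≤ κ := by have := ham q 2 hq (fun _ _ => rfl) (by simp); linarith
  have f1 : c * I ≤ κ + ε * V4 + 4 * L * (22 * e * V4) := by
    have := mul_le_mul_of_nonneg_left hDV hε.le
    have := mul_le_mul_of_nonneg_left s5 (by linarith : 0 ≤ 4 * L)
    linarith
  have f2 : (p - 1) / (4 * L) * I ≤ L * (1 + 88 * V4) * (κ + ε + e) := by
    refine (mul_le_mul_of_nonneg_right hc1 hI).trans (f1.trans ?_)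
    have e1 : κ ≤ L * κ := le_mul_of_one_le_left hκ (by linarith only [hL51])
    have e2 : ε * V4 ≤ L * (ε * V4) := by exact le_mul_of_one_le_left (mul_nonneg hε.le hV40) (by linarith only [hL51])
    have : 0 ≤ L * (ε + e) := by positivity
    have : 0 ≤ L * V4 * (88 * κ + 87 * ε) := by positivity
    linarith
  have f3 : I = 4 * L / (p - 1) * ((p - 1) / (4 * L) * I) := by field_simp
  rw [f3]
  calc _ ≤ 4 * L / (p - 1) * (L * (1 + 88 * V4) * (κ + ε + e)) := by gcongr
    _ = _ := by ring

end AP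

namespace AP
open Filter Topology
variable {N : ℕ} {p ε lam : ℝ} {q v w : EE N → ℝ} {K K' : NNReal}

lemma mm_one (hl : 0 ≤ lam) {x : EE N} (hx : ‖x‖ ≤ 1) : mm lam x ≤ Real.exp (-2 * lam) := by
  unfold mm
  apply Real.exp_le_exp.2
  have := min_le_left ‖x‖ 4
  nlinarith

lemma f_lip (hl : 1 ≤ lam) (hq : LipschitzWith 2 q) (hq2 : ∀ x, |q x| ≤ 2)
    (hv : ∀ x y, |v x - v y| ≤ (48 * lam + 3) * ‖x - y‖) (hv2 : ∀ x, |v x| ≤ 2) {x y : EE N} (hx : ‖x‖ ≤ 1) (hy : ‖y‖ ≤ 1) :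
    |mm lam x * (q x - v x) - mm lam y * (q y - v y)| ≤ 85 * Real.exp (-lam) * ‖x - y‖ := by
  have m1 := mm_one (by linarith : 0 ≤ lam) hx
  have m2 := mm_one (by linarith : 0 ≤ lam) hy
  have p1 := mm_pos (lam := lam) x
  have p2 := mm_pos (lam := lam) y
  set E := Real.exp (-2 * lam) with hE
  have hE0 : 0 < E := Real.exp_pos _
  have n0 := norm_nonneg (x - y)
  have h1 : |mm lam x - mm lam y| ≤ 8 * lam * ‖x - y‖ * E := by
    rcases le_total (4 * lam * ‖x - y‖) 1 with h | h
    · exact (mm_sub (by linarith) x y h).trans (by gcongr)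
    · rw [abs_le]; constructor <;> nlinarith
  have h2 : |(q x - v x) - (q y - v y)| ≤ (48 * lam + 5) * ‖x - y‖ := by
    have e1 : (q x - v x) - (q y - v y) = (q x - q y) - (v x - v y) := by ring
    have e2 : |q x - q y| ≤ 2 * ‖x - y‖ := by simpa using hq.norm_sub_le x y
    rw [e1]; refine (abs_sub _ _).trans ?_
    linarith [hv x y]
  have h3 : |q x - v x| ≤ 4 := (abs_sub _ _).trans (by linarith [hq2 x, hv2 x])
  have e1 : mm lam x * (q x - v x) - mm lam y * (q y - v y) =
    (mm lam x - mm lam y) * (q x - v x) + mm lam y * ((q x - v x) - (q y - v y)) := by ring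
  have hE2 : lam * E ≤ Real.exp (-lam) := by
    have : E = Real.exp (-lam) * Real.exp (-lam) := by rw [hE, ← Real.exp_add]; congr 1; ring
    have h5 : lam * Real.exp (-lam) ≤ 1 := by
      rw [Real.exp_neg, ← div_eq_mul_inv, div_le_one (Real.exp_pos _)]; linarith [Real.add_one_le_exp lam]
    rw [this]; nlinarith [Real.exp_pos (-lam)]
  rw [e1]
  calc _ ≤ |mm lam x - mm lam y| * |q x - v x| + mm lam y * |(q x - v x) - (q y - v y)| := by
        refine (abs_add_le _ _).trans ?_
        rw [abs_mul, abs_mul, abs_of_pos p2]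
    _ ≤ 8 * lam * ‖x - y‖ * E * 4 + E * ((48 * lam + 5) * ‖x - y‖) := by gcongr
    _ ≤ 85 * (lam * E) * ‖x - y‖ := by nlinarith [mul_nonneg hE0.le n0]
    _ ≤ _ := by gcongr

lemma pow_bd {t : ℝ} (ht0 : 0 < t) (ht1 : t < 1) : ∃ B > 0, ∀ n : ℕ, ((n:ℝ) + 1) ^ 2 * t ^ n ≤ B * Real.sqrt t ^ n := by
  set s := Real.sqrt t with hs
  have hs0 : 0 < s := Real.sqrt_pos.2 ht0
  have hs1 : s < 1 := by rw [hs, Real.sqrt_lt' one_pos]; simpa using ht1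
  have h := tendsto_pow_const_mul_const_pow_of_abs_lt_one 2 (abs_lt.2 ⟨by linarith, hs1⟩)
  obtain ⟨B, hB⟩ := h.bddAbove_range
  refine ⟨(max B 0 + 1) / s, by positivity, fun n => ?_⟩
  have h1 := hB ⟨n + 1, rfl⟩
  simp only [Nat.cast_add, Nat.cast_one] at h1
  have h2 : t ^ n = s ^ n * s ^ n := by rw [← mul_pow, Real.mul_self_sqrt ht0.le]
  rw [h2, ← mul_assoc]
  gcongr
  rw [le_div_iff₀ hs0, mul_assoc, ← pow_succ]
  exact h1.trans (by linarith [le_max_left B 0])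

set_option maxHeartbeats 1000000 in
lemma OS2 (hN : 1 ≤ N) (hp1 : 1 < p) (hp2 : p < 2) : ∃ q0 C : ℝ, 0 < q0 ∧ q0 < 1 ∧ 0 < C ∧ ∀ (n : ℕ) (κ : ℝ) (q : EE N → ℝ),
    LipschitzWith 2 q → (∀ x, |q x| ≤ 2) → (∀ x, |q x| ≤ 2 * max (3 - ‖x‖) 0) →
    (∀ (W : EE N → ℝ) (K : NNReal), LipschitzWith K W → (∀ x, x ∉ ball (0:EE N) 2 → W x = q x) → (∀ x, |W x - q x| ≤ 4) →
      ∫ x in ball (0:EE N) 2, ‖gradient q x‖ ^ p / p ≤ (∫ x in ball (0:EE N) 2, ‖gradient W x‖ ^ p / p) + κ) →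
    κ ≤ (1/4) ^ (n * (N + 1)) →
    ∃ ξ : EE N, ∫ x in ball (0:EE N) ((1/4) ^ n), ‖gradient q x - ξ‖ ^ 2 ≤ C * q0 ^ n * ((1/4) ^ n) ^ N := by
  obtain ⟨C1, hC1, H1⟩ := OS1 (N := N) hN hp1 hp2
  obtain ⟨σ0, θ, C2, hσ0, hθ0, hθ1, hC2, H2⟩ := lemP (N := N) hN hp1 hp2
  set V1 := volume.real (ball (0:EE N) 1) with hV1
  have hV10 : 0 ≤ V1 := measureReal_nonneg
  set t := max θ (1/4) with ht
  have ht0 : 0 < t := lt_max_of_lt_left hθ0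
  have ht1 : t < 1 := max_lt hθ1 (by norm_num)
  obtain ⟨B, hB, HB⟩ := pow_bd ht0 ht1
  set lam0 := 85 / σ0 + 1 with hlam0
  have hlam00 : 1 ≤ lam0 := by have : 0 < 85 / σ0 := by positivity
                               linarith
  set L0 := 48 * lam0 + 3 + 384 * ((N:ℝ) + 1) with hL0
  have hL00 : 0 < L0 := by positivity
  refine ⟨Real.sqrt t, L0 ^ 2 * (6 * C1 + 8 * C2 ^ 2 * V1) * B, Real.sqrt_pos.2 ht0, ?_, by positivity, ?_⟩
  · rw [Real.sqrt_lt' one_pos]; simpa using ht1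
  intro n κ q hq hq2 hq3 ham hκ
  set lam := lam0 + 8 * ((N:ℝ) + 1) * n with hlam
  have hnn : (0:ℝ) ≤ n := by positivity
  have hl : 1 ≤ lam := by have : 0 ≤ 8 * ((N:ℝ) + 1) * n := by positivity
                          linarith
  set ε : ℝ := (1/4) ^ (n * (N + 1)) with hε
  have hε0 : 0 < ε := by positivity
  have hε1 : ε ≤ 1 := pow_le_one₀ (by norm_num) (by norm_num)
  obtain ⟨v, hv, hv2, el, hI⟩ := H1 ε lam κ q hε0 hε1 hl hq hq2 hq3 ham
  set L := 48 * lam + 3 with hL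
  have hL1 : 1 ≤ L := by linarith
  have hLL : L ≤ L0 * (n + 1) := by
    have : (0:ℝ) ≤ (48 * lam0 + 3) * n + 384 * ((N:ℝ) + 1) := by positivity
    rw [hL, hL0, hlam]; linarith
  have hvl : LipschitzWith (Real.toNNReal L) v := by
    refine LipschitzWith.of_dist_le_mul fun x y => ?_
    rw [dist_eq_norm, dist_eq_norm, Real.coe_toNNReal _ (by linarith)]; exact hv x y
  have hgv : ∀ x, ‖gradient v x‖ ≤ L := fun x => by
    have := grad_le hvl x; rwa [Real.coe_toNNReal _ (by linarith)] at this
  have hr1 : ((1/4:ℝ)) ^ n ≤ 1 := pow_le_one₀ (by norm_num) (by norm_num)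
  obtain ⟨S, hgr⟩ := rescale (p := p) (ε := ε) (f := fun x => mm lam x * (q x - v x)) (Λ := 85 * Real.exp (-lam)) (v := v)
    (ρ := 1) (m := L) one_pos (by linarith) ⟨_, hvl⟩ (Eventually.of_forall fun x _ => hgv x)
    (mm_cont.mul (hq.continuous.sub hvl.continuous))
    (fun x hx y hy => f_lip hl hq hq2 hv hv2 (by simpa using (mem_ball_zero_iff.1 hx).le) (by simpa using (mem_ball_zero_iff.1 hy).le))
    (fun ψ K R h1 h2 h3 => el ψ K ⟨h1, fun x hx => h3 x fun h => hx (closedBall_subset_closedBall (by linarith) h)⟩)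
  have hΛ : 1 ^ 2 * L ^ (1 - p) * (85 * Real.exp (-lam)) ≤ σ0 := by
    have e1 : L ^ (1 - p) ≤ 1 := Real.rpow_le_one_of_one_le_of_nonpos hL1 (by linarith)
    have e2 : 85 * Real.exp (-lam) ≤ σ0 := by
      rw [Real.exp_neg, ← div_eq_mul_inv, div_le_iff₀ (Real.exp_pos _)]
      have : 85 / σ0 ≤ Real.exp lam := by
        have : 0 ≤ 8 * ((N:ℝ) + 1) * n := by positivity
        linarith [Real.add_one_le_exp lam]
      rw [div_le_iff₀ hσ0] at this; linarith
    have e3 : 0 ≤ L ^ (1 - p) := by positivity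
    have e4 := Real.exp_pos (-lam)
    rw [one_pow, one_mul]
    exact (mul_le_mul_of_nonneg_right e1 (by positivity)).trans (by linarith)
  obtain ⟨ξ, hξ⟩ := H2 n (ε / L) _ _ _ (by positivity) ((div_le_one (by linarith)).2 (by linarith)) S hΛ
  have ex : Real.exp (-lam / 4) ≤ ε := by
    have h1 : Real.exp (-lam / 4) ≤ Real.exp (-2) ^ (n * (N + 1)) := by
      rw [← Real.exp_nat_mul]; apply Real.exp_le_exp.2; push_cast; rw [hlam]; linarith
    refine h1.trans ?_
    rw [hε]; gcongr
    have : Real.exp (-2) = (Real.exp 1 ^ 2)⁻¹ := by rw [← Real.exp_nat_mul, ← Real.exp_neg]; norm_num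
    rw [this, one_div]
    apply inv_anti₀ (by norm_num)
    have := Real.add_one_le_exp (1:ℝ)
    calc (4:ℝ) = 2 ^ 2 := by norm_num
      _ ≤ _ := by gcongr; linarith
  set r : ℝ := (1/4) ^ n with hr
  have hr0 : 0 < r := by positivity
  have hεr : ε = r ^ N * r := by rw [hε, hr, ← pow_succ, ← pow_mul]
  have hrt : r ≤ t ^ n := by rw [hr]; gcongr; exact le_max_right _ _
  have htn : 0 < t ^ n := by positivity
  have htn1 : t ^ n ≤ 1 := pow_le_one₀ ht0.le ht1.le
  refine ⟨L • ξ, ?_⟩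
  set Br := ball (0:EE N) r
  have hBt : volume Br ≠ ⊤ := measure_ball_lt_top.ne
  have hVB : volume.real Br = r ^ N * V1 := by
    have := Measure.addHaar_ball_mul_of_pos (volume : Measure (EE N)) (0:EE N) hr0 1
    rw [mul_one] at this
    rw [measureReal_def, this, ENNReal.toReal_mul, ENNReal.toReal_ofReal (by positivity)]; simp [hV1, measureReal_def]
  have bgq := BM.grad hq
  have bgv := BM.grad hvl
  have i1 : IntegrableOn (fun x => 2 * ‖gradient q x - gradient v x‖ ^ 2) Br := ((BM.const (2:ℝ)).mul (bgq.sub bgv).norm.sq).on hBt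
  have k1 : ∫ x in Br, ‖gradient q x - L • ξ‖ ^ 2 ≤ ∫ x in Br, (2 * ‖gradient q x - gradient v x‖ ^ 2 + 2 * (C2 * (2 * L * t ^ n)) ^ 2) := by
    refine integral_mono_ae (((bgq.sub (BM.const (L • ξ))).norm.sq).on hBt) (i1.add ((BM.const _).on hBt)) ?_
    filter_upwards [ae_restrict_of_ae hξ, ae_restrict_mem measurableSet_ball] with x hx hxB
    have h1 := hx hxB
    rw [hgr, one_smul] at h1
    have h2 : ‖gradient v x - L • ξ‖ ≤ C2 * (2 * L * t ^ n) := by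
      have e1 : gradient v x - L • ξ = L • (L⁻¹ • gradient v x - ξ) := by
        rw [smul_sub, smul_smul, mul_inv_cancel₀ (by linarith), one_smul]
      rw [e1, norm_smul, Real.norm_of_nonneg (by linarith)]
      calc _ ≤ L * (C2 * (θ ^ n + ε / L)) := by gcongr
        _ = C2 * (L * θ ^ n + ε) := by field_simp
        _ ≤ C2 * (L * t ^ n + L * t ^ n) := by
            have g1 : θ ^ n ≤ t ^ n := by gcongr; exact le_max_left _ _
            have g2 : ε ≤ r := by rw [hεr]; exact mul_le_of_le_one_left hr0.le (pow_le_one₀ hr0.le hr1)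
            have g3 : ε ≤ L * t ^ n := (g2.trans hrt).trans (le_mul_of_one_le_left htn.le hL1)
            gcongr
        _ = _ := by ring
    have h3 : ‖gradient q x - L • ξ‖ ≤ ‖gradient q x - gradient v x‖ + ‖gradient v x - L • ξ‖ := norm_sub_le_norm_sub_add_norm_sub _ _ _
    have h4 : ‖gradient q x - L • ξ‖ ≤ ‖gradient q x - gradient v x‖ + C2 * (2 * L * t ^ n) := by linarith
    calc ‖gradient q x - L • ξ‖ ^ 2 ≤ (‖gradient q x - gradient v x‖ + C2 * (2 * L * t ^ n)) ^ 2 := by gcongr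
      _ ≤ _ := add_sq_le.trans (by rw [mul_add])
  rw [integral_add i1 ((BM.const _).on hBt), setIntegral_const, smul_eq_mul, integral_const_mul, hVB] at k1
  have k2 : ∫ x in Br, ‖gradient q x - gradient v x‖ ^ 2 ≤ C1 * L ^ 2 * (3 * ε) := by
    calc _ ≤ ∫ x in ball (0:EE N) 1, ‖gradient q x - gradient v x‖ ^ 2 :=
          setIntegral_mono_set (((bgq.sub bgv).norm.sq).on measure_ball_lt_top.ne) (Eventually.of_forall fun x => by
            simp only [Pi.zero_apply]; positivity) (ball_subset_ball hr1).eventuallyLE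
      _ ≤ _ := hI
      _ ≤ _ := by gcongr; linarith
  calc _ ≤ 2 * (C1 * L ^ 2 * (3 * (r ^ N * t ^ n))) + r ^ N * V1 * (2 * (C2 * (2 * L)) ^ 2 * t ^ n) := by
        refine k1.trans (add_le_add ?_ ?_)
        · refine mul_le_mul_of_nonneg_left (k2.trans ?_) zero_le_two
          rw [hεr]; gcongr
        · have : 2 * (C2 * (2 * L * t ^ n)) ^ 2 = 2 * (C2 * (2 * L)) ^ 2 * (t ^ n * t ^ n) := by ring
          rw [this]; gcongr; exact mul_le_of_le_one_left htn.le htn1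
    _ = (6 * C1 + 8 * C2 ^ 2 * V1) * r ^ N * (L ^ 2 * t ^ n) := by ring
    _ ≤ (6 * C1 + 8 * C2 ^ 2 * V1) * r ^ N * (L0 ^ 2 * (B * Real.sqrt t ^ n)) := by
        have : L ^ 2 * t ^ n ≤ L0 ^ 2 * (B * Real.sqrt t ^ n) := by
          calc _ ≤ (L0 * (n + 1)) ^ 2 * t ^ n := by gcongr
            _ = L0 ^ 2 * ((n + 1) ^ 2 * t ^ n) := by ring
            _ ≤ _ := mul_le_mul_of_nonneg_left (HB n) (by positivity)
        gcongr
    _ = _ := by ring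

end AP

namespace AP
open Filter Topology
variable {N : ℕ} {p β : ℝ} {q v w U : EE N → ℝ} {K K' : NNReal}

lemma grad_aff (v : EE N → ℝ) (a c ρ : ℝ) (z y : EE N) :
    gradient (fun y => a + c * v (z + ρ • y)) y = (c * ρ) • gradient v (z + ρ • y) := by
  have h1 := grad_scale (fun y => v (z + y)) ρ c y
  have h2 : gradient (fun y => v (z + y)) (ρ • y) = gradient v (z + ρ • y) := by
    unfold gradient; rw [fderiv_comp_add_left]
  have h3 : gradient (fun y => a + c * v (z + ρ • y)) y = gradient (fun y => c * v (z + ρ • y)) y := by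
    unfold gradient; rw [fderiv_const_add]
  rw [h3, h1, h2]

lemma mem_ball_aff {z y : EE N} {R ρ : ℝ} (hρ : 0 < ρ) : z + ρ • y ∈ ball z (ρ * R) ↔ y ∈ ball (0:EE N) R := by
  rw [mem_ball_iff_norm, mem_ball_zero_iff, add_sub_cancel_left, norm_smul, Real.norm_of_nonneg hρ.le]
  exact mul_lt_mul_iff_right₀ hρ

lemma mem_cball_aff {z y : EE N} {R ρ : ℝ} (hρ : 0 < ρ) : z + ρ • y ∈ closedBall z (ρ * R) ↔ y ∈ closedBall (0:EE N) R := by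
  rw [mem_closedBall_iff_norm, mem_closedBall_zero_iff, add_sub_cancel_left, norm_smul, Real.norm_of_nonneg hρ.le]
  exact mul_le_mul_iff_right₀ hρ

lemma cov (g : EE N → ℝ) (z : EE N) {R ρ : ℝ} (hρ : 0 < ρ) :
    ∫ x in ball z (ρ * R), g x = ρ ^ N * ∫ y in ball (0:EE N) R, g (z + ρ • y) := by
  rw [← integral_indicator measurableSet_ball, ← integral_indicator measurableSet_ball]
  have h1 : (fun y => (ball (0:EE N) R).indicator (fun y => g (z + ρ • y)) y) = fun y => (ball z (ρ * R)).indicator g (z + ρ • y) := by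
    funext y
    by_cases hy : y ∈ ball (0:EE N) R
    · rw [indicator_of_mem hy, indicator_of_mem ((mem_ball_aff hρ).2 hy)]
    · rw [indicator_of_notMem hy, indicator_of_notMem (fun h => hy ((mem_ball_aff hρ).1 h))]
  rw [h1, Measure.integral_comp_smul volume (fun w => (ball z (ρ * R)).indicator g (z + w)) ρ,
    integral_add_left_eq_self, finrank_euclideanSpace_fin, abs_of_pos (by positivity), smul_eq_mul, ← mul_assoc,
    mul_inv_cancel₀ (by positivity), one_mul]

structure AM (p β : ℝ) (U : EE N → ℝ) : Prop where
  dif : ∀ x ∈ ball (0:EE N) 1, DifferentiableAt ℝ U x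
  cont : ContinuousOn (gradient U) (ball (0:EE N) 1)
  bd : ∀ x ∈ ball (0:EE N) 1, ‖gradient U x‖ ≤ 1
  min : ∀ (z : EE N) (ρ : ℝ), 0 < ρ → closedBall z (ρ * 2) ⊆ ball (0:EE N) 1 → ∀ (W : EE N → ℝ) (K : NNReal),
    LipschitzOnWith K W (closedBall z (ρ * 2)) → (∀ x ∈ sphere z (ρ * 2), W x = U x) →
    (∀ x ∈ closedBall z (ρ * 2), |W x - U x| ≤ 4 * ρ) →
    ∫ x in ball z (ρ * 2), ‖gradient U x‖ ^ p / p ≤ (∫ x in ball z (ρ * 2), ‖gradient W x‖ ^ p / p) + ρ ^ N * ρ ^ β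

lemma AM.lip (h : AM p β U) : LipschitzOnWith 1 U (ball (0:EE N) 1) := by
  refine (convex_ball (0:EE N) 1).lipschitzOnWith_of_nnnorm_fderiv_le (𝕜 := ℝ) (fun x hx => h.dif x hx) fun x hx => ?_
  rw [← NNReal.coe_le_coe, coe_nnnorm, ← norm_grad]; exact h.bd x hx

noncomputable def cc (x : EE N) : ℝ := min 2 (2 * max (3 - ‖x‖) 0)

lemma cc_nonneg (x : EE N) : 0 ≤ cc x := le_min (by norm_num) (by positivity)

lemma cc_lip : LipschitzWith 2 (cc : EE N → ℝ) := by
  unfold cc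
  apply LipschitzWith.const_min
  refine LipschitzWith.of_dist_le_mul fun x y => ?_
  rw [dist_eq_norm, dist_eq_norm, Real.norm_eq_abs, ← mul_sub, abs_mul]
  have h1 := abs_norm_sub_norm_le x y
  have h2 := abs_sup_sub_sup_le_abs (3 - ‖x‖) (3 - ‖y‖) 0
  have h3 : |3 - ‖x‖ - (3 - ‖y‖)| = |‖x‖ - ‖y‖| := by rw [← abs_neg]; congr 1; ring
  rw [h3] at h2
  norm_num
  exact h2.trans h1

lemma camp1 (hN : 1 ≤ N) (hp1 : 1 < p) (hp2 : p < 2) : ∃ q0 C : ℝ, 0 < q0 ∧ q0 < 1 ∧ 0 < C ∧ ∀ (β : ℝ) (U : EE N → ℝ),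
    AM p β U → ∀ (z : EE N) (ρ : ℝ) (n : ℕ), 0 < ρ → closedBall z (ρ * 2) ⊆ ball (0:EE N) 1 → ρ ^ β ≤ (1/4) ^ (n * (N + 1)) →
    ∃ ξ : EE N, ∫ x in ball z (ρ * (1/4) ^ n), ‖gradient U x - ξ‖ ^ 2 ≤ C * q0 ^ n * (ρ * (1/4) ^ n) ^ N := by
  obtain ⟨q0, C, h0, h1, hC, H⟩ := OS2 (N := N) hN hp1 hp2
  refine ⟨q0, C, h0, h1, hC, fun β U hU z ρ n hρ hz hn => ?_⟩
  set U0 : EE N → ℝ := fun y => -(ρ⁻¹ * U z) + ρ⁻¹ * U (z + ρ • y) with hU0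
  have hin : ∀ y ∈ closedBall (0:EE N) 2, z + ρ • y ∈ ball (0:EE N) 1 := fun y hy => hz ((mem_cball_aff hρ).2 hy)
  have hzz : U0 0 = 0 := by simp [hU0]
  have hl0 : LipschitzOnWith 1 U0 (closedBall (0:EE N) 2) := by
    refine LipschitzOnWith.of_dist_le_mul fun x hx y hy => ?_
    have := hU.lip.dist_le_mul _ (hin x hx) _ (hin y hy)
    rw [dist_eq_norm, dist_eq_norm, add_sub_add_left_eq_sub, ← smul_sub, norm_smul, Real.norm_of_nonneg hρ.le] at this
    have e : U0 x - U0 y = ρ⁻¹ * (U (z + ρ • x) - U (z + ρ • y)) := by simp only [hU0]; ring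
    rw [dist_eq_norm, dist_eq_norm, e, norm_mul, Real.norm_of_nonneg (by positivity : 0 ≤ ρ⁻¹), inv_mul_le_iff₀ hρ]
    simpa using this
  obtain ⟨Ub, hUb, hUe⟩ := hl0.extend_real
  set q : EE N → ℝ := fun x => max (min (Ub x) (cc x)) (-cc x) with hq
  have hqc : ∀ x, |q x| ≤ cc x := fun x => by
    have := cc_nonneg x
    rw [abs_le]; exact ⟨le_max_right _ _, max_le (min_le_right _ _) (by linarith)⟩
  have hql : LipschitzWith 2 q := by
    have := ((hUb.weaken (by norm_num : (1:NNReal) ≤ 2)).min cc_lip).max (cc_lip (N := N)).neg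
    simpa using this
  have hqU : ∀ x ∈ closedBall (0:EE N) 2, q x = U0 x := fun x hx => by
    have e1 : |U0 x| ≤ 2 := by
      have := hl0.dist_le_mul x hx 0 (by simp)
      rw [hzz, dist_zero_right, dist_zero_right] at this
      rw [mem_closedBall_zero_iff] at hx
      simp at this; linarith
    have e2 : cc x = 2 := by
      rw [mem_closedBall_zero_iff] at hx
      unfold cc; rw [max_eq_left (by linarith), min_eq_left (by linarith)]
    rw [abs_le] at e1
    simp only [hq]; rw [← hUe hx, e2, min_eq_left e1.2, max_eq_left e1.1]
  have hqg : ∀ x ∈ ball (0:EE N) 2, gradient q x = gradient U (z + ρ • x) := fun x hx => by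
    have : q =ᶠ[𝓝 x] U0 := by
      filter_upwards [isOpen_ball.mem_nhds hx] with y hy using hqU y (ball_subset_closedBall hy)
    rw [this.gradient_eq, hU0, grad_aff, inv_mul_cancel₀ hρ.ne', one_smul]
  have ham : ∀ (W : EE N → ℝ) (K : NNReal), LipschitzWith K W → (∀ x, x ∉ ball (0:EE N) 2 → W x = q x) → (∀ x, |W x - q x| ≤ 4) →
      ∫ x in ball (0:EE N) 2, ‖gradient q x‖ ^ p / p ≤ (∫ x in ball (0:EE N) 2, ‖gradient W x‖ ^ p / p) + ρ ^ β := by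
    intro W K hW hWq hW4
    set W' : EE N → ℝ := fun x => U z + ρ * W (-(ρ⁻¹ • z) + ρ⁻¹ • x) with hW'
    have harg : ∀ y, -(ρ⁻¹ • z) + ρ⁻¹ • (z + ρ • y) = y := fun y => by
      rw [smul_add, smul_smul, inv_mul_cancel₀ hρ.ne', one_smul]; abel
    have hpar : ∀ x, x = z + ρ • (-(ρ⁻¹ • z) + ρ⁻¹ • x) := fun x => by
      rw [smul_add, smul_neg, smul_smul, smul_smul, mul_inv_cancel₀ hρ.ne', one_smul, one_smul]; abel
    have hW'e : ∀ y, W' (z + ρ • y) = U z + ρ * W y := fun y => by simp only [hW', harg]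
    have hUe' : ∀ y ∈ closedBall (0:EE N) 2, U (z + ρ • y) = U z + ρ * q y := fun y hy => by
      rw [hqU y hy]; simp only [hU0]; field_simp; ring
    have := hU.min z ρ hρ hz W' K ?_ ?_ ?_
    · rw [cov _ _ hρ, cov _ _ hρ, ← mul_add] at this
      have := le_of_mul_le_mul_left this (by positivity)
      have e1 : ∫ y in ball (0:EE N) 2, ‖gradient U (z + ρ • y)‖ ^ p / p = ∫ y in ball (0:EE N) 2, ‖gradient q y‖ ^ p / p :=
        setIntegral_congr_fun measurableSet_ball fun y hy => by simp only [hqg y hy]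
      have e2 : ∀ y, gradient W' (z + ρ • y) = gradient W y := fun y => by
        rw [hW', grad_aff, mul_inv_cancel₀ hρ.ne', one_smul, harg]
      simp only [e2] at this
      rwa [e1] at this
    · refine LipschitzOnWith.of_dist_le_mul fun x _ y _ => ?_
      have := hW.dist_le_mul (-(ρ⁻¹ • z) + ρ⁻¹ • x) (-(ρ⁻¹ • z) + ρ⁻¹ • y)
      rw [dist_eq_norm, dist_eq_norm, add_sub_add_left_eq_sub, ← smul_sub, norm_smul, Real.norm_of_nonneg (by positivity : 0 ≤ ρ⁻¹)] at this
      have e : W' x - W' y = ρ * (W (-(ρ⁻¹ • z) + ρ⁻¹ • x) - W (-(ρ⁻¹ • z) + ρ⁻¹ • y)) := by simp only [hW']; ring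
      rw [dist_eq_norm, dist_eq_norm, e, norm_mul, Real.norm_of_nonneg hρ.le]
      calc _ ≤ ρ * (K * (ρ⁻¹ * ‖x - y‖)) := by gcongr
        _ = _ := by field_simp
    · intro x hx
      have hx2 : ρ⁻¹ * ‖x - z‖ = 2 := by
        rw [mem_sphere_iff_norm] at hx; rw [hx]; field_simp
      have hn2 : ‖-(ρ⁻¹ • z) + ρ⁻¹ • x‖ = 2 := by
        rw [neg_add_eq_sub, ← smul_sub, norm_smul, Real.norm_of_nonneg (by positivity), hx2]
      rw [hpar x, hW'e, hUe' _ (by rw [mem_closedBall_zero_iff, hn2]), hWq _ (by rw [mem_ball_zero_iff, hn2]; simp)]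
    · intro x hx
      have hy := hx
      rw [hpar x, mem_cball_aff hρ] at hy
      rw [hpar x, hW'e, hUe' _ hy]
      have := hW4 (-(ρ⁻¹ • z) + ρ⁻¹ • x)
      rw [add_sub_add_left_eq_sub, ← mul_sub, abs_mul, abs_of_pos hρ]
      nlinarith
  obtain ⟨ξ, hξ⟩ := H n (ρ ^ β) q hql (fun x => (hqc x).trans (min_le_left _ _)) (fun x => (hqc x).trans (min_le_right _ _)) ham hn
  · refine ⟨ξ, ?_⟩
    rw [cov _ _ hρ]
    have e1 : ∫ y in ball (0:EE N) ((1/4) ^ n), ‖gradient U (z + ρ • y) - ξ‖ ^ 2 = ∫ y in ball (0:EE N) ((1/4) ^ n), ‖gradient q y - ξ‖ ^ 2 := by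
      refine setIntegral_congr_fun measurableSet_ball fun y hy => ?_
      have : ((1/4:ℝ)) ^ n ≤ 1 := pow_le_one₀ (by norm_num) (by norm_num)
      simp only [hqg y (ball_subset_ball (by linarith) hy)]
    rw [e1, mul_pow]
    calc _ ≤ ρ ^ N * (C * q0 ^ n * ((1/4) ^ n) ^ N) := by gcongr
      _ = _ := by ring

end AP

namespace AP
open Filter Topology
variable {N : ℕ} {p β : ℝ} {U : EE N → ℝ} {G : EE N → EE N}

lemma vol_ball (z : EE N) {r : ℝ} (hr : 0 < r) : volume.real (ball z r) = r ^ N * volume.real (ball (0:EE N) 1) := by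
  have := Measure.addHaar_ball_mul_of_pos (volume : Measure (EE N)) z hr 1
  rw [mul_one] at this
  rw [measureReal_def, this, ENNReal.toReal_mul, ENNReal.toReal_ofReal (by positivity)]; simp [measureReal_def]

lemma avg {B : Set (EE N)} (hB : volume B ≠ ⊤) (a b : EE N) (ha : IntegrableOn (fun x => ‖G x - a‖ ^ 2) B)
    (hb : IntegrableOn (fun x => ‖G x - b‖ ^ 2) B) :
    volume.real B * ‖a - b‖ ^ 2 ≤ 2 * (∫ x in B, ‖G x - a‖ ^ 2) + 2 * ∫ x in B, ‖G x - b‖ ^ 2 := by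
  rw [← integral_const_mul, ← integral_const_mul, ← integral_add (ha.const_mul 2) (hb.const_mul 2), ← smul_eq_mul, ← setIntegral_const]
  refine integral_mono ((BM.const (‖a - b‖ ^ 2)).on hB) ((ha.const_mul 2).add (hb.const_mul 2)) fun x => ?_
  have h : ‖a - b‖ ≤ ‖G x - a‖ + ‖G x - b‖ := by
    have := norm_sub_le_norm_sub_add_norm_sub a (G x) b
    rwa [norm_sub_rev a (G x)] at this
  calc ‖a - b‖ ^ 2 ≤ (‖G x - a‖ + ‖G x - b‖) ^ 2 := by gcongr
    _ ≤ _ := add_sq_le.trans (by rw [mul_add])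

lemma camp {μ s C : ℝ} (hμ0 : 0 < μ) (hμ : μ ≤ 1/4) (hs0 : 0 < s) (hs1 : s < 1) (hC : 0 < C) :
    ∃ C' > 0, ∀ G : EE N → EE N, ContinuousOn G (ball (0:EE N) 1) →
    (∀ z ∈ ball (0:EE N) (1/2), ∀ n : ℕ, 1 ≤ n → ∃ ξ, ∫ x in ball z (μ ^ n), ‖G x - ξ‖ ^ 2 ≤ C * (s ^ n) ^ 2 * (μ ^ n) ^ N) →
    ∀ x ∈ ball (0:EE N) (1/2), ∀ y ∈ ball (0:EE N) (1/2), ∀ n : ℕ, 1 ≤ n → ‖x - y‖ ≤ μ ^ (n + 1) → ‖G x - G y‖ ≤ C' * s ^ n := by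
  set V1 := volume.real (ball (0:EE N) 1) with hV1
  have hV : 0 < V1 := by
    rw [hV1, measureReal_def]; exact ENNReal.toReal_pos (measure_ball_pos _ _ one_pos).ne' measure_ball_lt_top.ne
  set D := Real.sqrt (4 * C / (V1 * μ ^ N)) with hD
  have hD0 : 0 < D := Real.sqrt_pos.2 (by positivity)
  have h1s : 0 < 1 - s := by linarith
  refine ⟨D + 2 * (D / (1 - s)), by positivity, fun G hG H => ?_⟩
  have hsub : ∀ z ∈ ball (0:EE N) (1/2), ∀ n : ℕ, 1 ≤ n → closedBall z (μ ^ n) ⊆ ball (0:EE N) 1 := by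
    intro z hz n hn
    have : μ ^ n ≤ 1/4 := (pow_le_of_le_one hμ0.le (by linarith) (by omega)).trans hμ
    apply closedBall_subset_ball'
    rw [mem_ball] at hz; linarith
  have hint : ∀ z ∈ ball (0:EE N) (1/2), ∀ n : ℕ, 1 ≤ n → ∀ a, IntegrableOn (fun x => ‖G x - a‖ ^ 2) (ball z (μ ^ n)) := by
    intro z hz n hn a
    have : ContinuousOn (fun x => ‖G x - a‖ ^ 2) (closedBall z (μ ^ n)) :=
      (((hG.mono (hsub z hz n hn)).sub continuousOn_const).norm).pow 2
    exact (this.integrableOn_compact (isCompact_closedBall _ _)).mono_set ball_subset_closedBall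
  choose! ξ hξ using H
  have key : ∀ x ∈ ball (0:EE N) (1/2), ∀ y ∈ ball (0:EE N) (1/2), ∀ n : ℕ, 1 ≤ n → ‖x - y‖ ≤ μ ^ (n + 1) →
      ‖ξ x n - ξ y (n + 1)‖ ≤ D * s ^ n := by
    intro x hx y hy n hn hxy
    have hμn : 0 < μ ^ n := by positivity
    have hss : ball y (μ ^ (n + 1)) ⊆ ball x (μ ^ n) := by
      apply ball_subset_ball'
      rw [dist_eq_norm, norm_sub_rev]
      rw [pow_succ] at hxy ⊢
      nlinarith
    have e1 := avg (G := G) (B := ball y (μ ^ (n + 1))) measure_ball_lt_top.ne (ξ x n) (ξ y (n + 1))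
      ((hint x hx n hn _).mono_set hss) (hint y hy (n + 1) (by omega) _)
    have e2 : ∫ w in ball y (μ ^ (n + 1)), ‖G w - ξ x n‖ ^ 2 ≤ C * (s ^ n) ^ 2 * (μ ^ n) ^ N :=
      (setIntegral_mono_set (hint x hx n hn _) (Eventually.of_forall fun w => by
        simp only [Pi.zero_apply]; positivity) hss.eventuallyLE).trans (hξ x hx n hn)
    have e3 : ∫ w in ball y (μ ^ (n + 1)), ‖G w - ξ y (n + 1)‖ ^ 2 ≤ C * (s ^ n) ^ 2 * (μ ^ n) ^ N := by
      refine (hξ y hy (n + 1) (by omega)).trans ?_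
      gcongr C * ?_ ^ 2 * ?_ ^ N
      · exact pow_le_pow_of_le_one hs0.le hs1.le (by omega)
      · exact pow_le_pow_of_le_one hμ0.le (by linarith) (by omega)
    rw [vol_ball y (by positivity)] at e1
    have e4 : ‖ξ x n - ξ y (n + 1)‖ ^ 2 ≤ (D * s ^ n) ^ 2 := by
      rw [mul_pow, hD, Real.sq_sqrt (by positivity), div_mul_eq_mul_div, le_div_iff₀ (by positivity)]
      have : (μ ^ (n + 1)) ^ N = (μ ^ n) ^ N * μ ^ N := by rw [pow_succ, mul_pow]
      rw [this] at e1
      have h5 : (μ ^ n) ^ N * (‖ξ x n - ξ y (n + 1)‖ ^ 2 * (V1 * μ ^ N)) ≤ (μ ^ n) ^ N * (4 * C * (s ^ n) ^ 2) := by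
        calc _ = (μ ^ n) ^ N * μ ^ N * V1 * ‖ξ x n - ξ y (n + 1)‖ ^ 2 := by ring
          _ ≤ _ := e1
          _ ≤ _ := by linarith
      exact le_of_mul_le_mul_left h5 (by positivity)
    exact (sq_le_sq₀ (norm_nonneg _) (by positivity)).1 e4
  have lim : ∀ x ∈ ball (0:EE N) (1/2), Tendsto (fun n => ξ x (n + 1)) atTop (𝓝 (G x)) := by
    intro x hx
    have hGx : ContinuousAt G x := hG.continuousAt (isOpen_ball.mem_nhds (ball_subset_ball (by norm_num) hx))
    rw [tendsto_iff_norm_sub_tendsto_zero]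
    have hsq : Tendsto (fun n => ‖ξ x (n + 1) - G x‖ ^ 2) atTop (𝓝 0) := by
      rw [Metric.tendsto_atTop]
      intro δ hδ
      obtain ⟨r, hr, hrG⟩ := Metric.continuousAt_iff.1 hGx (Real.sqrt (δ / 4)) (Real.sqrt_pos.2 (by positivity))
      have t1 : Tendsto (fun n : ℕ => μ ^ (n + 1)) atTop (𝓝 0) :=
        (tendsto_pow_atTop_nhds_zero_of_lt_one hμ0.le (by linarith)).comp (tendsto_add_atTop_nat 1)
      have t2 : Tendsto (fun n : ℕ => 2 * C / V1 * (s ^ 2) ^ (n + 1)) atTop (𝓝 (2 * C / V1 * 0)) :=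
        ((tendsto_pow_atTop_nhds_zero_of_lt_one (by positivity) (by nlinarith)).comp (tendsto_add_atTop_nat 1)).const_mul _
      rw [mul_zero] at t2
      obtain ⟨n0, hn0⟩ := eventually_atTop.1 ((t1.eventually_lt_const hr).and (t2.eventually_lt_const (by positivity : 0 < δ / 2)))
      refine ⟨n0, fun n hn => ?_⟩
      obtain ⟨hn1, hn2⟩ := hn0 n hn
      have hm : 0 < μ ^ (n + 1) := by positivity
      have e1 := avg (G := G) (B := ball x (μ ^ (n + 1))) measure_ball_lt_top.ne (ξ x (n + 1)) (G x)
        (hint x hx (n + 1) (by omega) _) (hint x hx (n + 1) (by omega) _)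
      have e2 := hξ x hx (n + 1) (by omega)
      have e3 : ∫ w in ball x (μ ^ (n + 1)), ‖G w - G x‖ ^ 2 ≤ (μ ^ (n + 1)) ^ N * V1 * (δ / 4) := by
        rw [← vol_ball x hm, ← smul_eq_mul, ← setIntegral_const]
        refine setIntegral_mono_on (hint x hx (n + 1) (by omega) _) ((BM.const (δ / 4)).on measure_ball_lt_top.ne) measurableSet_ball fun w hw => ?_
        have := hrG (lt_trans (mem_ball.1 hw) hn1)
        rw [dist_eq_norm] at this
        calc _ ≤ Real.sqrt (δ / 4) ^ 2 := by gcongr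
          _ = _ := Real.sq_sqrt (by positivity)
      rw [vol_ball x hm] at e1
      have e4 : ‖ξ x (n + 1) - G x‖ ^ 2 ≤ 2 * C / V1 * (s ^ 2) ^ (n + 1) + δ / 2 := by
        have h5 : ((μ ^ (n + 1)) ^ N * V1) * ‖ξ x (n + 1) - G x‖ ^ 2 ≤ ((μ ^ (n + 1)) ^ N * V1) * (2 * C / V1 * (s ^ 2) ^ (n + 1) + δ / 2) := by
          refine e1.trans ?_
          have : ((μ ^ (n + 1)) ^ N * V1) * (2 * C / V1 * (s ^ 2) ^ (n + 1) + δ / 2) =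
            2 * (C * (s ^ (n + 1)) ^ 2 * (μ ^ (n + 1)) ^ N) + 2 * ((μ ^ (n + 1)) ^ N * V1 * (δ / 4)) := by
            field_simp; ring
          rw [this]; linarith
        exact le_of_mul_le_mul_left h5 (by positivity)
      rw [Real.dist_eq, sub_zero, abs_of_nonneg (by positivity)]
      linarith
    have := hsq.sqrt
    simpa using this
  have dist_lim : ∀ x ∈ ball (0:EE N) (1/2), ∀ n : ℕ, 1 ≤ n → ‖ξ x n - G x‖ ≤ D / (1 - s) * s ^ n := by
    intro x hx n hn
    obtain ⟨k, rfl⟩ : ∃ k, n = k + 1 := ⟨n - 1, by omega⟩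
    have := dist_le_of_le_geometric_of_tendsto s (D * s) hs1 (f := fun n => ξ x (n + 1)) (fun m => by
      rw [dist_eq_norm]
      refine (key x hx x hx (m + 1) (by omega) (by simp; positivity)).trans (le_of_eq (by ring))) (lim x hx) k
    rw [dist_eq_norm] at this
    exact this.trans (le_of_eq (by rw [pow_succ]; ring))
  intro x hx y hy n hn hxy
  have a1 := dist_lim x hx n hn
  have a2 := dist_lim y hy (n + 1) (by omega)
  have a3 := key x hx y hy n hn hxy
  have a4 : D / (1 - s) * s ^ (n + 1) ≤ D / (1 - s) * s ^ n := by
    gcongr ?_ * ?_; exact pow_le_pow_of_le_one hs0.le hs1.le (by omega)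
  have e : G x - G y = -(ξ x n - G x) + (ξ x n - ξ y (n + 1)) + (ξ y (n + 1) - G y) := by abel
  rw [e]
  refine (norm_add₃_le).trans ?_
  rw [norm_neg]; linarith

lemma holder (hN : 1 ≤ N) (hp1 : 1 < p) (hp2 : p < 2) (hβ : 0 < β) : ∃ α C : ℝ, 0 < α ∧ α < 1 ∧ 0 < C ∧
    ∀ U : EE N → ℝ, AM p β U → ∀ x ∈ ball (0:EE N) (1/2), ∀ y ∈ ball (0:EE N) (1/2), ‖gradient U x - gradient U y‖ ≤ C * ‖x - y‖ ^ α := by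
  obtain ⟨q0, C, h0, h1, hC, H⟩ := camp1 (N := N) hN hp1 hp2
  obtain ⟨m, hm⟩ := exists_nat_ge (((N:ℝ) + 1) / β)
  rw [div_le_iff₀ hβ] at hm
  have hm1 : 1 ≤ m := by
    by_contra h
    have : m = 0 := by omega
    rw [this] at hm; push_cast at hm; nlinarith [Nat.cast_nonneg (α := ℝ) N]
  set μ : ℝ := (1/4) ^ (m + 1) with hμ
  have hμ0 : 0 < μ := by positivity
  have hμ4 : μ ≤ 1/4 := pow_le_of_le_one (by norm_num) (by norm_num) (by omega)
  set s := Real.sqrt q0 with hs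
  have hs0 : 0 < s := Real.sqrt_pos.2 h0
  have hs1 : s < 1 := by rw [hs, Real.sqrt_lt' one_pos]; simpa using h1
  obtain ⟨C', hC', HC⟩ := camp (N := N) hμ0 hμ4 hs0 hs1 hC
  have hlμ : Real.log μ < 0 := Real.log_neg hμ0 (by linarith)
  have hls : Real.log s < 0 := Real.log_neg hs0 hs1
  set α := min (1/2) (Real.log s / Real.log μ) with hα
  have hα0 : 0 < α := lt_min (by norm_num) (div_pos_of_neg_of_neg hls hlμ)
  have hsα : s ≤ μ ^ α := by
    calc s = μ ^ (Real.log s / Real.log μ) := by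
          rw [Real.rpow_def_of_pos hμ0, mul_div_cancel₀ _ hlμ.ne, Real.exp_log hs0]
      _ ≤ μ ^ α := Real.rpow_le_rpow_of_exponent_ge hμ0 (by linarith) (min_le_right _ _)
  refine ⟨α, (C' + 2) * ((μ ^ 2) ^ α)⁻¹, hα0, (min_le_left _ _).trans_lt (by norm_num), by positivity, fun U hU x hx y hy => ?_⟩
  have HH := HC (gradient U) hU.cont (fun z hz n hn => by
    obtain ⟨ξ, hξ⟩ := H β U hU z ((1/4) ^ (m * n)) n (by positivity) (by
      apply closedBall_subset_ball'
      have : ((1/4:ℝ)) ^ (m * n) ≤ 1/4 := pow_le_of_le_one (by norm_num) (by norm_num) (by positivity)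
      rw [mem_ball] at hz; linarith) (by
      rw [← Real.rpow_natCast, ← Real.rpow_natCast, ← Real.rpow_mul (by norm_num)]
      apply Real.rpow_le_rpow_of_exponent_ge (by norm_num) (by norm_num)
      push_cast
      have := mul_le_mul_of_nonneg_left hm (Nat.cast_nonneg (α := ℝ) n)
      linarith)
    refine ⟨ξ, ?_⟩
    have e1 : ((1/4:ℝ)) ^ (m * n) * (1/4) ^ n = μ ^ n := by rw [hμ, ← pow_add, ← pow_mul]; congr 1; ring
    have e2 : (s ^ n) ^ 2 = q0 ^ n := by rw [← pow_mul, mul_comm, pow_mul, hs, Real.sq_sqrt h0.le]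
    rw [e1] at hξ
    rw [e2]; exact hξ) x hx y hy
  by_cases hxy : x = y
  · rw [hxy]; simp; positivity
  have hd : 0 < ‖x - y‖ := norm_sub_pos_iff.2 hxy
  have hx1 := hU.bd x (ball_subset_ball (by norm_num) hx)
  have hy1 := hU.bd y (ball_subset_ball (by norm_num) hy)
  have hμα : 0 < (μ ^ 2) ^ α := by positivity
  have hdα : 0 < ‖x - y‖ ^ α := by positivity
  rw [mul_assoc, inv_mul_eq_div]
  rcases lt_or_ge (μ ^ 2) ‖x - y‖ with h | h
  · have e1 : 1 ≤ ‖x - y‖ ^ α / (μ ^ 2) ^ α := by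
      rw [one_le_div hμα]; gcongr
    have e2 := norm_sub_le (gradient U x) (gradient U y)
    nlinarith
  · obtain ⟨n, hn1, hn2⟩ := exists_nat_pow_near_of_lt_one hd (h.trans (pow_le_one₀ hμ0.le (by linarith))) hμ0 (by linarith : μ < 1)
    have hn : 2 ≤ n := by
      by_contra hc
      have : μ ^ 2 ≤ μ ^ (n + 1) := pow_le_pow_of_le_one hμ0.le (by linarith) (by omega)
      linarith
    obtain ⟨k, rfl⟩ : ∃ k, n = k + 1 := ⟨n - 1, by omega⟩
    have e1 := HH k (by omega) hn2
    have e2 : s ^ k ≤ ‖x - y‖ ^ α / (μ ^ 2) ^ α := by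
      rw [le_div_iff₀ hμα]
      calc s ^ k * (μ ^ 2) ^ α ≤ (μ ^ α) ^ k * (μ ^ 2) ^ α := by gcongr
        _ = (μ ^ (k + 1 + 1)) ^ α := by
            rw [← Real.rpow_natCast (μ ^ α), ← Real.rpow_mul hμ0.le, mul_comm α, Real.rpow_mul hμ0.le, Real.rpow_natCast,
              ← Real.mul_rpow (by positivity) (by positivity), ← pow_add]
        _ ≤ _ := by gcongr
    have e3 : 0 ≤ s ^ k := by positivity
    nlinarith

end AP

namespace AP
open Filter Topology
variable {N : ℕ} {p β : ℝ} {u : EE N → ℝ} {Ω : Set (EE N)}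

lemma pow_hol {γ A : ℝ} (hγ : 0 < γ) (hA : 1 ≤ A) {a b : ℝ} (hb : 0 ≤ b) (hab : b ≤ a) (haA : a ≤ A) :
    a ^ γ - b ^ γ ≤ (1 + γ * A ^ γ) * (a - b) ^ (min γ 1) := by
  rcases le_total γ 1 with h | h
  · rw [min_eq_left h]
    have h1 := Real.rpow_add_le_add_rpow hb (sub_nonneg.2 hab) hγ.le h
    rw [add_sub_cancel] at h1
    have h2 : 0 ≤ (a - b) ^ γ := Real.rpow_nonneg (sub_nonneg.2 hab) _
    have h3 : 0 ≤ γ * A ^ γ := by positivity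
    nlinarith [mul_nonneg h3 h2]
  · rw [min_eq_right h, Real.rpow_one]
    rcases (hb.trans hab).eq_or_lt with h0 | h0
    · have : b = 0 := by linarith
      rw [← h0, this]; simp
    · have h1 := one_add_mul_self_le_rpow_one_add (s := b / a - 1) (by have := div_nonneg hb h0.le; linarith) h
      rw [add_sub_cancel, Real.div_rpow hb h0.le, le_div_iff₀ (by positivity)] at h1
      have h2 : a ^ γ = a * a ^ (γ - 1) := by
        rw [← Real.rpow_one_add' h0.le (by linarith)]; congr 1; ring
      have h3 : a ^ (γ - 1) ≤ A ^ γ := (Real.rpow_le_rpow h0.le haA (by linarith)).trans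
        (Real.rpow_le_rpow_of_exponent_le hA (by linarith))
      have h4 : (1 + γ * (b / a - 1)) * a ^ γ = a ^ γ - γ * (a - b) * a ^ (γ - 1) := by
        rw [h2]; field_simp; ring
      rw [h4] at h1
      have h5 : γ * (a - b) * a ^ (γ - 1) ≤ γ * (a - b) * A ^ γ :=
        mul_le_mul_of_nonneg_left h3 (mul_nonneg hγ.le (sub_nonneg.2 hab))
      linarith

lemma pow_hol' {γ A : ℝ} (hγ : 0 < γ) (hA : 1 ≤ A) {t s : ℝ} (ht : |t| ≤ A) (hs : |s| ≤ A) :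
    |max t 0 ^ γ - max s 0 ^ γ| ≤ (1 + γ * A ^ γ) * |t - s| ^ (min γ 1) := by
  wlog hts : s ≤ t generalizing t s
  · rw [abs_sub_comm, abs_sub_comm t]; exact this hs ht (le_of_not_ge hts)
  have h1 : max s 0 ≤ max t 0 := max_le_max hts le_rfl
  have h2 : max t 0 - max s 0 ≤ |t - s| := (le_abs_self _).trans (abs_sup_sub_sup_le_abs t s 0)
  rw [abs_of_nonneg (sub_nonneg.2 (Real.rpow_le_rpow (le_max_right _ _) h1 hγ.le))]
  refine (pow_hol hγ hA (le_max_right _ _) h1 (max_le ((le_abs_self t).trans ht) (by linarith))).trans ?_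
  gcongr

lemma F_hol {γ lp lm A : ℝ} (hγ : 0 < γ) (hlp : 0 < lp) (hlm : 0 < lm) (hA : 1 ≤ A) {t s : ℝ} (ht : |t| ≤ A) (hs : |s| ≤ A) :
    |Fgam γ lp lm t - Fgam γ lp lm s| ≤ ((lp + lm) * (1 + γ * A ^ γ)) * |t - s| ^ (min γ 1) := by
  have h1 := pow_hol' hγ hA ht hs
  have h2 := pow_hol' hγ hA (t := -t) (s := -s) (by rwa [abs_neg]) (by rwa [abs_neg])
  have h3 : |-t - -s| = |t - s| := by rw [← abs_neg]; congr 1; ring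
  rw [h3] at h2
  have e : Fgam γ lp lm t - Fgam γ lp lm s = lp * (max t 0 ^ γ - max s 0 ^ γ) + lm * (max (-t) 0 ^ γ - max (-s) 0 ^ γ) := by
    unfold Fgam; ring
  rw [e]
  refine (abs_add_le _ _).trans ?_
  rw [abs_mul, abs_mul, abs_of_pos hlp, abs_of_pos hlm]
  have h4 := mul_le_mul_of_nonneg_left h1 hlp.le
  have h5 := mul_le_mul_of_nonneg_left h2 hlm.le
  linarith

lemma F_cont {γ : ℝ} (lp lm : ℝ) (hγ : 0 < γ) : Continuous (Fgam γ lp lm) := by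
  unfold Fgam
  exact (continuous_const.mul ((continuous_id.max continuous_const).rpow_const fun _ => Or.inr hγ.le)).add
    (continuous_const.mul ((continuous_neg.max continuous_const).rpow_const fun _ => Or.inr hγ.le))

lemma cv (v : EE N → ℝ) (b : ℝ) {c ρ0 L : ℝ} (z z' : EE N) (R : ℝ) (hL : 0 < L) (hρ : 0 < ρ0) (hc : c * ρ0 = L⁻¹) :
    ∫ x in ball (z + ρ0 • z') (ρ0 * R), ‖gradient v x‖ ^ p / p =
      (ρ0 ^ N * L ^ p) * ∫ y in ball z' R, ‖gradient (fun y => b + c * v (z + ρ0 • y)) y‖ ^ p / p := by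
  have h1 := cov (fun y => ‖gradient (fun y => b + c * v (z + ρ0 • y)) y‖ ^ p / p) z' (R := R) one_pos
  rw [one_mul, one_pow, one_mul] at h1
  rw [h1, cov _ _ hρ, mul_assoc, ← integral_const_mul (L ^ p)]
  congr 2
  funext y
  rw [grad_aff, hc, norm_smul, Real.norm_of_nonneg (by positivity), Real.mul_rpow (by positivity) (by positivity),
    Real.inv_rpow hL.le, one_smul, smul_add, add_assoc]
  field_simp

lemma AM_of {F : ℝ → ℝ} (hN : 1 ≤ N) (hp1 : 1 < p) (hF : Continuous F) {M A CF ρ0 L : ℝ} (hCF : 0 ≤ CF) (hβ : 0 < β)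
    (hFA : ∀ t s, |t| ≤ M + A → |s| ≤ M + A → |F t - F s| ≤ CF * |t - s| ^ β)
    (hu : APLocMin N p F Ω u) (huM : ∀ x ∈ Ω, |u x| ≤ M) (hρ : 0 < ρ0) (hL : 0 < L) (z : EE N)
    (hb : ball z ρ0 ⊆ Ω) (hg : ∀ x ∈ ball z ρ0, ‖gradient u x‖ ≤ L) (hA : 4 * (ρ0 * L) ≤ A)
    (hK : CF * (4 * (ρ0 * L)) ^ β * volume.real (ball (0:EE N) 2) ≤ L ^ p) :
    AM p β (fun y => -((ρ0 * L)⁻¹ * u z) + (ρ0 * L)⁻¹ * u (z + ρ0 • y)) := by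
  set c := (ρ0 * L)⁻¹ with hc
  have hc0 : 0 < c := by positivity
  have hcρ : c * ρ0 = L⁻¹ := by rw [hc]; field_simp
  have hmem : ∀ y ∈ ball (0:EE N) 1, z + ρ0 • y ∈ ball z ρ0 := fun y hy => by
    have := (mem_ball_aff (z := z) hρ).2 hy; rwa [mul_one] at this
  obtain ⟨ud, uc, -, um⟩ := hu
  constructor
  · intro x hx
    have h1 := ud _ (hb (hmem x hx))
    exact ((h1.comp x (by fun_prop : DifferentiableAt ℝ (fun y : EE N => z + ρ0 • y) x)).const_mul c).const_add _
  · have e : gradient (fun y => -(c * u z) + c * u (z + ρ0 • y)) = fun y => (c * ρ0) • gradient u (z + ρ0 • y) :=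
      funext fun y => grad_aff _ _ _ _ _ _
    rw [e]
    exact ContinuousOn.const_smul (uc.comp (Continuous.continuousOn (by fun_prop : Continuous fun y : EE N => z + ρ0 • y)) fun y hy => hb (hmem y hy)) (c * ρ0)
  · intro x hx
    rw [grad_aff, hcρ, norm_smul, Real.norm_of_nonneg (by positivity), inv_mul_le_iff₀ hL, mul_one]
    exact hg _ (hmem x hx)
  · intro z' ρ hρ' hz' W K hW hWs hWU
    set w : EE N → ℝ := fun x => u z + (ρ0 * L) * W (ρ0⁻¹ • (x - z)) with hw
    set a := z + ρ0 • z' with ha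
    set r := ρ0 * (ρ * 2) with hr
    have hr0 : 0 < r := by positivity
    have hWw : W = fun y => -(c * u z) + c * w (z + ρ0 • y) := by
      funext y
      simp only [hw, add_sub_cancel_left, smul_smul, inv_mul_cancel₀ hρ.ne', one_smul]
      rw [mul_add, ← mul_assoc, hc, inv_mul_cancel₀ (by positivity)]; ring
    have hpt : ∀ x, ∃ y, x = z + ρ0 • y ∧ y = ρ0⁻¹ • (x - z) := fun x => ⟨_, by
      rw [smul_smul, mul_inv_cancel₀ hρ.ne', one_smul, add_sub_cancel], rfl⟩
    have hdist : ∀ y, dist (z + ρ0 • y) a = ρ0 * dist y z' := fun y => by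
      rw [ha, dist_add_left, dist_smul₀, Real.norm_of_nonneg hρ.le]
    have hcb : ∀ y, z + ρ0 • y ∈ closedBall a r → y ∈ closedBall z' (ρ * 2) := fun y hy => by
      rw [mem_closedBall, hdist] at hy
      exact le_of_mul_le_mul_left hy hρ
    have hcb1 : closedBall a r ⊆ Ω := by
      intro x hx
      obtain ⟨y, rfl, -⟩ := hpt x
      exact hb (hmem y (hz' (hcb y hx)))
    have hwW : ∀ y, w (z + ρ0 • y) = u z + (ρ0 * L) * W y := fun y => by
      simp only [hw, add_sub_cancel_left, smul_smul, inv_mul_cancel₀ hρ.ne', one_smul]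
    have hdiff : ∀ y, w (z + ρ0 • y) - u (z + ρ0 • y) = (ρ0 * L) * (W y - (-(c * u z) + c * u (z + ρ0 • y))) := fun y => by
      rw [hwW, hc]; field_simp; ring
    have hws : EqOn w u (sphere a r) := by
      intro x hx
      obtain ⟨y, rfl, -⟩ := hpt x
      rw [mem_sphere, hdist] at hx
      have h1 := hWs y (mul_left_cancel₀ hρ.ne' hx)
      have h2 := hdiff y
      rw [h1, sub_self, mul_zero] at h2
      linarith
    have hwd : ∀ x ∈ closedBall a r, |w x - u x| ≤ 4 * (ρ0 * L) * ρ := by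
      intro x hx
      obtain ⟨y, rfl, -⟩ := hpt x
      rw [hdiff, abs_mul, abs_of_pos (by positivity : 0 < ρ0 * L)]
      have := mul_le_mul_of_nonneg_left (hWU y (hcb y hx)) (by positivity : 0 ≤ ρ0 * L)
      linarith
    have hwl : LipschitzOnWith (L.toNNReal * K) w (closedBall a r) := by
      refine LipschitzOnWith.of_dist_le_mul fun x hx x' hx' => ?_
      obtain ⟨y, rfl, -⟩ := hpt x
      obtain ⟨y', rfl, -⟩ := hpt x'
      have := hW.dist_le_mul _ (hcb y hx) _ (hcb y' hx')
      rw [hwW, hwW, dist_add_left, dist_add_left, dist_smul₀, Real.norm_of_nonneg hρ.le, NNReal.coe_mul, Real.coe_toNNReal _ hL.le,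
        Real.dist_eq, ← mul_sub, abs_mul, abs_of_pos (by positivity : 0 < ρ0 * L)]
      rw [Real.dist_eq] at this
      have := mul_le_mul_of_nonneg_left this (by positivity : 0 ≤ ρ0 * L)
      linarith
    have hρ1 : ρ ≤ 1 := by
      set e : EE N := EuclideanSpace.single ⟨0, hN⟩ 1 with he
      have hn : ‖e‖ = 1 := by rw [he, EuclideanSpace.norm_single, norm_one]
      have h1 : z' + (ρ * 2) • e ∈ ball (0:EE N) 1 := hz' (by
        rw [mem_closedBall_iff_norm, add_sub_cancel_left, norm_smul, hn, mul_one, Real.norm_of_nonneg (by positivity)])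
      have h2 : z' ∈ ball (0:EE N) 1 := hz' (mem_closedBall_self (by positivity))
      rw [mem_ball_zero_iff] at h1 h2
      have h3 := norm_sub_le (z' + (ρ * 2) • e) z'
      rw [add_sub_cancel_left, norm_smul, hn, mul_one, Real.norm_of_nonneg (by positivity)] at h3
      linarith
    have huc : ContinuousOn u (closedBall a r) := fun x hx => (ud x (hcb1 hx)).continuousAt.continuousWithinAt
    have hvf : volume (ball a r) ≠ ⊤ := measure_ball_lt_top.ne
    have i1 : IntegrableOn (fun x => ‖gradient u x‖ ^ p / p) (ball a r) := by
      have : ContinuousOn (fun x => ‖gradient u x‖ ^ p / p) (closedBall a r) :=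
        (((uc.mono hcb1).norm).rpow_const fun x _ => Or.inr (by linarith)).div_const _
      exact (this.integrableOn_compact (isCompact_closedBall _ _)).mono_set ball_subset_closedBall
    have i2 : IntegrableOn (fun x => F (u x)) (ball a r) :=
      ((hF.comp_continuousOn huc).integrableOn_compact (isCompact_closedBall _ _)).mono_set ball_subset_closedBall
    have i4 : IntegrableOn (fun x => F (w x)) (ball a r) :=
      ((hF.comp_continuousOn hwl.continuousOn).integrableOn_compact (isCompact_closedBall _ _)).mono_set ball_subset_closedBall
    have i3 : IntegrableOn (fun x => ‖gradient w x‖ ^ p / p) (ball a r) := by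
      refine Measure.integrableOn_of_bounded (M := (L.toNNReal * K : NNReal) ^ p / p) hvf
        (((grad_meas w).norm.pow_const p).div_const p).aestronglyMeasurable ?_
      rw [ae_restrict_iff' measurableSet_ball]
      refine Eventually.of_forall fun x hx => ?_
      have h1 : ‖gradient w x‖ ≤ (L.toNNReal * K : NNReal) := by
        rw [norm_grad]
        exact norm_fderiv_le_of_lipschitzOn ℝ (mem_of_superset (isOpen_ball.mem_nhds hx) ball_subset_closedBall) hwl
      rw [Real.norm_of_nonneg (by positivity)]
      gcongr
    have m := um a r hr0 (by rwa [closure_ball a hr0.ne']) w _ (by rw [closure_ball a hr0.ne']; exact hwl) hws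
    rw [integral_add i1 i2, integral_add i3 i4] at m
    have hFd : (∫ x in ball a r, F (w x)) - (∫ x in ball a r, F (u x)) ≤ CF * (4 * (ρ0 * L) * ρ) ^ β * volume.real (ball a r) := by
      rw [← integral_sub i4 i2, mul_comm _ (volume.real _), ← smul_eq_mul (volume.real _), ← setIntegral_const]
      refine setIntegral_mono_on (i4.sub i2) ((BM.const _).on hvf) measurableSet_ball fun x hx => ?_
      have hx' := ball_subset_closedBall hx
      have h1 := huM x (hcb1 hx')
      have h2 := hwd x hx'
      have hA' : 4 * (ρ0 * L) * ρ ≤ A := by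
        have : 4 * (ρ0 * L) * ρ ≤ 4 * (ρ0 * L) * 1 := by gcongr
        linarith
      have h3 : |w x| ≤ M + A := by
        have := abs_add_le (w x - u x) (u x)
        rw [sub_add_cancel] at this; linarith
      have h4 : |u x| ≤ M + A := by have := abs_nonneg (w x - u x); linarith
      refine (le_abs_self _).trans ((hFA _ _ h3 h4).trans ?_)
      gcongr
    have hvol : volume.real (ball a r) = ρ0 ^ N * (ρ ^ N * volume.real (ball (0:EE N) 2)) := by
      rw [vol_ball a hr0, vol_ball (0:EE N) two_pos, hr, mul_pow, mul_pow]; ring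
    rw [hvol, Real.mul_rpow (by positivity) hρ'.le] at hFd
    have e1 := cv (p := p) u (-(c * u z)) z z' (ρ * 2) hL hρ hcρ
    have e2 := cv (p := p) w (-(c * u z)) z z' (ρ * 2) hL hρ hcρ
    rw [← hWw] at e2
    rw [e1, e2] at m
    have hK' := mul_le_mul_of_nonneg_left hK (by positivity : 0 ≤ ρ0 ^ N * (ρ ^ N * ρ ^ β))
    have hpos : 0 < ρ0 ^ N * L ^ p := by positivity
    refine le_of_mul_le_mul_left ?_ hpos
    rw [mul_add]
    linarith
end AP

namespace AP
open Filter Topology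
variable {N : ℕ} {p β : ℝ}

lemma grad_sub_fd (f : EE N → ℝ) (x y : EE N) : ‖fderiv ℝ f x - fderiv ℝ f y‖ = ‖gradient f x - gradient f y‖ := by
  unfold gradient
  rw [← map_sub, LinearIsometryEquiv.norm_map]

lemma nondeg {U : EE N → ℝ} {θ : ℝ} (h : AM p β U) (hθ : 0 < θ) (hθ1 : θ < 1) (h0 : ‖gradient U 0‖ = 1/2)
    (hθg : ∀ x ∈ closedBall (0:EE N) θ, ‖gradient U x - gradient U 0‖ ≤ 1/4) :
    ∃ y ∈ ball (0:EE N) 1, θ / 4 ≤ |U y - U 0| := by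
  set e : EE N := (2:ℝ) • gradient U 0 with he
  have hn : ‖e‖ = 1 := by rw [he, norm_smul, h0]; norm_num
  have hy : θ • e ∈ closedBall (0:EE N) θ := by
    rw [mem_closedBall_zero_iff, norm_smul, hn, mul_one, Real.norm_of_nonneg hθ.le]
  have hss : closedBall (0:EE N) θ ⊆ ball (0:EE N) 1 := closedBall_subset_ball hθ1
  refine ⟨θ • e, hss hy, ?_⟩
  have k := (convex_closedBall (0:EE N) θ).norm_image_sub_le_of_norm_fderiv_le' (𝕜 := ℝ) (f := U) (C := 1/4) (φ := fderiv ℝ U 0)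
    (fun x hx => h.dif x (hss hx)) (fun x hx => by rw [grad_sub_fd]; exact hθg x hx)
    (mem_closedBall_self hθ.le) hy
  have hd : fderiv ℝ U 0 (θ • e) = θ / 2 := by
    have hg := (h.dif 0 (hss (mem_closedBall_self hθ.le))).hasGradientAt.hasFDerivAt
    rw [hg.fderiv, InnerProductSpace.toDual_apply_apply, inner_smul_right, he, inner_smul_right, real_inner_self_eq_norm_sq, h0]
    ring
  rw [sub_zero, hd, norm_smul, hn, mul_one, Real.norm_of_nonneg hθ.le, Real.norm_eq_abs] at k
  have := abs_le.1 k
  refine le_trans ?_ (le_abs_self _)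
  linarith [this.1]

theorem grad_bd (hN : 1 ≤ N) (hp1 : 1 < p) (hp2 : p < 2) (hβ : 0 < β) {M : ℝ} (hM : 0 < M) :
    ∃ A : ℝ, 1 ≤ A ∧ ∀ CF d' : ℝ, 0 ≤ CF → 0 < d' → ∃ Cg : ℝ, 0 < Cg ∧ ∀ F : ℝ → ℝ, Continuous F →
      (∀ t s, |t| ≤ M + A → |s| ≤ M + A → |F t - F s| ≤ CF * |t - s| ^ β) → ∀ (Ω : Set (EE N)) (u : EE N → ℝ),
      APLocMin N p F Ω u → (∀ x ∈ Ω, |u x| ≤ M) → ∀ x, closedBall x d' ⊆ Ω → ‖gradient u x‖ ≤ Cg := by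
  obtain ⟨α, C, hα0, hα1, hC, H⟩ := holder (N := N) hN hp1 hp2 hβ
  obtain ⟨θ, hθ0, hθ1, hθC⟩ : ∃ θ : ℝ, 0 < θ ∧ θ < 1/2 ∧ C * θ ^ α ≤ 1/4 := by
    have hq : 0 < 1 / (4 * C) := by positivity
    refine ⟨min (1/4) ((1 / (4 * C)) ^ (1/α)), by positivity, (min_le_left _ _).trans_lt (by norm_num), ?_⟩
    have : (min (1/4) ((1 / (4 * C)) ^ (1/α))) ^ α ≤ 1 / (4 * C) := by
      refine (Real.rpow_le_rpow (by positivity) (min_le_right _ _) hα0.le).trans ?_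
      rw [← Real.rpow_mul hq.le, one_div_mul_cancel hα0.ne', Real.rpow_one]
    refine (mul_le_mul_of_nonneg_left this hC.le).trans (le_of_eq ?_)
    field_simp
  set K0 := 16 * M / θ with hK0
  have hK0p : 0 < K0 := by positivity
  refine ⟨4 * K0 + 1, by linarith, fun CF d' hCF hd' => ?_⟩
  set V2 := volume.real (ball (0:EE N) 2) with hV2
  have hV2p : 0 ≤ V2 := measureReal_nonneg
  set L1 := 1 + CF * (4 * K0) ^ β * V2 with hL1
  have hL1p : 1 ≤ L1 := by
    have : 0 ≤ CF * (4 * K0) ^ β * V2 := by positivity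
    linarith
  refine ⟨L1 + K0 / d', by positivity, fun F hF hFA Ω u hu huM x hx => ?_⟩
  by_contra! hcon
  have hgc : ContinuousOn (fun y => ‖gradient u y‖) (closedBall x d') := (hu.2.1.mono hx).norm
  obtain ⟨x0, hx0, hmax⟩ := (isCompact_closedBall x d').exists_isMaxOn (nonempty_closedBall.2 hd'.le)
    (f := fun y => (d' - ‖y - x‖) * ‖gradient u y‖) (ContinuousOn.mul (Continuous.continuousOn (by fun_prop)) hgc)
  have hmax' : ∀ y ∈ closedBall x d', (d' - ‖y - x‖) * ‖gradient u y‖ ≤ (d' - ‖x0 - x‖) * ‖gradient u x0‖ := fun y hy => hmax hy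
  set s := d' - ‖x0 - x‖ with hs
  set g := ‖gradient u x0‖ with hg
  have hg0 : 0 ≤ g := norm_nonneg _
  have hs0 : 0 ≤ s := by rw [mem_closedBall_iff_norm] at hx0; linarith
  have hsd : s ≤ d' := by have := norm_nonneg (x0 - x); linarith
  have h1 := hmax' x (mem_closedBall_self hd'.le)
  rw [sub_self, norm_zero, sub_zero] at h1
  have h2 : d' * (L1 + K0 / d') < s * g := (mul_lt_mul_of_pos_left hcon hd').trans_le h1
  have h2' : d' * L1 + K0 < s * g := by
    have : d' * (L1 + K0 / d') = d' * L1 + K0 := by field_simp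
    linarith
  have hgL : L1 < g := by
    by_contra! hh
    have : s * g ≤ d' * L1 := by gcongr
    linarith
  have hgp : 0 < g := by linarith
  have hsp : 0 < s := by
    rcases hs0.eq_or_lt with h | h
    · rw [← h, zero_mul] at h2'
      have : 0 < d' * L1 := by positivity
      linarith
    · exact h
  have hL : 0 < 2 * g := by linarith
  have hρ0 : 0 < K0 / (2 * g) := by positivity
  have hρL : K0 / (2 * g) * (2 * g) = K0 := div_mul_cancel₀ _ hL.ne'
  have hρs : K0 / (2 * g) ≤ s / 2 := by
    rw [div_le_div_iff₀ hL two_pos]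
    have : 0 < d' * L1 := by positivity
    linarith
  have hbb : ∀ y ∈ ball x0 (K0 / (2 * g)), ‖y - x‖ ≤ d' - s / 2 := by
    intro y hy
    rw [mem_ball_iff_norm] at hy
    have := norm_sub_le_norm_sub_add_norm_sub y x0 x
    linarith
  have hin : ∀ y ∈ ball x0 (K0 / (2 * g)), y ∈ closedBall x d' := fun y hy => by
    rw [mem_closedBall_iff_norm]; have := hbb y hy; linarith
  have hgl : ∀ y ∈ ball x0 (K0 / (2 * g)), ‖gradient u y‖ ≤ 2 * g := by
    intro y hy
    have k1 := hmax' y (hin y hy)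
    have k2 := hbb y hy
    have k3 : s / 2 * ‖gradient u y‖ ≤ (d' - ‖y - x‖) * ‖gradient u y‖ := by
      apply mul_le_mul_of_nonneg_right _ (norm_nonneg _); linarith
    have k4 : s / 2 * ‖gradient u y‖ ≤ s / 2 * (2 * g) := by linarith
    exact le_of_mul_le_mul_left k4 (by positivity)
  have am := AM_of (β := β) hN hp1 hF hCF hβ hFA hu huM hρ0 hL x0 (fun y hy => hx (hin y hy)) hgl
    (by rw [hρL]; linarith) (by
      rw [hρL]
      have : (2 * g) ^ (1:ℝ) ≤ (2 * g) ^ p := Real.rpow_le_rpow_of_exponent_le (by linarith) hp1.le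
      rw [Real.rpow_one] at this
      linarith)
  rw [hρL] at am
  have hU0 : ‖gradient (fun y => -(K0⁻¹ * u x0) + K0⁻¹ * u (x0 + (K0 / (2 * g)) • y)) 0‖ = 1/2 := by
    rw [grad_aff, smul_zero, add_zero, norm_smul, ← hg, Real.norm_of_nonneg (by positivity)]
    field_simp
  obtain ⟨y, hy, hyy⟩ := nondeg am hθ0 (by linarith) hU0 (fun x hx => by
    have hx' := mem_closedBall_zero_iff.1 hx
    refine (H _ am x (by rw [mem_ball_zero_iff]; linarith) 0 (mem_ball_self (by norm_num))).trans (le_trans ?_ hθC)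
    rw [sub_zero]
    gcongr)
  have hyb : x0 + (K0 / (2 * g)) • y ∈ ball x0 (K0 / (2 * g)) := by
    have := (mem_ball_aff (z := x0) hρ0).2 hy; rwa [mul_one] at this
  have b1 := huM _ (hx (hin _ hyb))
  have b2 := huM _ (hx (hin _ (mem_ball_self hρ0)))
  have e : -(K0⁻¹ * u x0) + K0⁻¹ * u (x0 + (K0 / (2 * g)) • y) - (-(K0⁻¹ * u x0) + K0⁻¹ * u (x0 + (K0 / (2 * g)) • (0:EE N)))
      = K0⁻¹ * (u (x0 + (K0 / (2 * g)) • y) - u x0) := by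
    rw [smul_zero, add_zero]; ring
  rw [e, abs_mul, abs_of_pos (by positivity)] at hyy
  have b3 : |u (x0 + (K0 / (2 * g)) • y) - u x0| ≤ 2 * M := by
    have := abs_sub (u (x0 + (K0 / (2 * g)) • y)) (u x0); linarith
  have b4 : K0⁻¹ * |u (x0 + (K0 / (2 * g)) • y) - u x0| ≤ K0⁻¹ * (2 * M) := by gcongr
  have b5 : K0⁻¹ * (2 * M) = θ / 8 := by rw [hK0]; field_simp; norm_num
  linarith

theorem final (hN : 1 ≤ N) (hp1 : 1 < p) (hp2 : p < 2) (hβ : 0 < β) {M : ℝ} (hM : 0 < M) :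
    ∃ A : ℝ, 1 ≤ A ∧ ∀ CF d : ℝ, 0 ≤ CF → 0 < d → ∃ α C1 : ℝ, 0 < α ∧ α < 1 ∧ 0 < C1 ∧ ∀ F : ℝ → ℝ, Continuous F →
      (∀ t s, |t| ≤ M + A → |s| ≤ M + A → |F t - F s| ≤ CF * |t - s| ^ β) → ∀ (Ω : Set (EE N)) (u : EE N → ℝ),
      APLocMin N p F Ω u → (∀ x ∈ Ω, |u x| ≤ M) → ∀ Ω' : Set (EE N), (∀ x ∈ Ω', ball x d ⊆ Ω) →
      (∀ x ∈ Ω', ‖gradient u x‖ ≤ C1) ∧ (∀ x ∈ Ω', ∀ y ∈ Ω', ‖gradient u x - gradient u y‖ ≤ C1 * ‖x - y‖ ^ α) := by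
  obtain ⟨A, hA, HG⟩ := grad_bd (N := N) hN hp1 hp2 hβ hM
  obtain ⟨α, C, hα0, hα1, hC, H⟩ := holder (N := N) hN hp1 hp2 hβ
  refine ⟨A, hA, fun CF d hCF hd => ?_⟩
  obtain ⟨Cg, hCg, HG⟩ := HG CF (d / 4) hCF (by positivity)
  set L := Cg + 1 with hL
  have hLp : 0 < L := by positivity
  set V2 := volume.real (ball (0:EE N) 2) with hV2
  have hV2p : 0 ≤ V2 := measureReal_nonneg
  set T := 1 + CF * V2 with hT
  have hTp : 0 < T := by positivity
  set τ := min 1 ((1 / T) ^ (1 / β)) with hτ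
  have hτp : 0 < τ := by positivity
  set ρ0 := min (d / 2) (τ / (4 * L)) with hρ0
  have hρ : 0 < ρ0 := by positivity
  have hρd : ρ0 ≤ d / 2 := min_le_left _ _
  have h4 : 4 * (ρ0 * L) ≤ τ := by
    have : ρ0 ≤ τ / (4 * L) := min_le_right _ _
    rw [le_div_iff₀ (by positivity)] at this
    linarith
  have hKK : CF * (4 * (ρ0 * L)) ^ β * V2 ≤ L ^ p := by
    have h5 : (4 * (ρ0 * L)) ^ β ≤ 1 / T := by
      refine (Real.rpow_le_rpow (by positivity) (h4.trans (min_le_right _ _)) hβ.le).trans ?_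
      rw [← Real.rpow_mul (by positivity), one_div_mul_cancel hβ.ne', Real.rpow_one]
    have h6 : CF * (4 * (ρ0 * L)) ^ β * V2 ≤ CF * (1 / T) * V2 := by gcongr
    have h7 : CF * (1 / T) * V2 ≤ 1 := by
      have : CF * (1 / T) * V2 = (CF * V2) / T := by ring
      rw [this, div_le_one hTp]; linarith
    exact (h6.trans h7).trans (Real.one_le_rpow (by linarith) (by linarith))
  refine ⟨α, Cg + L * C * (1 / ρ0) ^ α + 2 * L * (2 / ρ0) ^ α, hα0, hα1, by positivity, fun F hF hFA Ω u hu huM Ω' hΩ' => ?_⟩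
  have hP1 : 0 ≤ L * C * (1 / ρ0) ^ α := by positivity
  have hP2 : 0 ≤ 2 * L * (2 / ρ0) ^ α := by positivity
  have hgb : ∀ x ∈ Ω', ∀ y ∈ ball x ρ0, ‖gradient u y‖ ≤ Cg := by
    intro x hx y hy
    refine HG F hF hFA Ω u hu huM y (Subset.trans (closedBall_subset_ball' ?_) (hΩ' x hx))
    rw [mem_ball] at hy; linarith
  refine ⟨fun x hx => (hgb x hx x (mem_ball_self hρ)).trans (by linarith), fun x hx y hy => ?_⟩
  have hnn : 0 ≤ ‖x - y‖ ^ α := by positivity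
  rcases lt_or_ge ‖x - y‖ (ρ0 / 2) with hxy | hxy
  · have am := AM_of (β := β) hN hp1 hF hCF hβ hFA hu huM hρ hLp x
      ((ball_subset_ball (by linarith)).trans (hΩ' x hx)) (fun y hy => (hgb x hx y hy).trans (by linarith))
      (h4.trans ((min_le_left _ _).trans hA)) hKK
    have hn : ‖(0:EE N) - ρ0⁻¹ • (y - x)‖ = 1 / ρ0 * ‖x - y‖ := by
      rw [zero_sub, norm_neg, norm_smul, Real.norm_of_nonneg (by positivity), norm_sub_rev, one_div]
    have k := H _ am 0 (mem_ball_self (by norm_num)) (ρ0⁻¹ • (y - x)) (by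
      rw [mem_ball_zero_iff, norm_smul, Real.norm_of_nonneg (by positivity), norm_sub_rev, inv_mul_lt_iff₀ hρ]; linarith)
    rw [grad_aff, grad_aff, hn, smul_zero, add_zero, smul_smul, mul_inv_cancel₀ hρ.ne', one_smul, add_sub_cancel, ← smul_sub,
      norm_smul, Real.norm_of_nonneg (by positivity), Real.mul_rpow (by positivity) (by positivity)] at k
    have hc : (ρ0 * L)⁻¹ * ρ0 = L⁻¹ := by field_simp
    rw [hc, inv_mul_le_iff₀ hLp] at k
    have q1 : 0 ≤ Cg * ‖x - y‖ ^ α := by positivity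
    have q2 : 0 ≤ 2 * L * (2 / ρ0) ^ α * ‖x - y‖ ^ α := by positivity
    linarith
  · have k1 := hgb x hx x (mem_ball_self hρ)
    have k2 := hgb y hy y (mem_ball_self hρ)
    have k3 := norm_sub_le (gradient u x) (gradient u y)
    have k4 : 1 ≤ (2 / ρ0) ^ α * ‖x - y‖ ^ α := by
      rw [← Real.mul_rpow (by positivity) (by positivity)]
      refine Real.one_le_rpow ?_ hα0.le
      rw [div_mul_eq_mul_div, le_div_iff₀ hρ]; linarith
    have k5 : 2 * L * 1 ≤ 2 * L * ((2 / ρ0) ^ α * ‖x - y‖ ^ α) := by gcongr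
    have q1 : 0 ≤ Cg * ‖x - y‖ ^ α := by positivity
    have q2 : 0 ≤ L * C * (1 / ρ0) ^ α * ‖x - y‖ ^ α := by positivity
    linarith

lemma ball_sub {Ω : Set (EE N)} {x : EE N} {d : ℝ} (hx : x ∈ Ω) (hd : 0 < d)
    (hO : IsOpen Ω) (h : d ≤ infDist x (frontier Ω)) : ball x d ⊆ Ω := by
  refine (convex_ball x d).isPreconnected.subset_left_of_subset_union hO isClosed_closure.isOpen_compl
    (disjoint_compl_right_iff_subset.2 subset_closure) (fun w hw => ?_) ⟨x, mem_ball_self hd, hx⟩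
  by_contra hc
  simp only [mem_union, mem_compl_iff, not_or, not_not] at hc
  have hwf : w ∈ frontier Ω := by rw [hO.frontier_eq]; exact ⟨hc.2, hc.1⟩
  have := infDist_le_dist_of_mem (x := x) hwf
  rw [mem_ball'] at hw
  linarith

end AP
theorem stmt1 (N : ℕ) (hN : 1 ≤ N) (p γ lp lm δ₀ M d : ℝ)
    (hp1 : 1 < p) (hp2 : p < 2) (hγ0 : 0 < γ) (hγp : γ < p) (hlp : 0 < lp) (hlm : 0 < lm)
    (hδ₀ : 0 < δ₀) (hM : 0 < M) (hd : 0 < d) :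
    ∃ α C₁ : ℝ, α ∈ Set.Ioo (0 : ℝ) 1 ∧ 0 < C₁ ∧
      ∀ (Ω : Set (EuclideanSpace ℝ (Fin N))), IsOpen Ω → Bornology.IsBounded Ω →
      ∀ δ : ℝ, 0 ≤ δ → δ ≤ δ₀ →
      ∀ u : EuclideanSpace ℝ (Fin N) → ℝ,
        APLocMin N p (fun t => δ * Fgam γ lp lm t) Ω u →
        (∀ x ∈ Ω, |u x| ≤ M) →
      ∀ Ω' : Set (EuclideanSpace ℝ (Fin N)), Ω' ⊆ Ω →
        (∀ x ∈ Ω', d ≤ Metric.infDist x (frontier Ω)) →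
        (∀ x ∈ Ω', ‖gradient u x‖ ≤ C₁) ∧
        (∀ x ∈ Ω', ∀ y ∈ Ω',
          ‖gradient u x - gradient u y‖ ≤ C₁ * ‖x - y‖ ^ α) := by
  have hβ : 0 < min γ 1 := lt_min hγ0 one_pos
  obtain ⟨A, hA, H⟩ := AP.final (N := N) hN hp1 hp2 hβ hM
  have hMA : 1 ≤ M + A := by linarith
  obtain ⟨α, C1, h0, h1, hC1, H⟩ := H (δ₀ * ((lp + lm) * (1 + γ * (M + A) ^ γ))) d (by positivity) hd
  refine ⟨α, C1, ⟨h0, h1⟩, hC1, fun Ω hO _ δ hδ hδ1 u hu huM Ω' hΩ' hd' => ?_⟩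
  refine H (fun t => δ * Fgam γ lp lm t) (continuous_const.mul (AP.F_cont lp lm hγ0)) (fun t s ht hs => ?_) Ω u hu huM Ω'
    fun x hx => AP.ball_sub (hΩ' hx) hd hO (hd' x hx)
  rw [← mul_sub, abs_mul, abs_of_nonneg hδ, mul_assoc]
  exact mul_le_mul hδ1 (AP.F_hol hγ0 hlp hlm hMA ht hs) (abs_nonneg _) hδ₀.le
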